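/- arXiv:2407.10565 — 4 statements merged into one kernel-verified Lean document; each statement's English description precedes it below -/
import Mathlib

section
/- Let 0 < ε < 2^{−12}. For every δ > 0 there exists N such that for all n ≥ N and all integers 2 ≤ ℓ ≤ ε^{16}·n, a uniformly random ℓ-lift of K_n contains, with probability at least 1 − δ, a topological clique of order at least (1−43ε)·√(2nℓ/(1−1/ℓ)). -/
/-- The `ℓ`-lift of the complete graph `K_n` determined by a family of permutations
`σ` (only the values `σ i j` for `i < j` matter): vertices `(i,a)` and `(j, σ i j a)`
are adjacent for `i < j`. -/
def liftGraph (n ℓ : ℕ) (σ : Fin n → Fin n → Equiv.Perm (Fin ℓ)) :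
    SimpleGraph (Fin n × Fin ℓ) :=
  SimpleGraph.fromRel (fun x y => x.1 < y.1 ∧ σ x.1 y.1 x.2 = y.2)

/-- The proportion of `ℓ`-lifts of `K_n` (all chosen uniformly at random) whose lift
graph satisfies the property `p`. -/
noncomputable def liftProb (n ℓ : ℕ) (p : SimpleGraph (Fin n × Fin ℓ) → Prop) : ℝ :=
  ((@Finset.filter _ (fun σ : Fin n → Fin n → Equiv.Perm (Fin ℓ) => p (liftGraph n ℓ σ))
      (Classical.decPred _) Finset.univ).card : ℝ)
    / (Fintype.card (Fin n → Fin n → Equiv.Perm (Fin ℓ)) : ℝ)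

/-- `f : Fin m → V` is the family of branch vertices of a topological clique of order `m`
in `G`: `f` is injective and there are pairwise internally vertex-disjoint paths between
the branch vertices whose internal vertices avoid all branch vertices. -/
def HasTopCliqueFun {V : Type*} (G : SimpleGraph V) {m : ℕ} (f : Fin m → V) : Prop :=
  Function.Injective f ∧
  ∃ P : ∀ i j : Fin m, G.Walk (f i) (f j),
    (∀ i j : Fin m, i < j → (P i j).IsPath) ∧
    (∀ i j : Fin m, i < j → ∀ k : Fin m, f k ∉ (P i j).support.tail.dropLast) ∧
    (∀ i j i' j' : Fin m, i < j → i' < j' → (i, j) ≠ (i', j') →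
      ∀ x, x ∈ (P i j).support.tail.dropLast → x ∉ (P i' j').support.tail.dropLast)

/-- `G` contains a topological clique of order `m` (a subdivision of `K_m`). -/
def HasTopClique {V : Type*} (G : SimpleGraph V) (m : ℕ) : Prop :=
  ∃ f : Fin m → V, HasTopCliqueFun G f

namespace LiftClique

open Finset

section Probability

/-- The average of `f` over a finite type. -/
noncomputable def ex {Ω : Type*} [Fintype Ω] (f : Ω → ℝ) : ℝ :=
  (∑ ω, f ω) / Fintype.card Ω

open scoped Classical in
/-- The probability of `P` under the uniform distribution on a finite type. -/
noncomputable def pr {Ω : Type*} [Fintype Ω] (P : Ω → Prop) : ℝ :=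
  ex fun ω => if P ω then 1 else 0

variable {Ω : Type*} [Fintype Ω]

lemma ex_mono {f g : Ω → ℝ} (h : ∀ ω, f ω ≤ g ω) : ex f ≤ ex g := by
  unfold ex
  gcongr with ω
  exact h ω

lemma ex_const [Nonempty Ω] (c : ℝ) : ex (fun _ : Ω => c) = c := by
  simp [ex]

lemma ex_add (f g : Ω → ℝ) : ex (fun ω => f ω + g ω) = ex f + ex g := by
  simp [ex, sum_add_distrib, add_div]

lemma ex_mul_left (c : ℝ) (f : Ω → ℝ) : ex (fun ω => c * f ω) = c * ex f := by
  simp [ex, ← mul_sum, mul_div_assoc]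

lemma ex_sum {ι : Type*} (s : Finset ι) (f : ι → Ω → ℝ) :
    ex (fun ω => ∑ i ∈ s, f i ω) = ∑ i ∈ s, ex (f i) := by
  simp only [ex, ← sum_div]
  rw [sum_comm]

lemma pr_le_ex {P : Ω → Prop} {f : Ω → ℝ} (h0 : ∀ ω, 0 ≤ f ω) (h1 : ∀ ω, P ω → 1 ≤ f ω) :
    pr P ≤ ex f := by
  refine ex_mono fun ω => ?_
  split_ifs with h
  · exact h1 ω h
  · exact h0 ω

lemma pr_mono {P Q : Ω → Prop} (h : ∀ ω, P ω → Q ω) : pr P ≤ pr Q := by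
  refine ex_mono fun ω => ?_
  have := h ω
  split_ifs <;> simp_all

lemma pr_exists_le {ι : Type*} (s : Finset ι) (P : ι → Ω → Prop) {B : ℝ}
    (h : ∀ i ∈ s, pr (P i) ≤ B) : pr (fun ω => ∃ i ∈ s, P i ω) ≤ #s * B := by
  classical
  have h1 : pr (fun ω => ∃ i ∈ s, P i ω) ≤
      ex (fun ω => ∑ i ∈ s, if P i ω then (1 : ℝ) else 0) := by
    refine pr_le_ex (fun ω => sum_nonneg fun i _ => by positivity) ?_
    rintro ω ⟨i, hi, hP⟩
    calc (1 : ℝ) = if P i ω then (1 : ℝ) else 0 := by simp [hP]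
      _ ≤ _ := single_le_sum (f := fun i => if P i ω then (1 : ℝ) else 0)
          (fun j _ => by positivity) hi
  refine h1.trans ?_
  rw [ex_sum, ← nsmul_eq_mul]
  refine sum_le_card_nsmul s _ _ fun i hi => ?_
  have := h i hi
  unfold pr at this
  convert this

lemma pr_or_le (P Q : Ω → Prop) : pr (fun ω => P ω ∨ Q ω) ≤ pr P + pr Q := by
  unfold pr
  rw [← ex_add]
  refine ex_mono fun ω => ?_
  by_cases hP : P ω <;> by_cases hQ : Q ω <;> simp [hP, hQ]

lemma pr_not [Nonempty Ω] (P : Ω → Prop) : pr (fun ω => ¬ P ω) = 1 - pr P := by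
  rw [eq_sub_iff_add_eq]
  unfold pr
  rw [← ex_add]
  refine Eq.trans ?_ (ex_const (Ω := Ω) 1)
  congr 1
  ext ω
  by_cases hP : P ω <;> simp [hP]

lemma pr_false : pr (fun _ : Ω => False) = 0 := by
  simp [pr, ex]

section Product

variable {E α : Type*} [Fintype E] [DecidableEq E] [Fintype α]

/-- Resampling the coordinates in `F` does not change averages. -/
lemma ex_resample [Nonempty α] (F : Finset E) (f : (E → α) → ℝ) :
    ex (fun ω => ex fun τ => f (F.piecewise τ ω)) = ex f := by
  have hinv : Function.Involutive
      (fun p : (E → α) × (E → α) => (F.piecewise p.2 p.1, F.piecewise p.1 p.2)) := by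
    rintro ⟨ω, τ⟩
    ext e <;> by_cases h : e ∈ F <;> simp [h]
  have h1 : ∑ ω : E → α, ∑ τ : E → α, f (F.piecewise τ ω) =
      ∑ ω : E → α, ∑ _τ : E → α, f ω := by
    rw [← Fintype.sum_prod_type' (f := fun ω τ : E → α => f (F.piecewise τ ω)),
      ← Fintype.sum_prod_type' (f := fun ω _ : E → α => f ω)]
    exact (hinv.toPerm).sum_comp univ (fun p : (E → α) × (E → α) => f p.1) (by simp)
  have hc : (Fintype.card (E → α) : ℝ) ≠ 0 := by
    exact_mod_cast Fintype.card_ne_zero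
  unfold ex
  rw [← sum_div, h1]
  simp only [sum_const, nsmul_eq_mul, ← mul_sum, card_univ]
  field_simp

lemma pr_le_of_resample [Nonempty α] (F : Finset E) {P : (E → α) → Prop} {B : ℝ}
    (h : ∀ ω, pr (fun τ => P (F.piecewise τ ω)) ≤ B) : pr P ≤ B := by
  unfold pr at h ⊢
  rw [← ex_resample F, ← ex_const (Ω := E → α) B]
  exact ex_mono h

lemma ex_prod [Nonempty α] (F : Finset E) (h : E → α → ℝ) :
    ex (fun τ : E → α => ∏ e ∈ F, h e (τ e)) = ∏ e ∈ F, ex (h e) := by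
  have key : ∀ g : E → α → ℝ, ex (fun τ : E → α => ∏ e, g e (τ e)) = ∏ e, ex (g e) := by
    intro g
    unfold ex
    rw [prod_div_distrib, prod_univ_sum, Fintype.piFinset_univ]
    simp
  have h1 := key fun e a => if e ∈ F then h e a else 1
  have h2 : ∀ e, ex (fun a : α => if e ∈ F then h e a else 1) = if e ∈ F then ex (h e) else 1 := by
    intro e
    split_ifs
    · rfl
    · exact ex_const 1
  simp only [h2, prod_ite_mem, univ_inter] at h1
  exact h1

variable [Nonempty α] {p : ℝ}

lemma ex_pow_count (F : Finset E) (A : E → α → Prop) [∀ e, DecidablePred (A e)]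
    (hA : ∀ e ∈ F, pr (A e) = p) (y : ℝ) :
    ex (fun τ : E → α => y ^ #{e ∈ F | A e (τ e)}) = (1 + p * (y - 1)) ^ #F := by
  have h1 : ∀ τ : E → α, y ^ #{e ∈ F | A e (τ e)} = ∏ e ∈ F, if A e (τ e) then y else 1 := by
    intro τ
    rw [prod_ite]
    simp
  simp only [h1]
  rw [ex_prod F (fun e a => if A e a then y else 1), prod_eq_pow_card]
  intro e he
  have h2 : (fun a : α => if A e a then y else 1) =
      fun a => 1 + (y - 1) * (if A e a then 1 else 0) := by
    ext a
    split_ifs <;> ring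
  rw [h2, ex_add, ex_const, ex_mul_left]
  have h3 : ex (fun a : α => if A e a then (1 : ℝ) else 0) = p := by
    rw [← hA e he]
    unfold pr
    congr!
  rw [h3]
  ring

lemma chernoff_upper (F : Finset E) (A : E → α → Prop) [∀ e, DecidablePred (A e)]
    (hA : ∀ e ∈ F, pr (A e) = p)
    (hp : 0 ≤ p) {ε : ℝ} (hε : 0 < ε) (hε1 : ε ≤ 1) {N : ℝ} (hN : (#F : ℝ) ≤ N) :
    pr (fun τ : E → α => (1 + ε) * (p * N) ≤ #{e ∈ F | A e (τ e)}) ≤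
      Real.exp (-(ε ^ 2 * (p * N) / 4)) := by
  have h1 : pr (fun τ : E → α => (1 + ε) * (p * N) ≤ #{e ∈ F | A e (τ e)}) ≤
      ex (fun τ : E → α => Real.exp (-(ε / 2 * ((1 + ε) * (p * N)))) *
        Real.exp (ε / 2) ^ #{e ∈ F | A e (τ e)}) := by
    refine pr_le_ex (fun τ => by positivity) fun τ h => ?_
    rw [← Real.exp_nat_mul, ← Real.exp_add, Real.one_le_exp_iff]
    nlinarith
  refine h1.trans ?_
  rw [ex_mul_left, ex_pow_count F A hA]
  have hq : Real.exp (ε / 2) - 1 ≤ ε / 2 + (ε / 2) ^ 2 := by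
    have := Real.abs_exp_sub_one_sub_id_le (x := ε / 2) (by rw [abs_of_pos] <;> linarith)
    rw [abs_le] at this
    linarith [this.2]
  have hq0 : 0 ≤ Real.exp (ε / 2) - 1 := by
    linarith [Real.add_one_le_exp (ε / 2)]
  have h2 : (1 + p * (Real.exp (ε / 2) - 1)) ^ #F ≤
      Real.exp (p * (ε / 2 + (ε / 2) ^ 2) * N) := by
    calc (1 + p * (Real.exp (ε / 2) - 1)) ^ #F
        ≤ Real.exp (p * (Real.exp (ε / 2) - 1)) ^ #F := by
          gcongr
          linarith [Real.add_one_le_exp (p * (Real.exp (ε / 2) - 1))]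
      _ = Real.exp (#F * (p * (Real.exp (ε / 2) - 1))) := by rw [Real.exp_nat_mul]
      _ ≤ _ := by
          rw [Real.exp_le_exp, mul_comm]
          gcongr
  calc _ ≤ Real.exp (-(ε / 2 * ((1 + ε) * (p * N)))) *
        Real.exp (p * (ε / 2 + (ε / 2) ^ 2) * N) := by gcongr
    _ = _ := by
        rw [← Real.exp_add]
        congr 1
        ring

lemma chernoff_lower (F : Finset E) (A : E → α → Prop) [∀ e, DecidablePred (A e)]
    (hA : ∀ e ∈ F, pr (A e) = p)
    (hp : 0 ≤ p) (hp1 : p ≤ 1) {ε : ℝ} (hε : 0 < ε) (hε1 : ε ≤ 1) :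
    pr (fun τ : E → α => (#{e ∈ F | A e (τ e)} : ℝ) ≤ (1 - ε) * (p * #F)) ≤
      Real.exp (-(ε ^ 2 * (p * #F) / 4)) := by
  have h1 : pr (fun τ : E → α => (#{e ∈ F | A e (τ e)} : ℝ) ≤ (1 - ε) * (p * #F)) ≤
      ex (fun τ : E → α => Real.exp (ε / 2 * ((1 - ε) * (p * #F))) *
        Real.exp (-(ε / 2)) ^ #{e ∈ F | A e (τ e)}) := by
    refine pr_le_ex (fun τ => by positivity) fun τ h => ?_
    rw [← Real.exp_nat_mul, ← Real.exp_add, Real.one_le_exp_iff]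
    nlinarith
  refine h1.trans ?_
  rw [ex_mul_left, ex_pow_count F A hA]
  have hq : Real.exp (-(ε / 2)) - 1 ≤ -(ε / 2) + (ε / 2) ^ 2 := by
    have := Real.abs_exp_sub_one_sub_id_le (x := -(ε / 2)) (by rw [abs_neg, abs_of_pos] <;> linarith)
    rw [abs_le] at this
    linarith [this.2]
  have hq0 : 0 ≤ 1 + p * (Real.exp (-(ε / 2)) - 1) := by
    nlinarith [Real.exp_pos (-(ε / 2))]
  have h2 : (1 + p * (Real.exp (-(ε / 2)) - 1)) ^ #F ≤
      Real.exp (p * (-(ε / 2) + (ε / 2) ^ 2) * #F) := by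
    calc (1 + p * (Real.exp (-(ε / 2)) - 1)) ^ #F
        ≤ Real.exp (p * (Real.exp (-(ε / 2)) - 1)) ^ #F := by
          gcongr
          linarith [Real.add_one_le_exp (p * (Real.exp (-(ε / 2)) - 1))]
      _ = Real.exp (#F * (p * (Real.exp (-(ε / 2)) - 1))) := by rw [Real.exp_nat_mul]
      _ ≤ _ := by
          rw [Real.exp_le_exp, mul_comm]
          gcongr
  calc _ ≤ Real.exp (ε / 2 * ((1 - ε) * (p * #F))) *
        Real.exp (p * (-(ε / 2) + (ε / 2) ^ 2) * #F) := by gcongr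
    _ = _ := by
        rw [← Real.exp_add]
        congr 1
        ring

lemma pr_forall_not_le (F : Finset E) (A : E → α → Prop) (hA : ∀ e ∈ F, pr (A e) = p)
    (hp1 : p ≤ 1) :
    pr (fun τ : E → α => ∀ e ∈ F, ¬ A e (τ e)) ≤ Real.exp (-(p * #F)) := by
  classical
  have h1 : pr (fun τ : E → α => ∀ e ∈ F, ¬ A e (τ e)) ≤
      ex (fun τ : E → α => (0 : ℝ) ^ #{e ∈ F | A e (τ e)}) := by
    refine pr_le_ex (fun τ => by positivity) fun τ h => ?_
    rw [filter_false_of_mem h]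
    simp
  refine h1.trans ?_
  rw [ex_pow_count F A hA]
  calc (1 + p * (0 - 1)) ^ #F ≤ Real.exp (-p) ^ #F := by
        gcongr
        · linarith
        · linarith [Real.add_one_le_exp (-p)]
    _ = _ := by
        rw [← Real.exp_nat_mul]
        congr 1
        ring

end Product

lemma pr_perm_apply_eq {ℓ : ℕ} (a b : Fin ℓ) :
    pr (fun τ : Equiv.Perm (Fin ℓ) => τ a = b) = 1 / ℓ := by
  classical
  have h1 : ∀ c : Fin ℓ, pr (fun τ : Equiv.Perm (Fin ℓ) => τ a = c) =
      pr (fun τ : Equiv.Perm (Fin ℓ) => τ a = b) := by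
    intro c
    unfold pr ex
    congr 1
    refine Fintype.sum_equiv (Equiv.mulLeft (Equiv.swap b c)) _ _ fun τ => ?_
    have : Equiv.swap b c (τ a) = b ↔ τ a = c := by
      rw [← Equiv.eq_symm_apply]
      simp
    simp [this]
  have h2 : ∑ c : Fin ℓ, pr (fun τ : Equiv.Perm (Fin ℓ) => τ a = c) = 1 := by
    unfold pr
    rw [← ex_sum]
    refine Eq.trans ?_ (ex_const (Ω := Equiv.Perm (Fin ℓ)) 1)
    congr 1
    ext τ
    rw [sum_eq_single (τ a)] <;> simp +contextual [eq_comm]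
  simp only [h1, sum_const, card_univ, Fintype.card_fin, nsmul_eq_mul] at h2
  exact eq_one_div_of_mul_eq_one_right h2

end Probability

section Combinatorics

/-- Hall's theorem when left degrees dominate right degrees. -/
lemma exists_injective_of_degree {ι α : Type*} [Fintype ι] [DecidableEq α]
    (t : ι → Finset α) {D : ℝ} (hD : 0 < D) (h1 : ∀ x, D ≤ #(t x))
    (h2 : ∀ b, (#{x | b ∈ t x} : ℝ) ≤ D) :
    ∃ f : ι → α, Function.Injective f ∧ ∀ x, f x ∈ t x := by
  rw [← all_card_le_biUnion_card_iff_exists_injective]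
  intro s
  have h3 : ∑ x ∈ s, #(t x) ≤ ∑ b ∈ s.biUnion t, #{x | b ∈ t x} := by
    have : ∀ x ∈ s, #(t x) = #{b ∈ s.biUnion t | b ∈ t x} := by
      intro x hx
      congr 1
      ext b
      simp only [mem_filter, mem_biUnion]
      exact ⟨fun h => ⟨⟨x, hx, h⟩, h⟩, fun h => h.2⟩
    rw [sum_congr rfl this]
    refine (sum_card_bipartiteAbove_eq_sum_card_bipartiteBelow (fun x b => b ∈ t x)).le.trans ?_
    refine sum_le_sum fun b _ => card_le_card ?_
    intro x
    simp [bipartiteBelow]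
  have h4 : (#s : ℝ) * D ≤ #(s.biUnion t) * D := by
    calc (#s : ℝ) * D = ∑ x ∈ s, D := by simp
      _ ≤ ∑ x ∈ s, (#(t x) : ℝ) := sum_le_sum fun x _ => h1 x
      _ ≤ ∑ b ∈ s.biUnion t, (#{x | b ∈ t x} : ℝ) := by exact_mod_cast h3
      _ ≤ ∑ b ∈ s.biUnion t, D := sum_le_sum fun b _ => h2 b
      _ = _ := by simp
  exact_mod_cast le_of_mul_le_mul_right h4 hD

/-- Greedy choice of disjoint links between private reservoirs. -/
lemma exists_disjoint_links {m s : ℕ} [NeZero s] (Δ : ℕ)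
    (rel : Fin m × Fin m → Fin s → Fin s → Prop) (B : Finset (Fin m × Fin m))
    (h1 : ∀ i, #{p ∈ B | p.1 = i} ≤ Δ) (h2 : ∀ j, #{p ∈ B | p.2 = j} ≤ Δ)
    (hrel : ∀ p ∈ B, ∀ S T : Finset (Fin s), s ≤ #S + Δ → s ≤ #T + Δ →
      ∃ c ∈ S, ∃ d ∈ T, rel p c d) :
    ∃ c d : Fin m × Fin m → Fin s, (∀ p ∈ B, rel p (c p) (d p)) ∧
      (∀ p ∈ B, ∀ q ∈ B, p.1 = q.1 → c p = c q → p = q) ∧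
      (∀ p ∈ B, ∀ q ∈ B, p.2 = q.2 → d p = d q → p = q) := by
  classical
  induction B using Finset.induction_on with
  | empty => exact ⟨fun _ => 0, fun _ => 0, by simp⟩
  | insert p B hp ih =>
    obtain ⟨c, d, h, hc, hd⟩ := ih
      (fun i => (card_le_card (filter_subset_filter _ (subset_insert p B))).trans (h1 i))
      (fun j => (card_le_card (filter_subset_filter _ (subset_insert p B))).trans (h2 j))
      (fun q hq => hrel q (mem_insert_of_mem hq))
    have hsize : ∀ (e : Fin m × Fin m → Fin s) (Q : Finset (Fin m × Fin m)), #Q ≤ Δ →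
        s ≤ #(univ \ Q.image e) + Δ := by
      intro e Q hQ
      have h3 := card_sdiff_add_card_eq_card (subset_univ (Q.image e))
      have h4 := card_image_le (s := Q) (f := e)
      rw [card_univ, Fintype.card_fin] at h3
      omega
    obtain ⟨c₀, hc₀, d₀, hd₀, hcd⟩ := hrel p (mem_insert_self p B) _ _
      (hsize c {q ∈ B | q.1 = p.1}
        ((card_le_card (filter_subset_filter _ (subset_insert p B))).trans (h1 p.1)))
      (hsize d {q ∈ B | q.2 = p.2}
        ((card_le_card (filter_subset_filter _ (subset_insert p B))).trans (h2 p.2)))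
    have hc₁ : ∀ q ∈ B, q.1 = p.1 → c q ≠ c₀ := by
      intro q hq hqp he
      simp only [mem_sdiff, mem_image, mem_filter, not_exists, not_and] at hc₀
      exact hc₀.2 q ⟨hq, hqp⟩ he
    have hd₁ : ∀ q ∈ B, q.2 = p.2 → d q ≠ d₀ := by
      intro q hq hqp he
      simp only [mem_sdiff, mem_image, mem_filter, not_exists, not_and] at hd₀
      exact hd₀.2 q ⟨hq, hqp⟩ he
    have hne : ∀ q ∈ B, q ≠ p := fun q hq e => hp (e ▸ hq)
    refine ⟨Function.update c p c₀, Function.update d p d₀, ?_, ?_, ?_⟩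
    · intro q hq
      rcases mem_insert.1 hq with rfl | hq
      · simpa using hcd
      · simpa [hne q hq] using h q hq
    · intro q hq q' hq' he hcq
      rcases mem_insert.1 hq with rfl | hqB <;> rcases mem_insert.1 hq' with rfl | hqB'
      · rfl
      · rw [Function.update_self, Function.update_of_ne (hne q' hqB')] at hcq
        exact absurd hcq.symm (hc₁ q' hqB' he.symm)
      · rw [Function.update_self, Function.update_of_ne (hne q hqB)] at hcq
        exact absurd hcq (hc₁ q hqB he)
      · rw [Function.update_of_ne (hne q hqB), Function.update_of_ne (hne q' hqB')] at hcq
        exact hc q hqB q' hqB' he hcq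
    · intro q hq q' hq' he hdq
      rcases mem_insert.1 hq with rfl | hqB <;> rcases mem_insert.1 hq' with rfl | hqB'
      · rfl
      · rw [Function.update_self, Function.update_of_ne (hne q' hqB')] at hdq
        exact absurd hdq.symm (hd₁ q' hqB' he.symm)
      · rw [Function.update_self, Function.update_of_ne (hne q hqB)] at hdq
        exact absurd hdq (hd₁ q hqB he)
      · rw [Function.update_of_ne (hne q hqB), Function.update_of_ne (hne q' hqB')] at hdq
        exact hd q hqB q' hqB' he hdq

end Combinatorics

section Paths

lemma hasTopCliqueFun_of_interior {V : Type*} {G : SimpleGraph V} {m : ℕ} {f : Fin m → V}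
    (hf : Function.Injective f) (U : Fin m → Fin m → Set V)
    (hU : ∀ i j, i < j → ∃ p : G.Walk (f i) (f j), p.IsPath ∧
      ∀ x ∈ p.support.tail.dropLast, x ∈ U i j)
    (havoid : ∀ i j, i < j → ∀ k, f k ∉ U i j)
    (hdisj : ∀ i j i' j' : Fin m, i < j → i' < j' → (i, j) ≠ (i', j') →
      ∀ x, x ∈ U i j → x ∉ U i' j') : HasTopCliqueFun G f := by
  classical
  let P : ∀ i j : Fin m, G.Walk (f i) (f j) := fun i j =>
    if h : i < j then (hU i j h).choose
    else if h' : j < i then (hU j i h').choose.reverse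
    else SimpleGraph.Walk.nil.copy rfl (by rw [le_antisymm (not_lt.1 h') (not_lt.1 h)])
  have hP : ∀ i j, i < j → (P i j).IsPath ∧ ∀ x ∈ (P i j).support.tail.dropLast, x ∈ U i j := by
    intro i j h
    simp only [P, h, dite_true]
    exact (hU i j h).choose_spec
  refine ⟨hf, P, fun i j h => (hP i j h).1, fun i j h k hk => havoid i j h k ((hP i j h).2 _ hk),
    fun i j i' j' h h' hne x hx hx' => hdisj i j i' j' h h' hne x ((hP i j h).2 x hx)
      ((hP i' j' h').2 x hx')⟩

lemma liftGraph_adj {n ℓ : ℕ} (σ : Fin n → Fin n → Equiv.Perm (Fin ℓ)) {i j : Fin n} (h : i < j)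
    {a b : Fin ℓ} (hab : σ i j a = b) : (liftGraph n ℓ σ).Adj (i, a) (j, b) := by
  rw [liftGraph, SimpleGraph.fromRel_adj]
  exact ⟨fun e => h.ne (congrArg Prod.fst e), Or.inl ⟨h, hab⟩⟩

/-- A topological clique assembled from edges, paths of length two and paths of length three. -/
lemma hasTopClique_of_links {n ℓ m : ℕ} [NeZero ℓ] (hm : m ≤ n)
    (σ : Fin n → Fin n → Equiv.Perm (Fin ℓ)) (x : Fin n → Fin m → Fin ℓ)
    (hx : ∀ k i, x k i = σ (Fin.castLE hm i) k 0)
    {M R₁ R₂ : Finset (Fin n)} (hM : ∀ k ∈ M, m ≤ k.val) (hR₁ : ∀ k ∈ R₁, m ≤ k.val)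
    (hR₂ : ∀ k ∈ R₂, m ≤ k.val) (hMR₁ : Disjoint M R₁) (hMR₂ : Disjoint M R₂)
    (hR : ∀ k ∈ R₁, ∀ k' ∈ R₂, k < k')
    (B : Finset (Fin m × Fin m)) (g u v : Fin m × Fin m → Fin n)
    (hg : ∀ p : Fin m × Fin m, p.1 < p.2 → p ∉ B →
      σ (Fin.castLE hm p.1) (Fin.castLE hm p.2) 0 ≠ 0 → g p ∈ M ∧ x (g p) p.1 = x (g p) p.2)
    (hginj : ∀ p q : Fin m × Fin m, p.1 < p.2 → p ∉ B →
      σ (Fin.castLE hm p.1) (Fin.castLE hm p.2) 0 ≠ 0 → q.1 < q.2 → q ∉ B →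
      σ (Fin.castLE hm q.1) (Fin.castLE hm q.2) 0 ≠ 0 →
      g p = g q → x (g p) p.1 = x (g q) q.1 → p = q)
    (huv : ∀ p ∈ B, u p ∈ R₁ ∧ v p ∈ R₂ ∧ σ (u p) (v p) (x (u p) p.1) = x (v p) p.2)
    (huinj : ∀ p ∈ B, ∀ q ∈ B, u p = u q → x (u p) p.1 = x (u q) q.1 → p = q)
    (hvinj : ∀ p ∈ B, ∀ q ∈ B, v p = v q → x (v p) p.2 = x (v q) q.2 → p = q) :
    HasTopClique (liftGraph n ℓ σ) m := by
  classical
  have hlt : ∀ (i : Fin m) (k : Fin n), m ≤ k.val → Fin.castLE hm i < k := fun i k hk =>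
    Fin.lt_def.2 (by simpa using i.2.trans_le hk)
  let U : Fin m → Fin m → Set (Fin n × Fin ℓ) := fun i j y =>
    ((i, j) ∈ B ∧ (y = (u (i, j), x (u (i, j)) i) ∨ y = (v (i, j), x (v (i, j)) j))) ∨
    ((i, j) ∉ B ∧ σ (Fin.castLE hm i) (Fin.castLE hm j) 0 ≠ 0 ∧ y = (g (i, j), x (g (i, j)) i))
  refine ⟨fun i => (Fin.castLE hm i, 0), hasTopCliqueFun_of_interior (U := U) ?_ ?_ ?_ ?_⟩
  · intro i j h
    simpa using h
  · intro i j hij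
    have hne : (Fin.castLE hm i, (0 : Fin ℓ)) ≠ (Fin.castLE hm j, 0) := by
      simpa using hij.ne
    by_cases hB : (i, j) ∈ B
    · obtain ⟨h1, h2, h3⟩ := huv _ hB
      have hu := hlt i _ (hR₁ _ h1)
      have hv := hlt j _ (hR₂ _ h2)
      have hu' := hlt j _ (hR₁ _ h1)
      have hv' := hlt i _ (hR₂ _ h2)
      have huv' := hR _ h1 _ h2
      refine ⟨.cons (liftGraph_adj σ hu (hx _ i).symm) (.cons (liftGraph_adj σ huv' h3)
        (.cons (liftGraph_adj σ hv (hx _ j).symm).symm .nil)), ?_, ?_⟩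
      · simp [SimpleGraph.Walk.isPath_def, hu.ne, hv.ne', hu'.ne', huv'.ne, hv'.ne, hij.ne]
      · intro y hy
        left
        simpa [hB] using hy
    · by_cases hadj : σ (Fin.castLE hm i) (Fin.castLE hm j) 0 = 0
      · refine ⟨.cons (liftGraph_adj σ (by simpa using hij) hadj) .nil, ?_, ?_⟩
        · simp [SimpleGraph.Walk.isPath_def, hij.ne]
        · intro y hy
          simp at hy
      · obtain ⟨h1, h2⟩ := hg (i, j) hij hB hadj
        have hu := hlt i _ (hM _ h1)
        have hv := hlt j _ (hM _ h1)
        refine ⟨.cons (liftGraph_adj σ hu (hx _ i).symm)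
          (.cons (liftGraph_adj σ hv ((hx _ j).symm.trans h2.symm)).symm .nil), ?_, ?_⟩
        · simp [SimpleGraph.Walk.isPath_def, hu.ne, hv.ne', hij.ne]
        · intro y hy
          right
          exact ⟨hB, hadj, by simpa using hy⟩
  · rintro i j hij k (⟨hB, h | h⟩ | ⟨hB, hadj, h⟩)
    · exact (hlt k _ (hR₁ _ (huv _ hB).1)).ne (congrArg Prod.fst h)
    · exact (hlt k _ (hR₂ _ (huv _ hB).2.1)).ne (congrArg Prod.fst h)
    · exact (hlt k _ (hM _ (hg (i, j) hij hB hadj).1)).ne (congrArg Prod.fst h)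
  · rintro i j i' j' hij hij' hne y (⟨hB, h | h⟩ | ⟨hB, hadj, h⟩)
      (⟨hB', h' | h'⟩ | ⟨hB', hadj', h'⟩) <;> rw [h, Prod.mk.injEq] at h' <;>
      obtain ⟨e1, e2⟩ := h'
    · exact hne (huinj _ hB _ hB' e1 e2)
    · exact (hR _ (huv _ hB).1 _ (huv _ hB').2.1).ne e1
    · exact disjoint_left.1 hMR₁ (hg (i', j') hij' hB' hadj').1 (e1 ▸ (huv _ hB).1)
    · exact (hR _ (huv _ hB').1 _ (huv _ hB).2.1).ne' e1
    · exact hne (hvinj _ hB _ hB' e1 e2)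
    · exact disjoint_left.1 hMR₂ (hg (i', j') hij' hB' hadj').1 (e1 ▸ (huv _ hB).2.1)
    · exact disjoint_left.1 hMR₁ (hg (i, j) hij hB hadj).1 (e1 ▸ (huv _ hB').1)
    · exact disjoint_left.1 hMR₂ (hg (i, j) hij hB hadj).1 (e1 ▸ (huv _ hB').2.1)
    · exact hne (hginj _ _ hij hB hadj hij' hB' hadj' e1 e2)

end Paths

section Classes

variable {n ℓ m : ℕ}

/-- The number of other branch indices in the class of `i` in fiber `k`. -/
def load (x : Fin n → Fin m → Fin ℓ) (k : Fin n) (i : Fin m) : ℕ :=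
  #{j | j ≠ i ∧ x k j = x k i}

lemma card_class (x : Fin n → Fin m → Fin ℓ) (k : Fin n) (i : Fin m) :
    #{j | x k j = x k i} = load x k i + 1 := by
  have : ({j | j ≠ i ∧ x k j = x k i} : Finset (Fin m)) =
      ({j | x k j = x k i} : Finset (Fin m)).erase i := by
    ext j
    simp
  rw [load, this, card_erase_add_one (by simp)]

lemma load_congr {x : Fin n → Fin m → Fin ℓ} {k : Fin n} {i j : Fin m} (h : x k i = x k j) :
    load x k i = load x k j := by
  have h1 := card_class x k i
  have h2 := card_class x k j
  rw [h] at h1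
  omega

variable {x : Fin n → Fin m → Fin ℓ} {K : Finset (Fin n)} {κ : ℕ} {h : ℝ}

/-- Few fibers have an oversized class at a given branch index. -/
lemma card_oversize_lt (i : Fin m)
    (hU : ∀ K' ⊆ K, #K' = κ → (∑ k ∈ K', load x k i : ℝ) < h * κ) :
    #{k ∈ K | h ≤ load x k i} < κ := by
  by_contra! hc
  obtain ⟨K', hK', hcard⟩ := exists_subset_card_eq hc
  have h1 := hU K' (hK'.trans (filter_subset _ _)) hcard
  have h2 : (∑ k ∈ K', h) ≤ ∑ k ∈ K', (load x k i : ℝ) :=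
    sum_le_sum fun k hk => (mem_filter.1 (hK' hk)).2
  rw [sum_const, hcard, nsmul_eq_mul] at h2
  linarith

lemma exists_reservoirs {R : Finset (Fin n)} (hRK : R ⊆ K) {s : ℕ} {c : ℝ}
    (hU : ∀ i, ∀ K' ⊆ K, #K' = κ → (∑ k ∈ K', load x k i : ℝ) < h * κ)
    (hh : 0 ≤ h) (hc : h + 1 ≤ c) (hκ : κ < #R) (hs : s * c ≤ #R - κ) :
    ∃ o : Fin m → Fin s → Fin n, (∀ i a, o i a ∈ R) ∧
      ∀ i a j b, o i a = o j b → x (o i a) i = x (o j b) j → i = j ∧ a = b := by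
  classical
  obtain ⟨f, hf, hft⟩ := exists_injective_of_degree (D := (#R : ℝ) - κ)
    (fun p : Fin m × Fin s => {k ∈ R | load x k p.1 < h}.image fun k => (k, x k p.1))
    (by rw [sub_pos]; exact_mod_cast hκ)
    (by
      intro p
      rw [card_image_of_injective _ fun k k' e => (Prod.mk.inj e).1]
      have h1 := card_filter_add_card_filter_not (s := R) (fun k => (load x k p.1 : ℝ) < h)
      have h2 : #{k ∈ R | ¬ (load x k p.1 : ℝ) < h} ≤ κ := by
        simp only [not_lt]
        exact (card_le_card (filter_subset_filter _ hRK)).trans (card_oversize_lt p.1 (hU p.1)).le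
      have h3 : #R ≤ #{k ∈ R | (load x k p.1 : ℝ) < h} + κ := by omega
      rw [sub_le_iff_le_add]
      exact_mod_cast h3)
    (by
      rintro ⟨k, a⟩
      refine le_trans ?_ hs
      by_cases hex : ∃ i, x k i = a ∧ (load x k i : ℝ) < h
      · obtain ⟨i, rfl, hi⟩ := hex
        have h1 : #{p : Fin m × Fin s | (k, x k i) ∈
            {k ∈ R | load x k p.1 < h}.image fun k => (k, x k p.1)} ≤ s * (load x k i + 1) := by
          calc _ ≤ #(({j | x k j = x k i} : Finset (Fin m)) ×ˢ (univ : Finset (Fin s))) := by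
                refine card_le_card ?_
                rintro ⟨j, b⟩
                simp only [mem_filter, mem_univ, true_and, mem_image, Prod.mk.injEq, mem_product,
                  and_true]
                rintro ⟨k', -, rfl, e⟩
                exact e
            _ = _ := by rw [card_product, card_class, card_univ, Fintype.card_fin, mul_comm]
        have h2 : (s : ℝ) * (load x k i + 1) ≤ s * c := by
          gcongr
          linarith
        refine le_trans ?_ h2
        exact_mod_cast h1
      · rw [filter_false_of_mem]
        · rw [card_empty, Nat.cast_zero]
          have : 0 ≤ c := by linarith
          positivity
        · rintro ⟨j, b⟩ - hmem
          simp only [mem_image, mem_filter, Prod.mk.injEq] at hmem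
          obtain ⟨k', ⟨-, hlt⟩, rfl, e⟩ := hmem
          exact hex ⟨j, e, hlt⟩)
  have hft' : ∀ p, (f p).1 ∈ R ∧ (f p).2 = x (f p).1 p.1 := by
    intro p
    obtain ⟨k, hk, e⟩ := mem_image.1 (hft p)
    rw [← e]
    exact ⟨(mem_filter.1 hk).1, rfl⟩
  refine ⟨fun i a => (f (i, a)).1, fun i a => (hft' _).1, fun i a j b e1 e2 => ?_⟩
  have := hf (a₁ := (i, a)) (a₂ := (j, b))
    (Prod.ext e1 (by rw [(hft' (i, a)).2, (hft' (j, b)).2]; exact e2))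
  simpa using this

/-- All but few branch indices have many undersized classes in common with `i`. -/
lemma card_bad_le {M : Finset (Fin n)} (hMK : M ⊆ K) (hκK : κ ≤ #K) (i : Fin m) {t Δ : ℕ}
    {A D : ℝ} (hDA : D < A)
    (hU : ∀ K' ⊆ K, #K' = κ → (∑ k ∈ K', load x k i : ℝ) < h * κ)
    (hL : ∀ J : Finset (Fin m), i ∉ J → #J = t →
      A * t < ∑ j ∈ J, (#{k ∈ M | x k j = x k i} : ℝ))
    (hΔ : t + h * κ / (A - D) ≤ Δ) :
    #{j | j ≠ i ∧ (#{k ∈ M | x k j = x k i ∧ load x k i < h} : ℝ) < D} ≤ Δ := by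
  classical
  set J₁ : Finset (Fin m) := {j | j ≠ i ∧ (#{k ∈ M | x k j = x k i} : ℝ) ≤ A} with hJ₁
  set J₂ : Finset (Fin m) := {j | j ≠ i ∧
    A - D < (#{k ∈ M | x k j = x k i ∧ h ≤ load x k i} : ℝ)} with hJ₂
  have hsub : ({j | j ≠ i ∧ (#{k ∈ M | x k j = x k i ∧ load x k i < h} : ℝ) < D} :
      Finset (Fin m)) ⊆ J₁ ∪ J₂ := by
    intro j hj
    simp only [hJ₁, hJ₂, mem_filter, mem_univ, true_and, mem_union] at hj ⊢
    by_cases hA : (#{k ∈ M | x k j = x k i} : ℝ) ≤ A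
    · exact Or.inl ⟨hj.1, hA⟩
    · refine Or.inr ⟨hj.1, ?_⟩
      have h1 := card_filter_add_card_filter_not (s := {k ∈ M | x k j = x k i})
        (fun k => (load x k i : ℝ) < h)
      rw [filter_filter, filter_filter] at h1
      simp only [not_lt] at h1
      have h2 : (#{k ∈ M | x k j = x k i ∧ load x k i < h} : ℝ) +
        #{k ∈ M | x k j = x k i ∧ h ≤ load x k i} = #{k ∈ M | x k j = x k i} := by
        exact_mod_cast h1
      linarith [hj.2]
  have hc₁ : #J₁ ≤ t := by
    by_contra! hlt
    obtain ⟨J, hJ, hcard⟩ := exists_subset_card_eq hlt.le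
    have h1 := hL J (fun hi => (mem_filter.1 (hJ hi)).2.1 rfl) hcard
    have h2 : ∑ j ∈ J, (#{k ∈ M | x k j = x k i} : ℝ) ≤ ∑ j ∈ J, A :=
      sum_le_sum fun j hj => (mem_filter.1 (hJ hj)).2.2
    rw [sum_const, hcard, nsmul_eq_mul] at h2
    linarith
  have hc₂ : (#J₂ : ℝ) ≤ h * κ / (A - D) := by
    rw [le_div_iff₀ (by linarith)]
    obtain ⟨K', hK'1, hK'2, hcard⟩ := exists_subsuperset_card_eq
      (filter_subset (fun k => h ≤ (load x k i : ℝ)) K) (card_oversize_lt i hU).le hκK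
    have h1 : (∑ j ∈ J₂, #{k ∈ K' | x k j = x k i}) = ∑ k ∈ K', #{j ∈ J₂ | x k j = x k i} :=
      sum_card_bipartiteAbove_eq_sum_card_bipartiteBelow (fun j k => x k j = x k i)
    have h2 : ∀ k ∈ K', #{j ∈ J₂ | x k j = x k i} ≤ load x k i := by
      intro k _
      refine card_le_card fun j hj => ?_
      simp only [hJ₂, mem_filter, mem_univ, true_and] at hj ⊢
      exact ⟨hj.1.1, hj.2⟩
    calc (#J₂ : ℝ) * (A - D) = ∑ j ∈ J₂, (A - D) := by simp [mul_sub]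
      _ ≤ ∑ j ∈ J₂, (#{k ∈ K' | x k j = x k i} : ℝ) := by
          refine sum_le_sum fun j hj => (mem_filter.1 hj).2.2.le.trans ?_
          refine Nat.cast_le.2 (card_le_card fun k hk => ?_)
          simp only [mem_filter] at hk
          exact mem_filter.2 ⟨hK'1 (mem_filter.2 ⟨hMK hk.1, hk.2.2⟩), hk.2.1⟩
      _ = ((∑ k ∈ K', #{j ∈ J₂ | x k j = x k i} : ℕ) : ℝ) := by
          rw [← h1]
          push_cast
          rfl
      _ ≤ ∑ k ∈ K', (load x k i : ℝ) := by exact_mod_cast sum_le_sum h2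
      _ ≤ h * κ := (hU K' hK'2 hcard).le
  have h3 : ((#J₁ + #J₂ : ℕ) : ℝ) ≤ Δ := by
    have : (#J₁ : ℝ) ≤ t := by exact_mod_cast hc₁
    push_cast
    linarith
  exact (card_le_card hsub).trans ((card_union_le _ _).trans (by exact_mod_cast h3))

lemma exists_midpoints [NeZero n] {M : Finset (Fin n)} {c D : ℝ} (hD : 0 < D) (hc : h + 1 ≤ c)
    (nonadj : Fin m × Fin m → Prop)
    (hY : ∀ k ∈ M, ∀ a, (#{j | x k j = a} : ℝ) ≤ c →
      ((open scoped Classical in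
        #{p : Fin m × Fin m | p.1 < p.2 ∧ nonadj p ∧ x k p.1 = a ∧ x k p.2 = a} : ℕ) : ℝ) ≤ D) :
    ∃ g : Fin m × Fin m → Fin n, ∀ p, p.1 < p.2 → nonadj p →
      D ≤ #{k ∈ M | x k p.2 = x k p.1 ∧ load x k p.1 < h} →
      g p ∈ M ∧ x (g p) p.1 = x (g p) p.2 ∧
      ∀ q, q.1 < q.2 → nonadj q → D ≤ #{k ∈ M | x k q.2 = x k q.1 ∧ load x k q.1 < h} →
        g p = g q → x (g p) p.1 = x (g q) q.1 → p = q := by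
  classical
  let ι := {p : Fin m × Fin m // p.1 < p.2 ∧ nonadj p ∧
      D ≤ #{k ∈ M | x k p.2 = x k p.1 ∧ load x k p.1 < h}}
  obtain ⟨f, hf, hft⟩ := exists_injective_of_degree (D := D)
    (fun p : ι => {k ∈ M | x k p.1.2 = x k p.1.1 ∧ load x k p.1.1 < h}.image
      fun k => (k, x k p.1.1)) hD
    (by
      rintro ⟨p, hp⟩
      rw [card_image_of_injective _ fun k k' e => (Prod.mk.inj e).1]
      exact hp.2.2)
    (by
      rintro ⟨k, a⟩
      by_cases hex : k ∈ M ∧ ∃ i, x k i = a ∧ (load x k i : ℝ) < h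
      · obtain ⟨hk, i, rfl, hi⟩ := hex
        refine le_trans ?_ (hY k hk (x k i) ?_)
        · refine Nat.cast_le.2 (card_le_card_of_injOn Subtype.val ?_ Subtype.val_injective.injOn)
          rintro ⟨p, hp⟩ hmem
          simp only [coe_filter, mem_univ, true_and, mem_image, mem_filter, Prod.mk.injEq,
            Set.mem_ofPred_eq] at hmem ⊢
          obtain ⟨k', hk', rfl, e⟩ := hmem
          exact ⟨hp.1, hp.2.1, e, hk'.2.1.trans e⟩
        · rw [card_class]
          push_cast
          linarith
      · rw [filter_false_of_mem]
        · simpa using hD.le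
        · rintro p - hmem
          simp only [mem_image, mem_filter, Prod.mk.injEq] at hmem
          obtain ⟨k', ⟨hk', -, hlt⟩, rfl, e⟩ := hmem
          exact hex ⟨hk', _, e, hlt⟩)
  have hft' : ∀ p : ι, (f p).1 ∈ M ∧ x (f p).1 p.1.2 = x (f p).1 p.1.1 ∧
      (f p).2 = x (f p).1 p.1.1 := by
    intro p
    obtain ⟨k, hk, e⟩ := mem_image.1 (hft p)
    rw [← e]
    exact ⟨(mem_filter.1 hk).1, (mem_filter.1 hk).2.1, rfl⟩
  refine ⟨fun p => if hp : p.1 < p.2 ∧ nonadj p ∧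
    D ≤ #{k ∈ M | x k p.2 = x k p.1 ∧ load x k p.1 < h} then (f ⟨p, hp⟩).1 else 0, ?_⟩
  intro p h1 h2 h3
  have hp := And.intro h1 (And.intro h2 h3)
  have h4 := hft' ⟨p, hp⟩
  simp only [hp, and_self, dite_true]
  refine ⟨h4.1, h4.2.1.symm, fun q h5 h6 h7 => ?_⟩
  have hq := And.intro h5 (And.intro h6 h7)
  have h8 := hft' ⟨q, hq⟩
  simp only [hq, and_self, dite_true]
  intro e1 e2
  have := hf (a₁ := ⟨p, hp⟩) (a₂ := ⟨q, hq⟩)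
    (Prod.ext e1 (by rw [h4.2.2, h8.2.2]; exact e2))
  exact congrArg Subtype.val this

end Classes

section Core

variable {n ℓ m : ℕ}

/-- In no set of `κ` fibers of `K` do the classes of a branch index have average load `h`. -/
def UpperRegular (x : Fin n → Fin m → Fin ℓ) (K : Finset (Fin n)) (κ : ℕ) (h : ℝ) : Prop :=
  ∀ i, ∀ K' ⊆ K, #K' = κ → (∑ k ∈ K', load x k i : ℝ) < h * κ

/-- Any `t` branch indices share more than `A` fibers of `M` on average with any other one. -/
def LowerRegular (x : Fin n → Fin m → Fin ℓ) (M : Finset (Fin n)) (t : ℕ) (A : ℝ) : Prop :=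
  ∀ i, ∀ J : Finset (Fin m), i ∉ J → #J = t → A * t < ∑ j ∈ J, (#{k ∈ M | x k j = x k i} : ℝ)

open scoped Classical in
/-- Each class of size at most `c` contains at most `D` pairs satisfying `nonadj`. -/
def FewPairs (x : Fin n → Fin m → Fin ℓ) (M : Finset (Fin n)) (nonadj : Fin m × Fin m → Prop)
    (c D : ℝ) : Prop :=
  ∀ k ∈ M, ∀ a, (#{j | x k j = a} : ℝ) ≤ c →
    (#{p : Fin m × Fin m | p.1 < p.2 ∧ nonadj p ∧ x k p.1 = a ∧ x k p.2 = a} : ℝ) ≤ D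

lemma hasTopClique_of_regular [NeZero ℓ] [NeZero n] (hm : m ≤ n)
    (σ : Fin n → Fin n → Equiv.Perm (Fin ℓ)) (x : Fin n → Fin m → Fin ℓ)
    (hx : ∀ k i, x k i = σ (Fin.castLE hm i) k 0)
    {K M R₁ R₂ : Finset (Fin n)} (hK : ∀ k ∈ K, m ≤ k.val)
    (hMK : M ⊆ K) (hR₁K : R₁ ⊆ K) (hR₂K : R₂ ⊆ K)
    (hMR₁ : Disjoint M R₁) (hMR₂ : Disjoint M R₂) (hR : ∀ k ∈ R₁, ∀ k' ∈ R₂, k < k')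
    {κ t Δ s : ℕ} [NeZero s] {h c A D : ℝ} (hκK : κ ≤ #K) (hc : h + 1 ≤ c) (hD : 0 < D)
    (hDA : D < A) (hΔ : t + h * κ / (A - D) ≤ Δ)
    (hU : UpperRegular x K κ h) (hL : LowerRegular x M t A)
    (hY : FewPairs x M (fun p => σ (Fin.castLE hm p.1) (Fin.castLE hm p.2) 0 ≠ 0) c D)
    (o₁ o₂ : Fin m → Fin s → Fin n) (ho₁ : ∀ i a, o₁ i a ∈ R₁) (ho₂ : ∀ i a, o₂ i a ∈ R₂)
    (ho₁' : ∀ i a j b, o₁ i a = o₁ j b → x (o₁ i a) i = x (o₁ j b) j → i = j ∧ a = b)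
    (ho₂' : ∀ i a j b, o₂ i a = o₂ j b → x (o₂ i a) i = x (o₂ j b) j → i = j ∧ a = b)
    (hZ : ∀ p : Fin m × Fin m, ∀ S T : Finset (Fin s), s ≤ #S + Δ → s ≤ #T + Δ →
      ∃ a ∈ S, ∃ b ∈ T, σ (o₁ p.1 a) (o₂ p.2 b) (x (o₁ p.1 a) p.1) = x (o₂ p.2 b) p.2) :
    HasTopClique (liftGraph n ℓ σ) m := by
  classical
  set B : Finset (Fin m × Fin m) := {p | p.1 < p.2 ∧
    (#{k ∈ M | x k p.2 = x k p.1 ∧ load x k p.1 < h} : ℝ) < D} with hB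
  have hbad := fun i => card_bad_le hMK hκK i hDA (hU i) (hL i) hΔ
  have hdeg₁ : ∀ i, #{p ∈ B | p.1 = i} ≤ Δ := by
    intro i
    refine (card_le_card_of_injOn Prod.snd ?_ ?_).trans (hbad i)
    · rintro ⟨i', j⟩ hp
      simp only [hB, coe_filter, mem_filter, mem_univ, true_and, Set.mem_ofPred_eq] at hp ⊢
      obtain ⟨⟨h1, h2⟩, rfl⟩ := hp
      exact ⟨h1.ne', h2⟩
    · rintro ⟨i', j⟩ hp ⟨i'', j'⟩ hp' e
      simp only [coe_filter, Set.mem_ofPred_eq] at hp hp' e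
      rw [hp.2, hp'.2, e]
  have hdeg₂ : ∀ j, #{p ∈ B | p.2 = j} ≤ Δ := by
    intro j
    refine (card_le_card_of_injOn Prod.fst ?_ ?_).trans (hbad j)
    · rintro ⟨i, j'⟩ hp
      simp only [hB, coe_filter, mem_filter, mem_univ, true_and, Set.mem_ofPred_eq] at hp ⊢
      obtain ⟨⟨h1, h2⟩, rfl⟩ := hp
      refine ⟨h1.ne, lt_of_eq_of_lt ?_ h2⟩
      congr 2
      ext k
      simp only [mem_filter]
      constructor
      · rintro ⟨h3, h4, h5⟩
        exact ⟨h3, h4.symm, by rwa [load_congr h4]⟩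
      · rintro ⟨h3, h4, h5⟩
        exact ⟨h3, h4.symm, by rwa [load_congr h4]⟩
    · rintro ⟨i', j⟩ hp ⟨i'', j'⟩ hp' e
      simp only [coe_filter, Set.mem_ofPred_eq] at hp hp' e
      rw [hp.2, hp'.2, e]
  obtain ⟨a, b, hab, ha, hb⟩ := exists_disjoint_links Δ
    (fun p a b => σ (o₁ p.1 a) (o₂ p.2 b) (x (o₁ p.1 a) p.1) = x (o₂ p.2 b) p.2) B hdeg₁ hdeg₂
    (fun p _ => hZ p)
  obtain ⟨g, hg⟩ := exists_midpoints hD hc _ hY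
  have hB' : ∀ p : Fin m × Fin m, p.1 < p.2 → p ∉ B →
      D ≤ #{k ∈ M | x k p.2 = x k p.1 ∧ load x k p.1 < h} := by
    intro p h1 h2
    by_contra! h3
    exact h2 (mem_filter.2 ⟨mem_univ _, h1, h3⟩)
  refine hasTopClique_of_links hm σ x hx (fun k hk => hK k (hMK hk)) (fun k hk => hK k (hR₁K hk))
    (fun k hk => hK k (hR₂K hk)) hMR₁ hMR₂ hR B g (fun p => o₁ p.1 (a p)) (fun p => o₂ p.2 (b p))
    ?_ ?_ ?_ ?_ ?_
  · intro p h1 h2 h3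
    have := hg p h1 h3 (hB' p h1 h2)
    exact ⟨this.1, this.2.1⟩
  · intro p q h1 h2 h3 h4 h5 h6 h7 h8
    exact (hg p h1 h3 (hB' p h1 h2)).2.2 q h4 h6 (hB' q h4 h5) h7 h8
  · intro p hp
    exact ⟨ho₁ _ _, ho₂ _ _, hab p hp⟩
  · intro p hp q hq e1 e2
    obtain ⟨h1, h2⟩ := ho₁' _ _ _ _ e1 e2
    exact ha p hp q hq h1 h2
  · intro p hp q hq e1 e2
    obtain ⟨h1, h2⟩ := ho₂' _ _ _ _ e1 e2
    exact hb p hp q hq h1 h2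

end Core

section Events

variable {n ℓ m : ℕ} [NeZero ℓ]

/-- The neighbor in fiber `k` of the branch vertex with index `i`. -/
def nbr (hm : m ≤ n) (ω : Fin n × Fin n → Equiv.Perm (Fin ℓ)) (k : Fin n) (i : Fin m) : Fin ℓ :=
  ω (Fin.castLE hm i, k) 0

/-- The coordinates between the branch fibers in `J` and the fibers in `K`. -/
def rect (hm : m ≤ n) (J : Finset (Fin m)) (K : Finset (Fin n)) : Finset (Fin n × Fin n) :=
  (J ×ˢ K).map ((Fin.castLEEmb hm).prodMap (Function.Embedding.refl _))

lemma mem_rect {hm : m ≤ n} {J : Finset (Fin m)} {K : Finset (Fin n)} {i : Fin m} {k : Fin n} :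
    (Fin.castLE hm i, k) ∈ rect hm J K ↔ i ∈ J ∧ k ∈ K := by
  simp [rect]

lemma card_rect (hm : m ≤ n) (J : Finset (Fin m)) (K : Finset (Fin n)) :
    #(rect hm J K) = #J * #K := by
  rw [rect, card_map, card_product]

lemma card_filter_rect (hm : m ≤ n) (J : Finset (Fin m)) (K : Finset (Fin n))
    (P : Fin n × Fin n → Prop) [DecidablePred P] :
    #{e ∈ rect hm J K | P e} = ∑ k ∈ K, #{j ∈ J | P (Fin.castLE hm j, k)} := by
  rw [rect, filter_map, card_map, card_filter, sum_product_right]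
  simp only [card_filter]
  rfl

lemma card_filter_rect' (hm : m ≤ n) (J : Finset (Fin m)) (K : Finset (Fin n))
    (P : Fin n × Fin n → Prop) [DecidablePred P] :
    #{e ∈ rect hm J K | P e} = ∑ j ∈ J, #{k ∈ K | P (Fin.castLE hm j, k)} := by
  rw [rect, filter_map, card_map, card_filter, sum_product]
  simp only [card_filter]
  rfl

lemma pr_not_upperRegular_le (hm : m ≤ n) (K : Finset (Fin n)) (κ : ℕ) {ε : ℝ} (hε : 0 < ε)
    (hε1 : ε ≤ 1) :
    pr (fun ω : Fin n × Fin n → Equiv.Perm (Fin ℓ) =>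
      ¬ UpperRegular (nbr hm ω) K κ ((1 + ε) * (m / ℓ))) ≤
    m * (2 ^ n * Real.exp (-(ε ^ 2 * (1 / ℓ * (κ * m)) / 4))) := by
  classical
  have h1 : pr (fun ω : Fin n × Fin n → Equiv.Perm (Fin ℓ) =>
      ¬ UpperRegular (nbr hm ω) K κ ((1 + ε) * (m / ℓ))) ≤
      pr (fun ω : Fin n × Fin n → Equiv.Perm (Fin ℓ) => ∃ i ∈ (univ : Finset (Fin m)),
        ∃ K' ∈ (univ : Finset (Finset (Fin n))), #K' = κ ∧
          (1 + ε) * (1 / ℓ * (κ * m)) ≤ (∑ k ∈ K', load (nbr hm ω) k i : ℝ)) := by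
    refine pr_mono fun ω hω => ?_
    simp only [UpperRegular, not_forall, not_lt] at hω
    obtain ⟨i, K', -, hc, hle⟩ := hω
    exact ⟨i, mem_univ _, K', mem_univ _, hc, le_of_eq_of_le (by ring) hle⟩
  refine h1.trans ?_
  have h2 := pr_exists_le (Ω := Fin n × Fin n → Equiv.Perm (Fin ℓ)) (univ : Finset (Fin m))
    (fun i ω => ∃ K' ∈ (univ : Finset (Finset (Fin n))), #K' = κ ∧
          (1 + ε) * (1 / ℓ * (κ * m)) ≤ (∑ k ∈ K', load (nbr hm ω) k i : ℝ))
    (B := 2 ^ n * Real.exp (-(ε ^ 2 * (1 / ℓ * (κ * m)) / 4)))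
  rw [card_univ, Fintype.card_fin] at h2
  refine h2 fun i _ => ?_
  have h3 := pr_exists_le (Ω := Fin n × Fin n → Equiv.Perm (Fin ℓ))
    (univ : Finset (Finset (Fin n)))
    (fun K' ω => #K' = κ ∧
          (1 + ε) * (1 / ℓ * (κ * m)) ≤ (∑ k ∈ K', load (nbr hm ω) k i : ℝ))
    (B := Real.exp (-(ε ^ 2 * (1 / ℓ * (κ * m)) / 4)))
  rw [card_univ, Fintype.card_finset, Fintype.card_fin] at h3
  push_cast at h3
  refine h3 fun K' _ => ?_
  by_cases hK' : #K' = κ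
  swap
  · simp only [hK', false_and]
    rw [pr_false]
    positivity
  simp only [hK', true_and]
  refine pr_le_of_resample (rect hm (univ.erase i) K') fun ω => ?_
  have h4 : ∀ τ : Fin n × Fin n → Equiv.Perm (Fin ℓ),
      ∑ k ∈ K', load (nbr hm ((rect hm (univ.erase i) K').piecewise τ ω)) k i =
      #{e ∈ rect hm (univ.erase i) K' | τ e 0 = nbr hm ω e.2 i} := by
    intro τ
    rw [card_filter_rect]
    refine sum_congr rfl fun k hk => ?_
    have h5 : nbr hm ((rect hm (univ.erase i) K').piecewise τ ω) k i = nbr hm ω k i := by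
      rw [nbr, piecewise_eq_of_notMem _ _ _ (by simp [mem_rect]), nbr]
    rw [load, h5]
    congr 1
    ext j
    simp only [mem_filter, mem_univ, true_and, mem_erase, and_true]
    refine and_congr_right fun hj => ?_
    rw [nbr, piecewise_eq_of_mem _ _ _ (by simp [mem_rect, hj, hk])]
  have h6 := chernoff_upper (p := 1 / ℓ) (rect hm (univ.erase i) K')
    (fun e (τ : Equiv.Perm (Fin ℓ)) => τ 0 = nbr hm ω e.2 i)
    (fun e _ => pr_perm_apply_eq _ _) (by positivity) hε hε1 (N := κ * m) (by
      rw [card_rect, hK', card_erase_of_mem (mem_univ _), card_univ, Fintype.card_fin, mul_comm]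
      exact_mod_cast Nat.mul_le_mul_left _ (Nat.sub_le _ _))
  refine le_trans (pr_mono fun τ hτ => ?_) h6
  rw [← h4]
  push_cast
  exact hτ

lemma pr_not_lowerRegular_le (hm : m ≤ n) (M : Finset (Fin n)) (t : ℕ) {ε : ℝ} (hε : 0 < ε)
    (hε1 : ε ≤ 1) :
    pr (fun ω : Fin n × Fin n → Equiv.Perm (Fin ℓ) =>
      ¬ LowerRegular (nbr hm ω) M t ((1 - ε) * (#M / ℓ))) ≤
    m * (2 ^ m * Real.exp (-(ε ^ 2 * (1 / ℓ * (t * #M)) / 4))) := by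
  classical
  have h1 : pr (fun ω : Fin n × Fin n → Equiv.Perm (Fin ℓ) =>
      ¬ LowerRegular (nbr hm ω) M t ((1 - ε) * (#M / ℓ))) ≤
      pr (fun ω : Fin n × Fin n → Equiv.Perm (Fin ℓ) => ∃ i ∈ (univ : Finset (Fin m)),
        ∃ J ∈ (univ : Finset (Finset (Fin m))), (i ∉ J ∧ #J = t) ∧
          (∑ j ∈ J, (#{k ∈ M | nbr hm ω k j = nbr hm ω k i} : ℝ)) ≤
            (1 - ε) * (1 / ℓ * (t * #M))) := by
    refine pr_mono fun ω hω => ?_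
    simp only [LowerRegular, not_forall, not_lt] at hω
    obtain ⟨i, J, hi, hc, hle⟩ := hω
    exact ⟨i, mem_univ _, J, mem_univ _, ⟨hi, hc⟩, le_of_le_of_eq hle (by ring)⟩
  refine h1.trans ?_
  have h2 := pr_exists_le (Ω := Fin n × Fin n → Equiv.Perm (Fin ℓ)) (univ : Finset (Fin m))
    (fun i ω => ∃ J ∈ (univ : Finset (Finset (Fin m))), (i ∉ J ∧ #J = t) ∧
          (∑ j ∈ J, (#{k ∈ M | nbr hm ω k j = nbr hm ω k i} : ℝ)) ≤
            (1 - ε) * (1 / ℓ * (t * #M)))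
    (B := 2 ^ m * Real.exp (-(ε ^ 2 * (1 / ℓ * (t * #M)) / 4)))
  rw [card_univ, Fintype.card_fin] at h2
  refine h2 fun i _ => ?_
  have h3 := pr_exists_le (Ω := Fin n × Fin n → Equiv.Perm (Fin ℓ))
    (univ : Finset (Finset (Fin m)))
    (fun J ω => (i ∉ J ∧ #J = t) ∧
          (∑ j ∈ J, (#{k ∈ M | nbr hm ω k j = nbr hm ω k i} : ℝ)) ≤
            (1 - ε) * (1 / ℓ * (t * #M)))
    (B := Real.exp (-(ε ^ 2 * (1 / ℓ * (t * #M)) / 4)))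
  rw [card_univ, Fintype.card_finset, Fintype.card_fin] at h3
  push_cast at h3
  refine h3 fun J _ => ?_
  by_cases hJ : i ∉ J ∧ #J = t
  swap
  · simp only [hJ, false_and]
    rw [pr_false]
    positivity
  simp only [hJ, not_false_eq_true, true_and]
  refine pr_le_of_resample (rect hm J M) fun ω => ?_
  have h4 : ∀ τ : Fin n × Fin n → Equiv.Perm (Fin ℓ),
      ∑ j ∈ J, #{k ∈ M | nbr hm ((rect hm J M).piecewise τ ω) k j =
        nbr hm ((rect hm J M).piecewise τ ω) k i} =
      #{e ∈ rect hm J M | τ e 0 = nbr hm ω e.2 i} := by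
    intro τ
    rw [card_filter_rect']
    refine sum_congr rfl fun j hj => ?_
    congr 1
    refine filter_congr fun k hk => ?_
    have h5 : nbr hm ((rect hm J M).piecewise τ ω) k i = nbr hm ω k i := by
      rw [nbr, piecewise_eq_of_notMem _ _ _ (by simp [mem_rect, hJ.1]), nbr]
    rw [h5, nbr, piecewise_eq_of_mem _ _ _ (by simp [mem_rect, hj, hk])]
  have hℓ : (1 : ℝ) / ℓ ≤ 1 := by
    rw [div_le_one (by exact_mod_cast Nat.pos_of_neZero ℓ)]
    exact_mod_cast Nat.pos_of_neZero ℓ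
  have h6 := chernoff_lower (p := 1 / ℓ) (rect hm J M)
    (fun e (τ : Equiv.Perm (Fin ℓ)) => τ 0 = nbr hm ω e.2 i)
    (fun e _ => pr_perm_apply_eq _ _) (by positivity) hℓ hε hε1
  rw [card_rect, hJ.2] at h6
  push_cast at h6
  refine le_trans (pr_mono fun τ hτ => ?_) h6
  rw [← h4]
  push_cast
  exact hτ

end Events

lemma two_mul_card_filter_lt_le {m : ℕ} (S : Finset (Fin m)) :
    2 * #{p ∈ S ×ˢ S | p.1 < p.2} ≤ #S ^ 2 := by
  have h1 : #{p ∈ S ×ˢ S | p.1 < p.2} = #{p ∈ S ×ˢ S | p.2 < p.1} := by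
    refine card_bij' (fun p _ => p.swap) (fun p _ => p.swap) ?_ ?_ ?_ ?_ <;>
      simp +contextual
  have h2 : #{p ∈ S ×ˢ S | p.1 < p.2} + #{p ∈ S ×ˢ S | p.2 < p.1} ≤ #(S ×ˢ S) := by
    rw [← card_union_of_disjoint]
    · exact card_le_card (union_subset (filter_subset _ _) (filter_subset _ _))
    · exact disjoint_filter.2 fun p _ h => h.asymm
  rw [card_product] at h2
  nlinarith

section Events

variable {n ℓ m : ℕ}

lemma card_pairs_le {c : ℝ} (y : Fin m → Fin ℓ) (a : Fin ℓ) (hc : (#{j | y j = a} : ℝ) ≤ c) :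
    (#{p : Fin m × Fin m | p.1 < p.2 ∧ y p.1 = a ∧ y p.2 = a} : ℝ) ≤ c ^ 2 / 2 := by
  have h1 := two_mul_card_filter_lt_le ({j | y j = a} : Finset (Fin m))
  have h2 : ({p ∈ ({j | y j = a} : Finset (Fin m)) ×ˢ ({j | y j = a} : Finset (Fin m)) |
      p.1 < p.2} : Finset (Fin m × Fin m)) = ({p | p.1 < p.2 ∧ y p.1 = a ∧ y p.2 = a} :
      Finset (Fin m × Fin m)) := by
    ext p
    simp
    tauto
  rw [h2] at h1
  have h3 : (2 : ℝ) * (#{p : Fin m × Fin m | p.1 < p.2 ∧ y p.1 = a ∧ y p.2 = a} : ℝ) ≤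
      (#{j | y j = a} : ℝ) ^ 2 := by exact_mod_cast h1
  have h4 : (#{j | y j = a} : ℝ) ^ 2 ≤ c ^ 2 := by gcongr
  linarith

lemma fewPairs_of_le (x : Fin n → Fin m → Fin ℓ) (M : Finset (Fin n))
    (nonadj : Fin m × Fin m → Prop) {c D : ℝ} (h : c ^ 2 / 2 ≤ D) : FewPairs x M nonadj c D := by
  classical
  intro k _ a hc
  refine le_trans (Nat.cast_le.2 (card_le_card fun p hp => ?_)) ((card_pairs_le (x k) a hc).trans h)
  simp only [mem_filter] at hp ⊢
  exact ⟨hp.1, hp.2.1, hp.2.2.2⟩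

variable [NeZero ℓ]

lemma pr_not_fewPairs_le (hm : m ≤ n) (M : Finset (Fin n)) (hM : ∀ k ∈ M, m ≤ k.val) (c : ℝ)
    {ε : ℝ} (hε : 0 < ε) (hε1 : ε ≤ 1) :
    pr (fun ω : Fin n × Fin n → Equiv.Perm (Fin ℓ) => ¬ FewPairs (nbr hm ω) M
      (fun p => ω (Fin.castLE hm p.1, Fin.castLE hm p.2) 0 ≠ 0) c
        ((1 + ε) * ((1 - 1 / ℓ) * (c ^ 2 / 2)))) ≤
    n * (ℓ * Real.exp (-(ε ^ 2 * ((1 - 1 / ℓ) * (c ^ 2 / 2)) / 4))) := by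
  classical
  set D := (1 + ε) * ((1 - 1 / ℓ) * (c ^ 2 / 2)) with hD
  set B := Real.exp (-(ε ^ 2 * ((1 - 1 / ℓ) * (c ^ 2 / 2)) / 4)) with hB
  set φ : Fin m × Fin m ↪ Fin n × Fin n := (Fin.castLEEmb hm).prodMap (Fin.castLEEmb hm) with hφ
  have hℓ : (1 : ℝ) / ℓ ≤ 1 := by
    rw [div_le_one (by exact_mod_cast Nat.pos_of_neZero ℓ)]
    exact_mod_cast Nat.pos_of_neZero ℓ
  refine pr_le_of_resample (univ.map φ) fun ω => ?_
  have hx : ∀ τ, ∀ k ∈ M, nbr hm ((univ.map φ).piecewise τ ω) k = nbr hm ω k := by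
    intro τ k hk
    ext1 i
    rw [nbr, nbr, piecewise_eq_of_notMem]
    simp only [mem_map, mem_univ, true_and, hφ, Prod.exists, not_exists]
    intro i' j' h
    have h1 := congrArg (fun e => (Prod.snd e).val) h
    simp at h1
    have := hM k hk
    omega
  have h1 : pr (fun τ : Fin n × Fin n → Equiv.Perm (Fin ℓ) =>
      ¬ FewPairs (nbr hm ((univ.map φ).piecewise τ ω)) M
      (fun p => (univ.map φ).piecewise τ ω (Fin.castLE hm p.1, Fin.castLE hm p.2) 0 ≠ 0) c D) ≤
      pr (fun τ : Fin n × Fin n → Equiv.Perm (Fin ℓ) => ∃ k ∈ (univ : Finset (Fin n)),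
        ∃ a ∈ (univ : Finset (Fin ℓ)), (#{j | nbr hm ω k j = a} : ℝ) ≤ c ∧
        D ≤ (#{p : Fin m × Fin m | (p.1 < p.2 ∧ nbr hm ω k p.1 = a ∧ nbr hm ω k p.2 = a) ∧
          τ (φ p) 0 ≠ 0} : ℝ)) := by
    refine pr_mono fun τ hτ => ?_
    simp only [FewPairs, not_forall, not_le] at hτ
    obtain ⟨k, hk, a, hc, hlt⟩ := hτ
    rw [hx τ k hk] at hc hlt
    refine ⟨k, mem_univ _, a, mem_univ _, hc, hlt.le.trans ?_⟩
    refine Nat.cast_le.2 (card_le_card fun p hp => ?_)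
    simp only [mem_filter] at hp ⊢
    obtain ⟨-, h1, h2, h3⟩ := hp
    refine ⟨mem_univ _, ⟨h1, h3⟩, ?_⟩
    have h4 : (Fin.castLE hm p.1, Fin.castLE hm p.2) = φ p := rfl
    rwa [h4, piecewise_eq_of_mem _ _ _ (mem_map_of_mem φ (mem_univ p))] at h2
  refine h1.trans ?_
  have h2 := pr_exists_le (Ω := Fin n × Fin n → Equiv.Perm (Fin ℓ)) (univ : Finset (Fin n))
    (fun k τ => ∃ a ∈ (univ : Finset (Fin ℓ)), (#{j | nbr hm ω k j = a} : ℝ) ≤ c ∧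
        D ≤ (#{p : Fin m × Fin m | (p.1 < p.2 ∧ nbr hm ω k p.1 = a ∧ nbr hm ω k p.2 = a) ∧
          τ (φ p) 0 ≠ 0} : ℝ)) (B := ℓ * B)
  rw [card_univ, Fintype.card_fin] at h2
  refine h2 fun k _ => ?_
  have h3 := pr_exists_le (Ω := Fin n × Fin n → Equiv.Perm (Fin ℓ)) (univ : Finset (Fin ℓ))
    (fun a τ => (#{j | nbr hm ω k j = a} : ℝ) ≤ c ∧
        D ≤ (#{p : Fin m × Fin m | (p.1 < p.2 ∧ nbr hm ω k p.1 = a ∧ nbr hm ω k p.2 = a) ∧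
          τ (φ p) 0 ≠ 0} : ℝ)) (B := B)
  rw [card_univ, Fintype.card_fin] at h3
  refine h3 fun a _ => ?_
  by_cases hc : (#{j | nbr hm ω k j = a} : ℝ) ≤ c
  swap
  · simp only [hc, false_and]
    rw [pr_false]
    positivity
  simp only [hc, true_and]
  set Q : Finset (Fin m × Fin m) :=
    {p | p.1 < p.2 ∧ nbr hm ω k p.1 = a ∧ nbr hm ω k p.2 = a} with hQ
  have h4 := chernoff_upper (p := 1 - 1 / ℓ) (Q.map φ)
    (fun _ (τ : Equiv.Perm (Fin ℓ)) => ¬ τ 0 = 0)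
    (fun e _ => by rw [pr_not, pr_perm_apply_eq]) (by linarith) hε hε1 (N := c ^ 2 / 2) (by
      rw [card_map]
      exact card_pairs_le _ a hc)
  refine le_trans (pr_mono fun τ hτ => ?_) h4
  rw [filter_map, card_map]
  refine hτ.trans_eq ?_
  rw [hQ, filter_filter]
  rfl

lemma pr_exists_linkless_le {s Δ s₀ : ℕ} (hs₀ : s₀ + Δ ≤ s) (x : Fin n → Fin m → Fin ℓ)
    (o₁ o₂ : Fin m → Fin s → Fin n) (ho₁ : ∀ i, Function.Injective (o₁ i))
    (ho₂ : ∀ i, Function.Injective (o₂ i)) :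
    pr (fun τ : Fin n × Fin n → Equiv.Perm (Fin ℓ) => ∃ p ∈ (univ : Finset (Fin m × Fin m)),
      ∃ ST ∈ (univ : Finset (Finset (Fin s) × Finset (Fin s))),
        (s ≤ #ST.1 + Δ ∧ s ≤ #ST.2 + Δ) ∧ ∀ a ∈ ST.1, ∀ b ∈ ST.2,
          τ (o₁ p.1 a, o₂ p.2 b) (x (o₁ p.1 a) p.1) ≠ x (o₂ p.2 b) p.2) ≤
      (m * m) * ((2 ^ s * 2 ^ s) * Real.exp (-(1 / ℓ * (s₀ * s₀)))) := by
  classical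
  have hℓ : (1 : ℝ) / ℓ ≤ 1 := by
    rw [div_le_one (by exact_mod_cast Nat.pos_of_neZero ℓ)]
    exact_mod_cast Nat.pos_of_neZero ℓ
  have h1 := pr_exists_le (Ω := Fin n × Fin n → Equiv.Perm (Fin ℓ))
    (univ : Finset (Fin m × Fin m)) (fun p τ =>
      ∃ ST ∈ (univ : Finset (Finset (Fin s) × Finset (Fin s))),
        (s ≤ #ST.1 + Δ ∧ s ≤ #ST.2 + Δ) ∧ ∀ a ∈ ST.1, ∀ b ∈ ST.2,
          τ (o₁ p.1 a, o₂ p.2 b) (x (o₁ p.1 a) p.1) ≠ x (o₂ p.2 b) p.2)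
    (B := (2 ^ s * 2 ^ s) * Real.exp (-(1 / ℓ * (s₀ * s₀))))
  rw [card_univ, Fintype.card_prod, Fintype.card_fin] at h1
  push_cast at h1
  refine h1 fun p _ => ?_
  have h2 := pr_exists_le (Ω := Fin n × Fin n → Equiv.Perm (Fin ℓ))
    (univ : Finset (Finset (Fin s) × Finset (Fin s))) (fun ST τ =>
        (s ≤ #ST.1 + Δ ∧ s ≤ #ST.2 + Δ) ∧ ∀ a ∈ ST.1, ∀ b ∈ ST.2,
          τ (o₁ p.1 a, o₂ p.2 b) (x (o₁ p.1 a) p.1) ≠ x (o₂ p.2 b) p.2)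
    (B := Real.exp (-(1 / ℓ * (s₀ * s₀))))
  rw [card_univ, Fintype.card_prod, Fintype.card_finset, Fintype.card_fin] at h2
  push_cast at h2
  refine h2 fun ST _ => ?_
  by_cases hST : s ≤ #ST.1 + Δ ∧ s ≤ #ST.2 + Δ
  swap
  · simp only [hST, false_and]
    rw [pr_false]
    positivity
  simp only [hST, true_and]
  set φ : Fin s × Fin s ↪ Fin n × Fin n :=
    (⟨o₁ p.1, ho₁ p.1⟩ : Fin s ↪ Fin n).prodMap ⟨o₂ p.2, ho₂ p.2⟩ with hφ
  have h3 := pr_forall_not_le (p := 1 / ℓ) ((ST.1 ×ˢ ST.2).map φ)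
    (fun e (τ : Equiv.Perm (Fin ℓ)) => τ (x e.1 p.1) = x e.2 p.2)
    (fun e _ => pr_perm_apply_eq _ _) hℓ
  refine (pr_mono fun τ hτ => ?_).trans (h3.trans ?_)
  · simp only [mem_map, forall_exists_index, and_imp]
    rintro _ ⟨a, b⟩ hab rfl
    rw [mem_product] at hab
    exact hτ a hab.1 b hab.2
  · rw [Real.exp_le_exp, card_map, card_product]
    push_cast
    have ha : (s₀ : ℝ) ≤ #ST.1 := by exact_mod_cast (by omega : s₀ ≤ #ST.1)
    have hb : (s₀ : ℝ) ≤ #ST.2 := by exact_mod_cast (by omega : s₀ ≤ #ST.2)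
    gcongr

end Events

section Events

variable {n ℓ m : ℕ} [NeZero ℓ] [NeZero n]

lemma pr_regular_and_not_hasTopClique_le (hm : m ≤ n) {K M R₁ R₂ : Finset (Fin n)}
    (hK : ∀ k ∈ K, m ≤ k.val) (hMK : M ⊆ K) (hR₁K : R₁ ⊆ K) (hR₂K : R₂ ⊆ K)
    (hMR₁ : Disjoint M R₁) (hMR₂ : Disjoint M R₂) (hR : ∀ k ∈ R₁, ∀ k' ∈ R₂, k < k')
    {κ t Δ s s₀ : ℕ} [NeZero s] {h c A D : ℝ} (hκK : κ ≤ #K) (hh : 0 ≤ h) (hc : h + 1 ≤ c)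
    (hD : 0 < D) (hDA : D < A) (hΔ : t + h * κ / (A - D) ≤ Δ)
    (hκ₁ : κ < #R₁) (hs₁ : s * c ≤ #R₁ - κ) (hκ₂ : κ < #R₂) (hs₂ : s * c ≤ #R₂ - κ)
    (hs₀ : s₀ + Δ ≤ s) :
    pr (fun ω : Fin n × Fin n → Equiv.Perm (Fin ℓ) =>
      (UpperRegular (nbr hm ω) K κ h ∧ LowerRegular (nbr hm ω) M t A ∧ FewPairs (nbr hm ω) M
        (fun p => ω (Fin.castLE hm p.1, Fin.castLE hm p.2) 0 ≠ 0) c D) ∧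
      ¬ HasTopClique (liftGraph n ℓ fun i j => ω (i, j)) m) ≤
    (m * m) * ((2 ^ s * 2 ^ s) * Real.exp (-(1 / ℓ * (s₀ * s₀)))) := by
  classical
  refine pr_le_of_resample (R₁ ×ˢ R₂) fun ω => ?_
  have hlow : ∀ τ : Fin n × Fin n → Equiv.Perm (Fin ℓ), ∀ (i : Fin m) (k : Fin n),
      (R₁ ×ˢ R₂).piecewise τ ω (Fin.castLE hm i, k) = ω (Fin.castLE hm i, k) := by
    intro τ i k
    rw [piecewise_eq_of_notMem]
    intro hmem
    have := hK _ (hR₁K (mem_product.1 hmem).1)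
    simp at this
    omega
  have hx : ∀ τ : Fin n × Fin n → Equiv.Perm (Fin ℓ),
      nbr hm ((R₁ ×ˢ R₂).piecewise τ ω) = nbr hm ω := by
    intro τ
    ext1 k
    ext1 i
    rw [nbr, hlow, nbr]
  simp only [hx, hlow]
  by_cases hU : UpperRegular (nbr hm ω) K κ h
  swap
  · simp only [hU, false_and]
    rw [pr_false]
    positivity
  obtain ⟨o₁, ho₁, ho₁'⟩ := exists_reservoirs hR₁K hU hh hc hκ₁ hs₁
  obtain ⟨o₂, ho₂, ho₂'⟩ := exists_reservoirs hR₂K hU hh hc hκ₂ hs₂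
  refine (pr_mono fun τ hτ => ?_).trans (pr_exists_linkless_le hs₀ (nbr hm ω) o₁ o₂
    (fun i a b e => (ho₁' i a i b e (by rw [e])).2)
    (fun i a b e => (ho₂' i a i b e (by rw [e])).2))
  by_contra! hcon
  refine hτ.2 (hasTopClique_of_regular hm (fun i j => (R₁ ×ˢ R₂).piecewise τ ω (i, j))
    (nbr hm ω) (fun k i => ?_) hK hMK hR₁K hR₂K hMR₁ hMR₂ hR hκK hc hD hDA hΔ hU hτ.1.2.1 ?_ o₁ o₂
    ho₁ ho₂ ho₁' ho₂' ?_)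
  · rw [hlow, nbr]
  · simp only [hlow]
    exact hτ.1.2.2
  · intro p S T hS hT
    obtain ⟨a, ha, b, hb, hab⟩ := hcon p (mem_univ _) (S, T) (mem_univ _) ⟨hS, hT⟩
    refine ⟨a, ha, b, hb, ?_⟩
    rw [piecewise_eq_of_mem _ _ _ (mem_product.2 ⟨ho₁ _ _, ho₂ _ _⟩)]
    exact hab

lemma pr_not_hasTopClique_le (hm : m ≤ n) {K M R₁ R₂ : Finset (Fin n)}
    (hK : ∀ k ∈ K, m ≤ k.val) (hMK : M ⊆ K) (hR₁K : R₁ ⊆ K) (hR₂K : R₂ ⊆ K)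
    (hMR₁ : Disjoint M R₁) (hMR₂ : Disjoint M R₂) (hR : ∀ k ∈ R₁, ∀ k' ∈ R₂, k < k')
    {κ t Δ s s₀ : ℕ} [NeZero s] {h c A D : ℝ} (hκK : κ ≤ #K) (hh : 0 ≤ h) (hc : h + 1 ≤ c)
    (hD : 0 < D) (hDA : D < A) (hΔ : t + h * κ / (A - D) ≤ Δ)
    (hκ₁ : κ < #R₁) (hs₁ : s * c ≤ #R₁ - κ) (hκ₂ : κ < #R₂) (hs₂ : s * c ≤ #R₂ - κ)
    (hs₀ : s₀ + Δ ≤ s) :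
    pr (fun ω : Fin n × Fin n → Equiv.Perm (Fin ℓ) =>
      ¬ HasTopClique (liftGraph n ℓ fun i j => ω (i, j)) m) ≤
    pr (fun ω : Fin n × Fin n → Equiv.Perm (Fin ℓ) => ¬ UpperRegular (nbr hm ω) K κ h) +
    pr (fun ω : Fin n × Fin n → Equiv.Perm (Fin ℓ) => ¬ LowerRegular (nbr hm ω) M t A) +
    pr (fun ω : Fin n × Fin n → Equiv.Perm (Fin ℓ) => ¬ FewPairs (nbr hm ω) M
        (fun p => ω (Fin.castLE hm p.1, Fin.castLE hm p.2) 0 ≠ 0) c D) +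
    (m * m) * ((2 ^ s * 2 ^ s) * Real.exp (-(1 / ℓ * (s₀ * s₀)))) := by
  refine le_trans (le_trans (pr_mono fun ω hω => ?_) (pr_or_le _ _))
    (add_le_add (le_trans (pr_or_le _ _) (add_le_add_left (pr_or_le _ _) _))
      (pr_regular_and_not_hasTopClique_le hm hK hMK hR₁K hR₂K hMR₁ hMR₂ hR hκK hh hc hD hDA hΔ
        hκ₁ hs₁ hκ₂ hs₂ hs₀))
  tauto

omit [NeZero ℓ] [NeZero n] in
lemma liftProb_eq (p : SimpleGraph (Fin n × Fin ℓ) → Prop) :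
    liftProb n ℓ p = 1 - pr (fun ω : Fin n × Fin n → Equiv.Perm (Fin ℓ) =>
      ¬ p (liftGraph n ℓ fun i j => ω (i, j))) := by
  classical
  rw [pr_not, sub_sub_cancel]
  unfold liftProb pr ex
  rw [← Fintype.card_congr (Equiv.curry (Fin n) (Fin n) (Equiv.Perm (Fin ℓ)))]
  congr 1
  rw [card_filter]
  push_cast
  refine (Fintype.sum_equiv (Equiv.curry (Fin n) (Fin n) (Equiv.Perm (Fin ℓ))) _ _
    fun ω => ?_).symm
  congr!

lemma le_liftProb (hm : m ≤ n) {ε : ℝ} (hε : 0 < ε) (hε1 : 2 * ε ≤ 1) {r κ t Δ s s₀ : ℕ} [NeZero s]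
    {c D B₁ B₂ B₃ B₄ : ℝ} (hmr : m + 2 * r ≤ n) (hκ : κ < r) (hc : (1 + ε) * (m / ℓ) + 1 ≤ c)
    (hs : s * c ≤ r - κ) (hs₀ : s₀ + Δ ≤ s) (hD : 0 < D)
    (hDA : D < (1 - ε) * ((n - m - 2 * r) / ℓ))
    (hDD : (1 + 2 * ε) * ((1 - 1 / ℓ) * (c ^ 2 / 2)) ≤ D)
    (hΔ : t + (1 + ε) * (m / ℓ) * κ / ((1 - ε) * ((n - m - 2 * r) / ℓ) - D) ≤ Δ)
    (h₁ : m * (2 ^ n * Real.exp (-(ε ^ 2 * (1 / ℓ * (κ * m)) / 4))) ≤ B₁)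
    (h₂ : m * (2 ^ m * Real.exp (-(ε ^ 2 * (1 / ℓ * (t * (n - m - 2 * r))) / 4))) ≤ B₂)
    (h₃ : 1 ≤ (1 + 2 * ε) * (1 - 1 / (ℓ : ℝ)) ∧ 0 ≤ B₃ ∨
      n * (ℓ * Real.exp (-((2 * ε) ^ 2 * ((1 - 1 / ℓ) * (c ^ 2 / 2)) / 4))) ≤ B₃)
    (h₄ : (m * m) * ((2 ^ s * 2 ^ s) * Real.exp (-(1 / ℓ * (s₀ * s₀)))) ≤ B₄)
    {p : SimpleGraph (Fin n × Fin ℓ) → Prop} (hp : ∀ G, HasTopClique G m → p G) :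
    1 - (B₁ + B₂ + B₃ + B₄) ≤ liftProb n ℓ p := by
  set K : Finset (Fin n) := {k | m ≤ k.val} with hK
  set R₁ : Finset (Fin n) := {k | m ≤ k.val ∧ k.val < m + r} with hR₁
  set R₂ : Finset (Fin n) := {k | m + r ≤ k.val ∧ k.val < m + 2 * r} with hR₂
  set M : Finset (Fin n) := {k | m + 2 * r ≤ k.val} with hM
  have hcard : ∀ a b : ℕ, b ≤ n → #({k | a ≤ k.val ∧ k.val < b} : Finset (Fin n)) = b - a := by
    intro a b hb
    rw [← Nat.card_Ico, ← card_map Fin.valEmbedding]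
    congr 1
    ext x
    simp only [mem_map, mem_filter, mem_univ, true_and, Fin.valEmbedding_apply, mem_Ico]
    constructor
    · rintro ⟨k, hk, rfl⟩
      exact hk
    · intro hx
      exact ⟨⟨x, by omega⟩, hx, rfl⟩
  have hcR₁ : #R₁ = r := by rw [hR₁, hcard _ _ (by omega)]; omega
  have hcR₂ : #R₂ = r := by rw [hR₂, hcard _ _ (by omega)]; omega
  have hcM : (#M : ℝ) = n - m - 2 * r := by
    have : #M = n - (m + 2 * r) := by
      rw [← hcard _ _ le_rfl]
      simp [hM]
    rw [this, Nat.cast_sub hmr]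
    push_cast
    ring
  rw [liftProb_eq]
  have hmain := pr_not_hasTopClique_le (ℓ := ℓ) (K := K) (M := M) (R₁ := R₁) (R₂ := R₂) (κ := κ)
    (t := t) (Δ := Δ) (s := s) (s₀ := s₀) (h := (1 + ε) * (m / ℓ)) (c := c)
    (A := (1 - ε) * (#M / ℓ)) (D := D) hm (by simp [hK])
    (fun k => by simp only [hK, hM, mem_filter, mem_univ, true_and]; omega)
    (fun k => by simp only [hK, hR₁, mem_filter, mem_univ, true_and]; omega)
    (fun k => by simp only [hK, hR₂, mem_filter, mem_univ, true_and]; omega)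
    (disjoint_filter.2 fun k _ => by omega) (disjoint_filter.2 fun k _ => by omega)
    (fun k hk k' hk' => by
      simp only [hR₁, hR₂, mem_filter, mem_univ, true_and] at hk hk'
      exact Fin.lt_def.2 (by omega))
    (by
      have : #R₁ ≤ #K := card_le_card fun k => by
        simp only [hK, hR₁, mem_filter, mem_univ, true_and]; omega
      omega)
    (by positivity) hc hD (by rwa [hcM]) (by rwa [hcM]) (by omega) (by rwa [hcR₁]) (by omega)
    (by rwa [hcR₂]) hs₀
  have e₁ := (pr_not_upperRegular_le (ℓ := ℓ) hm K κ hε (by linarith)).trans h₁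
  have e₂ := pr_not_lowerRegular_le (ℓ := ℓ) hm M t hε (by linarith)
  nth_rewrite 2 [hcM] at e₂
  replace e₂ := e₂.trans h₂
  have e₃ : pr (fun ω : Fin n × Fin n → Equiv.Perm (Fin ℓ) => ¬ FewPairs (nbr hm ω) M
      (fun p => ω (Fin.castLE hm p.1, Fin.castLE hm p.2) 0 ≠ 0) c D) ≤ B₃ := by
    rcases h₃ with ⟨h3, h0⟩ | h3
    · refine le_of_eq_of_le ?_ h0
      rw [← pr_false (Ω := Fin n × Fin n → Equiv.Perm (Fin ℓ))]
      congr 1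
      ext ω
      simp only [iff_false, not_not]
      refine fewPairs_of_le _ _ _ (le_trans ?_ hDD)
      rw [← mul_assoc]
      exact le_mul_of_one_le_left (by positivity) h3
    · refine le_trans (pr_mono fun ω hω => ?_) ((pr_not_fewPairs_le hm M
        (fun k hk => ?_) c (ε := 2 * ε) (by linarith) hε1).trans h3)
      · exact fun hF => hω fun k hk a ha => (hF k hk a ha).trans hDD
      · simp only [hM, mem_filter, mem_univ, true_and] at hk
        omega
  have e₀ : pr (fun ω : Fin n × Fin n → Equiv.Perm (Fin ℓ) =>
      ¬ p (liftGraph n ℓ fun i j => ω (i, j))) ≤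
      pr (fun ω : Fin n × Fin n → Equiv.Perm (Fin ℓ) =>
      ¬ HasTopClique (liftGraph n ℓ fun i j => ω (i, j)) m) :=
    pr_mono fun ω hω h => hω (hp _ h)
  linarith

end Events

section Estimates

lemma order_bounds {ε n L : ℝ} (hε : 0 < ε) (hε' : ε ≤ 1 / 4096) (hL : 2 ≤ L)
    (hLn : L ≤ ε ^ 16 * n) {m : ℕ}
    (hm : m = ⌈(1 - 43 * ε) * Real.sqrt (2 * n * L / (1 - 1 / L))⌉₊) :
    n * L ≤ (m : ℝ) ^ 2 ∧ (1 - 1 / L) * (m : ℝ) ^ 2 ≤ (1 - 84 * ε) * (2 * (n * L)) := by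
  have hn : 0 < n := by
    by_contra! h
    have : ε ^ 16 * n ≤ 0 := mul_nonpos_of_nonneg_of_nonpos (by positivity) h
    linarith
  have hβ1 : 1 - 1 / L ≤ 1 := by linarith [show 0 < 1 / L by positivity]
  have hβ2 : 1 / 2 ≤ 1 - 1 / L := by
    have : 1 / L ≤ 1 / 2 := one_div_le_one_div_of_le (by norm_num) hL
    linarith
  set β := 1 - 1 / L with hβ
  set y := Real.sqrt (2 * n * L / β) with hy
  have hy2 : β * y ^ 2 = 2 * (n * L) := by
    rw [hy, Real.sq_sqrt (by positivity)]
    field_simp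
  have hy0 : 0 ≤ y := Real.sqrt_nonneg _
  have hlow : (1 - 43 * ε) * y ≤ m := by
    rw [hm]
    exact Nat.le_ceil _
  have hupp : (m : ℝ) ≤ (1 - 43 * ε) * y + 1 := by
    rw [hm]
    exact (Nat.ceil_lt_add_one (by apply mul_nonneg <;> linarith)).le
  have hy3 : 2 * (n * L) ≤ y ^ 2 := by nlinarith
  have hnL : 4 ≤ ε ^ 16 * (n * L) := by nlinarith
  have hεy : 4 ≤ ε * y := by
    have h1 : ε ^ 16 ≤ ε ^ 2 * (1 / 4096) ^ 14 := by
      calc ε ^ 16 = ε ^ 2 * ε ^ 14 := by ring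
        _ ≤ _ := by gcongr
    have h2 : (4 : ℝ) ^ 2 ≤ (ε * y) ^ 2 := by
      have : ε ^ 16 * (n * L) ≤ ε ^ 2 * (1 / 4096) ^ 14 * (n * L) := by gcongr
      have h4 : ε ^ 2 * (2 * (n * L)) ≤ ε ^ 2 * y ^ 2 := by gcongr
      nlinarith
    exact le_of_sq_le_sq h2 (by positivity)
  constructor
  · calc n * L ≤ y ^ 2 / 2 := by linarith
      _ ≤ ((1 - 43 * ε) * y) ^ 2 := by
        rw [mul_pow]
        nlinarith [sq_nonneg y]
      _ ≤ (m : ℝ) ^ 2 := by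
        gcongr
        apply mul_nonneg <;> linarith
  · have h1 : (m : ℝ) ≤ (1 - 42.75 * ε) * y := by linarith
    have h2 : (m : ℝ) ^ 2 ≤ ((1 - 42.75 * ε) * y) ^ 2 := by gcongr
    calc β * (m : ℝ) ^ 2 ≤ β * ((1 - 42.75 * ε) * y) ^ 2 := by gcongr
      _ = (1 - 42.75 * ε) ^ 2 * (2 * (n * L)) := by rw [← hy2]; ring
      _ ≤ _ := by
        gcongr
        nlinarith

lemma scale_bounds {ε n L m : ℝ} (hε : 0 < ε) (hL : 2 ≤ L)
    (hLn : L ≤ ε ^ 16 * n) (hm : 0 ≤ m) (h1 : n * L ≤ m ^ 2)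
    (h2 : (1 - 1 / L) * m ^ 2 ≤ (1 - 84 * ε) * (2 * (n * L))) :
    m ^ 2 ≤ 4 * (n * L) ∧ L ≤ ε ^ 8 * m ∧ m ≤ 2 * ε ^ 8 * n := by
  have hn : 0 < n := by
    by_contra! h
    have : ε ^ 16 * n ≤ 0 := mul_nonpos_of_nonneg_of_nonpos (by positivity) h
    linarith
  have hβ2 : 1 / 2 ≤ 1 - 1 / L := by
    have : 1 / L ≤ 1 / 2 := one_div_le_one_div_of_le (by norm_num) hL
    linarith
  have h3 : m ^ 2 ≤ 4 * (n * L) := by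
    have : 0 ≤ ε * (n * L) := by positivity
    nlinarith [sq_nonneg m]
  refine ⟨h3, ?_, ?_⟩
  · refine le_of_sq_le_sq ?_ (by positivity)
    calc L ^ 2 = L * L := sq L
      _ ≤ (ε ^ 16 * n) * L := by gcongr
      _ = ε ^ 16 * (n * L) := by ring
      _ ≤ ε ^ 16 * m ^ 2 := by gcongr
      _ = (ε ^ 8 * m) ^ 2 := by ring
  · refine le_of_sq_le_sq ?_ (by positivity)
    calc m ^ 2 ≤ 4 * (n * L) := h3
      _ ≤ 4 * (n * (ε ^ 16 * n)) := by gcongr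
      _ = (2 * ε ^ 8 * n) ^ 2 := by ring

lemma two_pow_le_exp (k : ℕ) : (2 : ℝ) ^ k ≤ Real.exp k := by
  rw [← mul_one (k : ℝ), Real.exp_nat_mul]
  gcongr
  linarith [Real.add_one_le_exp (1 : ℝ)]

lemma upper_failure_le {n m ℓ κ : ℕ} {ε : ℝ} (hmn : m ≤ n) (hℓ : (0 : ℝ) < ℓ)
    (h : (ℓ : ℝ) ≤ ε ^ 5 * m / 8) (hκ : ε ^ 3 * n ≤ κ) :
    m * (2 ^ n * Real.exp (-(ε ^ 2 * (1 / ℓ * (κ * m)) / 4))) ≤ (n : ℝ) ^ 1 * Real.exp (-1 * n) := by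
  have h5 : 2 * (n : ℝ) ≤ ε ^ 2 * (1 / ℓ * (κ * m)) / 4 := by
    calc 2 * (n : ℝ) = 8 * ℓ * n / (4 * ℓ) := by field_simp; ring
      _ ≤ 8 * (ε ^ 5 * m / 8) * n / (4 * ℓ) := by gcongr
      _ = ε ^ 2 * (1 / ℓ * (ε ^ 3 * n * m)) / 4 := by field_simp
      _ ≤ _ := by gcongr
  calc (m : ℝ) * (2 ^ n * Real.exp (-(ε ^ 2 * (1 / ℓ * (κ * m)) / 4)))
      ≤ n * (Real.exp n * Real.exp (-(2 * n))) := by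
        gcongr
        exact two_pow_le_exp n
    _ = _ := by
        rw [← Real.exp_add, pow_one]
        ring_nf

lemma lower_failure_le {n m ℓ t : ℕ} {ε R : ℝ} (hm : (0 : ℝ) < m) (hℓ : (0 : ℝ) < ℓ)
    (hn : 0 < (n : ℝ)) (hnm : (n : ℝ) ≤ m ^ 2) (h : (ℓ : ℝ) ≤ ε ^ 4 * n / 16)
    (ht : ε ^ 2 * m ≤ t) (hR : n / 2 ≤ R) :
    m * (2 ^ m * Real.exp (-(ε ^ 2 * (1 / ℓ * (t * R)) / 4))) ≤ 2 / Real.sqrt n := by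
  have h5 : 2 * (m : ℝ) ≤ ε ^ 2 * (1 / ℓ * (t * R)) / 4 := by
    calc 2 * (m : ℝ) = 8 * ℓ * m / (4 * ℓ) := by field_simp; norm_num
      _ ≤ 8 * (ε ^ 4 * n / 16) * m / (4 * ℓ) := by gcongr
      _ = ε ^ 2 * (1 / ℓ * (ε ^ 2 * m * (n / 2))) / 4 := by field_simp; ring
      _ ≤ _ := by gcongr
  have h7 : (m : ℝ) ^ 2 / 2 ≤ Real.exp m := by
    linarith [Real.quadratic_le_exp_of_nonneg hm.le]
  calc (m : ℝ) * (2 ^ m * Real.exp (-(ε ^ 2 * (1 / ℓ * (t * R)) / 4)))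
      ≤ m * (Real.exp m * Real.exp (-(2 * m))) := by
        gcongr
        exact two_pow_le_exp m
    _ = m / Real.exp m := by
        rw [← Real.exp_add, div_eq_mul_inv, ← Real.exp_neg]
        ring_nf
    _ ≤ m / ((m : ℝ) ^ 2 / 2) := by gcongr
    _ = 2 / m := by field_simp
    _ ≤ 2 / Real.sqrt n := by
        gcongr
        exact Real.sqrt_le_iff.2 ⟨hm.le, hnm⟩

lemma pairs_failure_le {n m ℓ : ℕ} {ε : ℝ} (hε : 0 < ε) (hℓ : 1 / 2 ≤ 1 - 1 / (ℓ : ℝ))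
    (hℓn : (ℓ : ℝ) ≤ n) (hεℓ : ε ≤ 1 / ℓ) (hq : (n : ℝ) / ℓ ≤ (m / ℓ) ^ 2) :
    n * (ℓ * Real.exp (-((2 * ε) ^ 2 *
      ((1 - 1 / ℓ) * (((1 + 2 * ε) * (m / ℓ)) ^ 2 / 2)) / 4))) ≤
    (n : ℝ) ^ 2 * Real.exp (-(ε ^ 3 / 4) * n) := by
  have h5 : ε ^ 3 / 4 * n ≤ (2 * ε) ^ 2 *
      ((1 - 1 / (ℓ : ℝ)) * (((1 + 2 * ε) * (m / ℓ)) ^ 2 / 2)) / 4 := by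
    calc ε ^ 3 / 4 * n = (2 * ε) ^ 2 * (1 / 2 * ((ε * n) / 2)) / 4 := by ring
      _ ≤ (2 * ε) ^ 2 * (1 / 2 * ((1 / ℓ * n) / 2)) / 4 := by gcongr
      _ = (2 * ε) ^ 2 * (1 / 2 * ((n / ℓ) / 2)) / 4 := by
        rw [one_div_mul_eq_div (ℓ : ℝ) n]
      _ ≤ (2 * ε) ^ 2 * ((1 - 1 / (ℓ : ℝ)) * ((m / ℓ) ^ 2 / 2)) / 4 := by
        gcongr
      _ ≤ _ := by
        have h6 : (m / ℓ : ℝ) ≤ (1 + 2 * ε) * (m / ℓ) :=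
          le_mul_of_one_le_left (by positivity) (by linarith)
        gcongr
  calc (n : ℝ) * (ℓ * Real.exp (-((2 * ε) ^ 2 *
      ((1 - 1 / (ℓ : ℝ)) * (((1 + 2 * ε) * (m / ℓ)) ^ 2 / 2)) / 4)))
      ≤ n * (n * Real.exp (-(ε ^ 3 / 4 * n))) := by gcongr
    _ = _ := by ring_nf

lemma links_failure_le {n m ℓ s s₀ : ℕ} {ε : ℝ} (hε : 0 < ε) (hℓ : (0 : ℝ) < ℓ) (hmn : m ≤ n)
    (h1 : (n : ℝ) * ℓ ≤ (m : ℝ) ^ 2) (hs₀ : ε * m / 20 ≤ s₀)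
    (hs : 2 * (s : ℝ) ≤ ε ^ 2 * n / 800) :
    (m * m : ℝ) * (2 ^ s * 2 ^ s * Real.exp (-(1 / ℓ * (s₀ * s₀)))) ≤
    (n : ℝ) ^ 2 * Real.exp (-(ε ^ 2 / 800) * n) := by
  have h5 : ε ^ 2 * n / 400 ≤ 1 / ℓ * (s₀ * s₀) := by
    calc ε ^ 2 * n / 400 = 1 / ℓ * (ε ^ 2 * (n * ℓ) / 400) := by field_simp
      _ ≤ 1 / ℓ * (ε ^ 2 * (m : ℝ) ^ 2 / 400) := by gcongr
      _ = 1 / ℓ * (ε * m / 20 * (ε * m / 20)) := by ring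
      _ ≤ _ := by gcongr
  calc (m * m : ℝ) * (2 ^ s * 2 ^ s * Real.exp (-(1 / ℓ * (s₀ * s₀))))
      ≤ (n * n) * (Real.exp s * Real.exp s * Real.exp (-(ε ^ 2 * n / 400))) := by
        gcongr
        · exact two_pow_le_exp s
        · exact two_pow_le_exp s
    _ ≤ _ := by
        rw [← Real.exp_add, ← Real.exp_add, ← sq]
        gcongr
        linarith

set_option maxHeartbeats 1000000 in
lemma le_liftProb_of_order_bounds {n ℓ m : ℕ} {ε : ℝ} (hε : 0 < ε) (hε' : ε ≤ 1 / 4096)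
    (hℓ : 2 ≤ ℓ) (hℓn : (ℓ : ℝ) ≤ ε ^ 16 * n) (h1 : (n : ℝ) * ℓ ≤ (m : ℝ) ^ 2)
    (h2 : (1 - 1 / (ℓ : ℝ)) * (m : ℝ) ^ 2 ≤ (1 - 84 * ε) * (2 * (n * ℓ)))
    {p : SimpleGraph (Fin n × Fin ℓ) → Prop} (hp : ∀ G, HasTopClique G m → p G) :
    1 - ((n : ℝ) ^ 1 * Real.exp (-1 * n) + 2 / Real.sqrt n + (n : ℝ) ^ 2 * Real.exp (-(ε ^ 3 / 4) * n)
      + (n : ℝ) ^ 2 * Real.exp (-(ε ^ 2 / 800) * n)) ≤ liftProb n ℓ p := by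
  have hL : (2 : ℝ) ≤ ℓ := by exact_mod_cast hℓ
  have hε2 : (1 + 2 * ε) ^ 3 ≤ 1 + 7 * ε := by
    have h4 : ε ^ 2 ≤ ε / 4096 := by nlinarith
    nlinarith
  have hε3 : 1 - 4 * ε ≤ (1 - ε) * (1 - 3 * ε) := by nlinarith
  have hε4 : (1 + 7 * ε) * (1 - 84 * ε) ≤ 1 - 10 * ε := by nlinarith
  have hε5 : 1 ≤ (1 + 2 * ε) * (1 - ε) := by nlinarith
  have hpow : ∀ j k : ℕ, ε ^ (j + k) ≤ ε ^ j * (1 / 4096) ^ k := fun j k => by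
    rw [pow_add]
    gcongr
  obtain ⟨h3, hLm, hmn⟩ := scale_bounds hε hL hℓn (Nat.cast_nonneg m) h1 h2
  have hn0 : (0 : ℝ) < n := by
    by_contra! h
    have : ε ^ 16 * (n : ℝ) ≤ 0 := mul_nonpos_of_nonneg_of_nonpos (by positivity) h
    linarith
  have hm0 : (0 : ℝ) < m := by
    by_contra! h
    have : ε ^ 8 * (m : ℝ) ≤ 0 := mul_nonpos_of_nonneg_of_nonpos (by positivity) h
    linarith
  have f1 : 1 ≤ ε ^ 3 * n / 1000 := by
    have : ε ^ (3 + 13) * (n : ℝ) ≤ ε ^ 3 * (1 / 4096) ^ 13 * n := by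
      gcongr
      exact hpow 3 13
    norm_num at this
    linarith
  have f1' : ε ^ 3 * n ≤ ε * n / 1000 := by
    have : ε ^ (1 + 2) * (n : ℝ) ≤ ε ^ 1 * (1 / 4096) ^ 2 * n := by
      gcongr
      exact hpow 1 2
    norm_num at this
    have h0 : 0 ≤ ε * n := by positivity
    linarith
  have f1'' : ε * n ≤ n / 4096 := by nlinarith
  have f2 : 1 ≤ ε ^ 2 * m / 1000 := by
    have : ε ^ (2 + 6) * (m : ℝ) ≤ ε ^ 2 * (1 / 4096) ^ 6 * m := by
      gcongr
      exact hpow 2 6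
    norm_num at this
    linarith
  have f2' : ε ^ 2 * m ≤ ε * m / 4096 := by
    have h0 : 0 ≤ ε * m := by positivity
    nlinarith
  have f3 : (m : ℝ) ≤ ε * n / 1000 := by
    have : ε ^ (1 + 7) * (n : ℝ) ≤ ε ^ 1 * (1 / 4096) ^ 7 * n := by
      gcongr
      exact hpow 1 7
    norm_num at this
    have h0 : 0 ≤ ε * n := by positivity
    linarith
  have f4 : (ℓ : ℝ) ≤ ε * m := by
    have : ε ^ (1 + 7) * (m : ℝ) ≤ ε ^ 1 * (1 / 4096) ^ 7 * m := by
      gcongr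
      exact hpow 1 7
    norm_num at this
    have h0 : 0 ≤ ε * m := by positivity
    linarith
  have hβ1 : 1 / 2 ≤ 1 - 1 / (ℓ : ℝ) := by
    have : 1 / (ℓ : ℝ) ≤ 1 / 2 := one_div_le_one_div_of_le (by norm_num) hL
    linarith
  obtain ⟨r, hr1, hr2⟩ : ∃ r : ℕ, ε * n ≤ r ∧ (r : ℝ) ≤ 1.01 * (ε * n) :=
    ⟨⌈ε * n⌉₊, Nat.le_ceil _, by linarith [Nat.ceil_lt_add_one (a := ε * n) (by positivity)]⟩
  obtain ⟨κ, hκ1, hκ2⟩ : ∃ κ : ℕ, ε ^ 3 * n ≤ κ ∧ (κ : ℝ) ≤ 2 * (ε ^ 3 * n) :=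
    ⟨⌈ε ^ 3 * n⌉₊, Nat.le_ceil _,
      by linarith [Nat.ceil_lt_add_one (a := ε ^ 3 * n) (by positivity)]⟩
  obtain ⟨t, ht1, ht2⟩ : ∃ t : ℕ, ε ^ 2 * m ≤ t ∧ (t : ℝ) ≤ 2 * (ε ^ 2 * m) :=
    ⟨⌈ε ^ 2 * m⌉₊, Nat.le_ceil _,
      by linarith [Nat.ceil_lt_add_one (a := ε ^ 2 * m) (by positivity)]⟩
  obtain ⟨Δ, hΔ1, hΔ2⟩ : ∃ Δ : ℕ, 3 * (ε ^ 2 * m) ≤ Δ ∧ (Δ : ℝ) ≤ 4 * (ε ^ 2 * m) :=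
    ⟨⌈3 * (ε ^ 2 * m)⌉₊, Nat.le_ceil _,
      by linarith [Nat.ceil_lt_add_one (a := 3 * (ε ^ 2 * m)) (by positivity)]⟩
  obtain ⟨s, hs1, hs2, hs3⟩ : ∃ s : ℕ, ε * m / 17 ≤ s ∧ (s : ℝ) ≤ ε * m / 2 ∧
      (s : ℝ) ≤ r * ℓ / (4 * m) := by
    have hfl := Nat.floor_le (a := (r * ℓ / (4 * m) : ℝ)) (by positivity)
    have hlf := Nat.lt_floor_add_one (r * ℓ / (4 * m) : ℝ)
    refine ⟨⌊(r * ℓ / (4 * m) : ℝ)⌋₊, ?_, ?_, hfl⟩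
    · have : ε * m / 16 ≤ r * ℓ / (4 * m) := by
        rw [le_div_iff₀ (by positivity)]
        calc ε * m / 16 * (4 * m) = ε * (m : ℝ) ^ 2 / 4 := by ring
          _ ≤ ε * (4 * (n * ℓ)) / 4 := by gcongr
          _ = ε * n * ℓ := by ring
          _ ≤ r * ℓ := by gcongr
      linarith
    · refine hfl.trans ?_
      rw [div_le_iff₀ (by positivity)]
      calc (r : ℝ) * ℓ ≤ 1.01 * (ε * n) * ℓ := by gcongr
        _ = 1.01 * ε * (n * ℓ) := by ring
        _ ≤ 1.01 * ε * (m : ℝ) ^ 2 := by gcongr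
        _ ≤ 2 * ε * (m : ℝ) ^ 2 := by gcongr; norm_num
        _ = ε * m / 2 * (4 * m) := by ring
  have hΔs : Δ ≤ s := by
    have : (Δ : ℝ) ≤ s := by linarith
    exact_mod_cast this
  have : NeZero ℓ := ⟨by omega⟩
  have : NeZero n := ⟨by rintro rfl; simp at hn0⟩
  have : NeZero s := by
    constructor
    rintro rfl
    have : 0 < ε * m := by positivity
    norm_num at hs1
    linarith
  have hL0 : (0 : ℝ) < ℓ := by linarith
  have hM : (1 - 3 * ε) * n ≤ (n : ℝ) - m - 2 * r := by linarith
  have hA : (1 - 4 * ε) * (n / ℓ) ≤ (1 - ε) * ((n - m - 2 * r) / ℓ) := by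
    calc (1 - 4 * ε) * (n / ℓ : ℝ) ≤ (1 - ε) * ((1 - 3 * ε) * n / ℓ) := by
          rw [mul_div_assoc, ← mul_assoc]
          gcongr
      _ ≤ _ := by
          gcongr
          linarith
  have hq : (n : ℝ) / ℓ ≤ (m / ℓ) ^ 2 := by
    rw [div_pow, div_le_div_iff₀ (by positivity) (by positivity)]
    calc (n : ℝ) * ℓ ^ 2 = n * ℓ * ℓ := by ring
      _ ≤ (m : ℝ) ^ 2 * ℓ := by gcongr
  have hmn' : m ≤ n := by
    have : (m : ℝ) ≤ n := by linarith
    exact_mod_cast this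
  refine le_liftProb (n := n) (ℓ := ℓ) (m := m) (ε := ε) (r := r) (κ := κ) (t := t) (Δ := Δ) (s := s)
    (s₀ := s - Δ) (c := (1 + 2 * ε) * (m / ℓ)) (D := (1 - 10 * ε) * (n / ℓ)) ?_ hε ?_ ?_ ?_ ?_ ?_
    ?_ ?_ ?_ ?_ ?_ ?_ ?_ ?_ ?_ hp
  · exact hmn'
  · linarith
  · have : (m : ℝ) + 2 * r ≤ n := by linarith
    exact_mod_cast this
  · have : (κ : ℝ) < r := by linarith
    exact_mod_cast this
  · have : 1 ≤ ε * (m / ℓ) := by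
      rw [← mul_div_assoc, le_div_iff₀ hL0]
      linarith
    linarith
  · calc (s : ℝ) * ((1 + 2 * ε) * (m / ℓ)) ≤ (r * ℓ / (4 * m)) * ((1 + 2 * ε) * (m / ℓ)) := by
          gcongr
      _ = (1 + 2 * ε) * r / 4 := by field_simp
      _ ≤ 2 * r / 4 := by gcongr; linarith
      _ ≤ r - κ := by linarith
  · omega
  · apply mul_pos
    · linarith
    · positivity
  · refine lt_of_lt_of_le ?_ hA
    gcongr
    norm_num
  · calc (1 + 2 * ε) * ((1 - 1 / (ℓ : ℝ)) * (((1 + 2 * ε) * (m / ℓ)) ^ 2 / 2))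
        = (1 + 2 * ε) ^ 3 * ((1 - 1 / (ℓ : ℝ)) * m ^ 2) / (2 * ℓ ^ 2) := by
          field_simp
      _ ≤ (1 + 7 * ε) * ((1 - 84 * ε) * (2 * (n * ℓ))) / (2 * ℓ ^ 2) := by
          gcongr
      _ = ((1 + 7 * ε) * (1 - 84 * ε)) * (n / ℓ) := by field_simp
      _ ≤ _ := by
          gcongr
  · have h5 : 6 * ε * (n / ℓ) ≤ (1 - ε) * ((n - m - 2 * r) / ℓ) - (1 - 10 * ε) * (n / ℓ) := by
      linarith
    have h6 : (1 + ε) * (m / ℓ) * κ / ((1 - ε) * ((n - m - 2 * r) / ℓ) - (1 - 10 * ε) * (n / ℓ)) ≤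
        ε ^ 2 * m := by
      calc _ ≤ 2 * (m / ℓ) * (2 * (ε ^ 3 * n)) / (6 * ε * (n / ℓ)) := by
            gcongr
            linarith
        _ = 4 / 6 * (ε ^ 2 * m) := by
            field_simp
            norm_num
        _ ≤ _ := by
            have : 0 ≤ ε ^ 2 * m := by positivity
            linarith
    linarith
  · refine upper_failure_le hmn' hL0 ?_ hκ1
    have : ε ^ (5 + 3) * (m : ℝ) ≤ ε ^ 5 * (1 / 4096) ^ 3 * m := by
      gcongr
      exact hpow 5 3
    norm_num at this
    have h0 : 0 ≤ ε ^ 5 * m := by positivity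
    linarith
  · refine lower_failure_le hm0 hL0 hn0 ?_ ?_ ht1 ?_
    · exact (le_mul_of_one_le_right hn0.le (by linarith)).trans h1
    · have : ε ^ (4 + 12) * (n : ℝ) ≤ ε ^ 4 * (1 / 4096) ^ 12 * n := by
        gcongr
        exact hpow 4 12
      norm_num at this
      have h0 : 0 ≤ ε ^ 4 * n := by positivity
      linarith
    · linarith
  · by_cases hc : 1 / (ℓ : ℝ) ≤ ε
    · left
      refine ⟨hε5.trans ?_, by positivity⟩
      gcongr
    · right
      refine pairs_failure_le hε hβ1 (f4.trans ?_) (not_le.1 hc).le hq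
      have : ε * m ≤ 1 * m := by
        gcongr
        linarith
      linarith
  · refine links_failure_le hε hL0 hmn' h1 ?_ ?_
    · rw [Nat.cast_sub hΔs]
      have : 0 ≤ ε * m := by positivity
      linarith
    · have : ε ^ (1 + 7) * (n : ℝ) ≤ ε ^ 1 * (1 / 4096) ^ 7 * n := by
        gcongr
        exact hpow 1 7
      norm_num at this
      have h7 : (m : ℝ) ≤ ε * n / 1600 := by
        have h0 : 0 ≤ ε * n := by positivity
        linarith
      have h8 : ε * m ≤ ε * (ε * n / 1600) := by gcongr
      have h9 : ε * (ε * n / 1600) = ε ^ 2 * n / 1600 := by ring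
      have h10 : 0 ≤ ε ^ 2 * n := by positivity
      linarith

end Estimates

section Limit

open Filter Topology

lemma tendsto_pow_mul_exp_neg (k : ℕ) {b : ℝ} (hb : 0 < b) :
    Tendsto (fun n : ℕ => (n : ℝ) ^ k * Real.exp (-b * n)) atTop (𝓝 0) := by
  have h := (tendsto_rpow_mul_exp_neg_mul_atTop_nhds_zero k b hb).comp
    tendsto_natCast_atTop_atTop
  simpa [Function.comp_def] using h

lemma tendsto_failure {ε : ℝ} (hε : 0 < ε) :
    Tendsto (fun n : ℕ => (n : ℝ) ^ 1 * Real.exp (-1 * n) + 2 / Real.sqrt n +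
      (n : ℝ) ^ 2 * Real.exp (-(ε ^ 3 / 4) * n) + (n : ℝ) ^ 2 * Real.exp (-(ε ^ 2 / 800) * n))
      atTop (𝓝 0) := by
  have h1 : Tendsto (fun n : ℕ => 2 / Real.sqrt n) atTop (𝓝 0) :=
    Tendsto.const_div_atTop (Real.tendsto_sqrt_atTop.comp tendsto_natCast_atTop_atTop) _
  simpa using (((tendsto_pow_mul_exp_neg 1 one_pos).add h1).add
    (tendsto_pow_mul_exp_neg 2 (b := ε ^ 3 / 4) (by positivity))).add
    (tendsto_pow_mul_exp_neg 2 (b := ε ^ 2 / 800) (by positivity))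

end Limit

end LiftClique

/-- Let `0 < ε < 2⁻¹²`. For every `δ > 0` there exists `N` such that for all `n ≥ N`
and all integers `2 ≤ ℓ ≤ ε¹⁶ n`, a uniformly random `ℓ`-lift of `K_n` contains, with
probability at least `1 - δ`, a topological clique of order at least
`(1-43ε)√(2nℓ/(1-1/ℓ))`. -/
theorem stmt5 (ε : ℝ) (hε : 0 < ε) (hε' : ε < (2 : ℝ) ^ (-12 : ℤ)) (δ : ℝ) (hδ : 0 < δ) :
    ∃ N : ℕ, ∀ n : ℕ, N ≤ n → ∀ ℓ : ℕ, 2 ≤ ℓ → (ℓ : ℝ) ≤ ε ^ 16 * n →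
      1 - δ ≤ liftProb n ℓ (fun G => ∃ m : ℕ,
        (1 - 43 * ε) * Real.sqrt (2 * n * ℓ / (1 - 1 / (ℓ : ℝ))) ≤ (m : ℝ) ∧
        HasTopClique G m) := by
  have hε1 : ε ≤ 1 / 4096 := by
    norm_num at hε'
    linarith
  obtain ⟨N, hN⟩ := Filter.eventually_atTop.1
    ((LiftClique.tendsto_failure hε).eventually (ge_mem_nhds hδ))
  refine ⟨N, fun n hn ℓ hℓ hℓn => ?_⟩
  obtain ⟨h1, h2⟩ := LiftClique.order_bounds hε hε1 (by exact_mod_cast hℓ) hℓn rfl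
  exact (sub_le_sub_left (hN n hn) 1).trans
    (LiftClique.le_liftProb_of_order_bounds hε hε1 hℓ hℓn h1 h2
      fun G hG => ⟨_, Nat.le_ceil _, hG⟩)
end

section
/- For every ε > 0 and δ > 0 there exists N such that for all n ≥ N and every integer ℓ ≥ 2, the probability that a uniformly random ℓ-lift of K_n contains a topological clique of order at least (1+ε)·√(2nℓ/(1−1/ℓ)) is at most δ. -/
open Finset

theorem Real.exp_le_add_exp_sq (y : ℝ) : Real.exp y ≤ y + Real.exp (y ^ 2) := by
  have h1 := Real.add_one_le_exp (y ^ 2)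
  rcases le_or_gt |y| 1 with h | h
  · have := (abs_le.mp (Real.abs_exp_sub_one_sub_id_le h)).2
    linarith
  · rcases lt_abs.mp h with h | h
    · have : Real.exp y ≤ Real.exp (y ^ 2) := Real.exp_le_exp.mpr (by nlinarith)
      linarith
    · have : Real.exp y ≤ 1 := Real.exp_le_one_iff.mpr (by linarith)
      nlinarith

/-- A centred function with square at most `V` is sub-Gaussian for the counting measure. -/
theorem sum_exp_mul_le_card_mul_exp {α : Type*} [Fintype α] (X : α → ℝ) (V c : ℝ)
    (h0 : ∑ a, X a = 0) (hV : ∀ a, X a ^ 2 ≤ V) :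
    ∑ a, Real.exp (c * X a) ≤ Fintype.card α * Real.exp (c ^ 2 * V) := by
  calc ∑ a, Real.exp (c * X a) ≤ ∑ a, (c * X a + Real.exp (c ^ 2 * V)) := by
        refine sum_le_sum fun a _ => (Real.exp_le_add_exp_sq _).trans ?_
        have : (c * X a) ^ 2 ≤ c ^ 2 * V := by
          rw [mul_pow]; exact mul_le_mul_of_nonneg_left (hV a) (sq_nonneg c)
        gcongr
    _ = _ := by
        rw [sum_add_distrib, ← mul_sum, h0]
        simp

theorem sum_exp_sum_le_card_mul_exp {ι α : Type*} [Fintype ι] [DecidableEq ι] [Fintype α]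
    (X : ι → ι → α → ℝ) (V : ι → ι → ℝ) (c : ℝ)
    (h0 : ∀ i j, ∑ a, X i j a = 0) (hV : ∀ i j a, X i j a ^ 2 ≤ V i j) :
    ∑ σ : ι → ι → α, Real.exp (c * ∑ i, ∑ j, X i j (σ i j)) ≤
      Fintype.card (ι → ι → α) * Real.exp (c ^ 2 * ∑ i, ∑ j, V i j) := by
  have key : ∑ σ : ι → ι → α, Real.exp (c * ∑ i, ∑ j, X i j (σ i j)) =
      ∏ i, ∏ j, ∑ a, Real.exp (c * X i j a) := by
    simp_rw [Fintype.prod_sum, mul_sum, Real.exp_sum]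
  rw [key]
  calc ∏ i, ∏ j, ∑ a, Real.exp (c * X i j a)
      ≤ ∏ i, ∏ j, (Fintype.card α * Real.exp (c ^ 2 * V i j)) := by
        refine prod_le_prod (fun i _ => by positivity) fun i _ => ?_
        exact prod_le_prod (fun j _ => by positivity) fun j _ =>
          sum_exp_mul_le_card_mul_exp _ _ _ (h0 i j) (hV i j)
    _ = _ := by
        simp_rw [prod_mul_distrib, mul_sum, Real.exp_sum]
        simp [Fintype.card_pi]

theorem card_mul_card_perm_filter_apply_eq {α : Type*} [Fintype α] [DecidableEq α] (x y : α) :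
    Fintype.card α * #{p : Equiv.Perm α | p x = y} = Fintype.card (Equiv.Perm α) := by
  have h : ∀ z : α, #{p : Equiv.Perm α | p x = z} = #{p : Equiv.Perm α | p x = y} := by
    intro z
    refine card_bij' (fun p _ => Equiv.swap z y * p) (fun p _ => Equiv.swap z y * p) ?_ ?_ ?_ ?_
    · intro p hp; simp_all
    · intro p hp; simp_all
    · intro p _; simp [← mul_assoc]
    · intro p _; simp [← mul_assoc]
  have := card_eq_sum_card_fiberwise (f := fun p : Equiv.Perm α => p x) (s := univ) (t := univ)
    (by simp)
  simp_rw [h] at this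
  simpa using this.symm

theorem sum_card_filter_perm_apply_mem {α : Type*} [Fintype α] [DecidableEq α]
    (A B : Finset α) :
    Fintype.card α * ∑ p : Equiv.Perm α, #{x ∈ A | p x ∈ B} =
      Fintype.card (Equiv.Perm α) * (#A * #B) := by
  have h : ∀ p : Equiv.Perm α, #{x ∈ A | p x ∈ B} =
      ∑ x ∈ A, ∑ y ∈ B, if p x = y then 1 else 0 := by
    intro p
    rw [card_filter]
    simp
  simp_rw [h]
  rw [sum_comm]
  simp_rw [sum_comm (s := univ) (t := B), ← card_filter, mul_sum,
    card_mul_card_perm_filter_apply_eq]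
  simp
  ring

/-- The part of a set of vertices lying in the fiber of `i`. -/
def fiberSlice {n ℓ : ℕ} (S : Finset (Fin n × Fin ℓ)) (i : Fin n) : Finset (Fin ℓ) :=
  {x | (i, x) ∈ S}

theorem sum_card_fiberSlice {n ℓ : ℕ} (S : Finset (Fin n × Fin ℓ)) :
    ∑ i, #(fiberSlice S i) = #S := by
  simp_rw [fiberSlice, card_filter]
  rw [← Fintype.sum_prod_type (f := fun v => if v ∈ S then 1 else 0)]
  simp

theorem two_mul_sum_lt_mul_le_sq {ι : Type*} [Fintype ι] [LinearOrder ι] (a : ι → ℝ)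
    (ha : ∀ i, 0 ≤ a i) :
    2 * ∑ i, ∑ j, (if i < j then a i * a j else 0) ≤ (∑ i, a i) ^ 2 := by
  have hs : ∑ i, ∑ j, (if i < j then a i * a j else 0) =
      ∑ i, ∑ j, (if j < i then a i * a j else 0) := by
    rw [sum_comm]
    simp_rw [mul_comm]
  rw [two_mul]
  nth_rewrite 2 [hs]
  rw [sq, sum_mul_sum, ← sum_add_distrib]
  refine sum_le_sum fun i _ => ?_
  rw [← sum_add_distrib]
  refine sum_le_sum fun j _ => ?_
  have := mul_nonneg (ha i) (ha j)
  rcases lt_trichotomy i j with h | h | h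
  · simp [h, h.not_gt]
  · simpa [h] using mul_nonneg (ha j) (ha j)
  · simp [h, h.not_gt]

/-- The number of edges spanned by `S` in the lift determined by `σ`. -/
def spannedEdges {n ℓ : ℕ} (S : Finset (Fin n × Fin ℓ))
    (σ : Fin n → Fin n → Equiv.Perm (Fin ℓ)) : ℕ :=
  ∑ i, ∑ j, if i < j then #{x ∈ fiberSlice S i | σ i j x ∈ fiberSlice S j} else 0

theorem card_spannedEdges_ge_le {n ℓ : ℕ} (hℓ : 0 < ℓ) (S : Finset (Fin n × Fin ℓ)) (c t : ℝ)
    (hc : 0 ≤ c) :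
    (#{σ : Fin n → Fin n → Equiv.Perm (Fin ℓ) |
        (#S : ℝ) ^ 2 / (2 * ℓ) + t ≤ spannedEdges S σ} : ℝ) ≤
      Fintype.card (Fin n → Fin n → Equiv.Perm (Fin ℓ)) *
        Real.exp (c ^ 2 * (#S : ℝ) ^ 2 / 2 - c * t) := by
  have hℓ' : (0 : ℝ) < ℓ := by exact_mod_cast hℓ
  set a : Fin n → ℝ := fun i => #(fiberSlice S i) with ha
  set X : Fin n → Fin n → Equiv.Perm (Fin ℓ) → ℝ := fun i j p =>
    if i < j then (#{x ∈ fiberSlice S i | p x ∈ fiberSlice S j} : ℝ) - a i * a j / ℓ else 0 with hX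
  set V : Fin n → Fin n → ℝ := fun i j => if i < j then a i * a j else 0 with hVdef
  have haS : ∑ i, a i = #S := by
    rw [← sum_card_fiberSlice S, Nat.cast_sum]
  have hVS : ∑ i, ∑ j, V i j ≤ (#S : ℝ) ^ 2 / 2 := by
    have := two_mul_sum_lt_mul_le_sq a (fun i => Nat.cast_nonneg _)
    rw [haS] at this
    linarith
  have h0 : ∀ i j, ∑ p, X i j p = 0 := by
    intro i j
    by_cases hij : i < j
    · simp only [hX, hij, if_true, sum_sub_distrib]
      have := sum_card_filter_perm_apply_mem (fiberSlice S i) (fiberSlice S j)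
      rw [Fintype.card_fin] at this
      have h2 : (ℓ : ℝ) * ∑ p : Equiv.Perm (Fin ℓ),
          (#{x ∈ fiberSlice S i | p x ∈ fiberSlice S j} : ℝ) =
          Fintype.card (Equiv.Perm (Fin ℓ)) * (a i * a j) := by
        simp only [ha]
        exact_mod_cast this
      rw [sum_const, nsmul_eq_mul, card_univ, sub_eq_zero]
      field_simp
      linarith
    · simp [hX, hij]
  have hV : ∀ i j p, X i j p ^ 2 ≤ V i j := by
    intro i j p
    by_cases hij : i < j
    · simp only [hX, hVdef, hij, if_true]
      have hai : a i ≤ ℓ := by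
        simpa [ha] using card_le_univ (fiberSlice S i)
      have haj : a j ≤ ℓ := by
        simpa [ha] using card_le_univ (fiberSlice S j)
      have hi0 : 0 ≤ a i := Nat.cast_nonneg _
      have hj0 : 0 ≤ a j := Nat.cast_nonneg _
      have hx1 : (#{x ∈ fiberSlice S i | p x ∈ fiberSlice S j} : ℝ) ≤ a i :=
        Nat.cast_le.mpr (card_filter_le _ _)
      have hx2 : (#{x ∈ fiberSlice S i | p x ∈ fiberSlice S j} : ℝ) ≤ a j := by
        have : #{x ∈ fiberSlice S i | p x ∈ fiberSlice S j} ≤ #(fiberSlice S j) :=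
          card_le_card_of_injOn p (fun x hx => (mem_filter.mp hx).2) p.injective.injOn
        exact Nat.cast_le.mpr this
      have hx0 : (0 : ℝ) ≤ #{x ∈ fiberSlice S i | p x ∈ fiberSlice S j} := Nat.cast_nonneg _
      have hm0 : 0 ≤ a i * a j / ℓ := by positivity
      have hm1 : a i * a j / ℓ ≤ a i := by
        rw [div_le_iff₀ hℓ']; exact mul_le_mul_of_nonneg_left haj hi0
      have hm2 : a i * a j / ℓ ≤ a j := by
        rw [div_le_iff₀ hℓ', mul_comm]; exact mul_le_mul_of_nonneg_left hai hj0
      rw [sq, ← abs_mul_abs_self]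
      exact mul_le_mul (abs_le.mpr ⟨by linarith, by linarith⟩)
        (abs_le.mpr ⟨by linarith, by linarith⟩) (abs_nonneg _) hi0
    · simp [hX, hVdef, hij]
  have hsum : ∀ σ : Fin n → Fin n → Equiv.Perm (Fin ℓ),
      (spannedEdges S σ : ℝ) - (∑ i, ∑ j, V i j) / ℓ = ∑ i, ∑ j, X i j (σ i j) := by
    intro σ
    simp only [spannedEdges, hX, hVdef]
    push_cast
    simp_rw [sum_div, ← sum_sub_distrib]
    refine sum_congr rfl fun i _ => sum_congr rfl fun j _ => ?_
    split_ifs <;> simp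
  have hM := sum_exp_sum_le_card_mul_exp X V c h0 hV
  have hmark : (#{σ : Fin n → Fin n → Equiv.Perm (Fin ℓ) |
        (#S : ℝ) ^ 2 / (2 * ℓ) + t ≤ spannedEdges S σ} : ℝ) * Real.exp (c * t) ≤
      ∑ σ : Fin n → Fin n → Equiv.Perm (Fin ℓ), Real.exp (c * ∑ i, ∑ j, X i j (σ i j)) := by
    rw [← nsmul_eq_mul]
    refine le_trans (card_nsmul_le_sum _ _ _ fun σ hσ => ?_)
      (sum_le_sum_of_subset_of_nonneg (subset_univ _) fun _ _ _ => (Real.exp_pos _).le)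
    rw [← hsum]
    have h1 := (mem_filter.mp hσ).2
    have h2 : (∑ i, ∑ j, V i j) / ℓ ≤ (#S : ℝ) ^ 2 / (2 * ℓ) := by
      rw [← div_div]; gcongr
    exact Real.exp_le_exp.mpr (mul_le_mul_of_nonneg_left (by linarith) hc)
  have hfin : Real.exp (c ^ 2 * ∑ i, ∑ j, V i j) ≤ Real.exp (c ^ 2 * (#S : ℝ) ^ 2 / 2) := by
    rw [mul_div_assoc]; gcongr
  rw [Real.exp_sub, ← mul_div_assoc, le_div_iff₀ (Real.exp_pos _)]
  exact hmark.trans (hM.trans (by gcongr))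

theorem HasTopClique.mono {V : Type*} {G : SimpleGraph V} {k m : ℕ} (hkm : k ≤ m)
    (h : HasTopClique G m) : HasTopClique G k := by
  obtain ⟨f, hf, P, h1, h2, h3⟩ := h
  have hlt : ∀ {i j : Fin k}, i < j → Fin.castLE hkm i < Fin.castLE hkm j := fun h => h
  refine ⟨f ∘ Fin.castLE hkm, hf.comp (Fin.castLE_injective hkm),
    fun i j => P (Fin.castLE hkm i) (Fin.castLE hkm j), fun i j hij => h1 _ _ (hlt hij),
    fun i j hij l => h2 _ _ (hlt hij) _, fun i j i' j' hij hij' hne => ?_⟩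
  refine h3 _ _ _ _ (hlt hij) (hlt hij') fun he => hne ?_
  simpa [Prod.ext_iff] using he

theorem SimpleGraph.Walk.exists_mem_support_tail_dropLast {V : Type*} {G : SimpleGraph V}
    {u v : V} (p : G.Walk u v) (hne : u ≠ v) (hadj : ¬ G.Adj u v) :
    ∃ x, x ∈ p.support.tail.dropLast := by
  cases p with
  | nil => exact absurd rfl hne
  | cons h q =>
    cases q with
    | nil => exact absurd h hadj
    | cons h' r =>
      exact ⟨_, by
        rw [SimpleGraph.Walk.support_cons, List.tail_cons, SimpleGraph.Walk.support_cons,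
          List.dropLast_cons_of_ne_nil r.support_ne_nil]
        exact List.mem_cons_self⟩

open Classical in
/-- Non-adjacent pairs of branch vertices use distinct subdividing vertices. -/
theorem HasTopCliqueFun.card_not_adj_le {V : Type*} [Fintype V] {G : SimpleGraph V} {m : ℕ}
    {f : Fin m → V} (h : HasTopCliqueFun G f) :
    #{e : Fin m × Fin m | e.1 < e.2 ∧ ¬ G.Adj (f e.1) (f e.2)} ≤ Fintype.card V := by
  obtain ⟨hf, P, -, -, h3⟩ := h
  have hex : ∀ e : Fin m × Fin m, ∃ x : V, e.1 < e.2 ∧ ¬ G.Adj (f e.1) (f e.2) →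
      x ∈ (P e.1 e.2).support.tail.dropLast := by
    intro e
    by_cases he : e.1 < e.2 ∧ ¬ G.Adj (f e.1) (f e.2)
    · obtain ⟨x, hx⟩ := (P e.1 e.2).exists_mem_support_tail_dropLast
        (fun hh => he.1.ne (hf hh)) he.2
      exact ⟨x, fun _ => hx⟩
    · exact ⟨f e.1, fun hh => absurd hh he⟩
  choose g hg using hex
  refine card_le_card_of_injOn g (fun _ _ => mem_univ _) ?_
  intro e he e' he' hee
  simp only [coe_filter, mem_univ, true_and, Set.mem_ofPred_eq] at he he'
  by_contra hne
  exact h3 e.1 e.2 e'.1 e'.2 he.1 he'.1 hne (g e) (hg e he) (hee ▸ hg e' he')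

theorem spannedEdges_eq_card {n ℓ : ℕ} (S : Finset (Fin n × Fin ℓ))
    (σ : Fin n → Fin n → Equiv.Perm (Fin ℓ)) :
    spannedEdges S σ =
      #{e ∈ S ×ˢ S | e.1.1 < e.2.1 ∧ σ e.1.1 e.2.1 e.1.2 = e.2.2} := by
  have h : #{e ∈ S ×ˢ S | e.1.1 < e.2.1 ∧ σ e.1.1 e.2.1 e.1.2 = e.2.2} =
      ∑ u : Fin n × Fin ℓ, ∑ v : Fin n × Fin ℓ,
        if (u ∈ S ∧ v ∈ S) ∧ u.1 < v.1 ∧ σ u.1 v.1 u.2 = v.2 then 1 else 0 := by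
    rw [← Fintype.sum_prod_type (f := fun e : (Fin n × Fin ℓ) × (Fin n × Fin ℓ) =>
      if (e.1 ∈ S ∧ e.2 ∈ S) ∧ e.1.1 < e.2.1 ∧ σ e.1.1 e.2.1 e.1.2 = e.2.2 then 1 else 0),
      ← card_filter]
    congr 1
    ext e
    simp
  rw [h, Fintype.sum_prod_type, spannedEdges]
  simp_rw [Fintype.sum_prod_type]
  refine sum_congr rfl fun i _ => ?_
  rw [sum_comm]
  refine sum_congr rfl fun j _ => ?_
  by_cases hij : i < j
  · simp only [hij, if_true, true_and]
    rw [show fiberSlice S i = ({x | (i, x) ∈ S} : Finset _) from rfl, filter_filter, card_filter]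
    refine sum_congr rfl fun x _ => ?_
    rw [Fintype.sum_eq_single (σ i j x) fun y hy => by simp [hy.symm]]
    simp [fiberSlice]
  · simp [hij]

open Classical in
theorem card_adj_le_spannedEdges {n ℓ m : ℕ} (σ : Fin n → Fin n → Equiv.Perm (Fin ℓ))
    (f : Fin m → Fin n × Fin ℓ) (hf : Function.Injective f) :
    #{e : Fin m × Fin m | e.1 < e.2 ∧ (liftGraph n ℓ σ).Adj (f e.1) (f e.2)} ≤
      spannedEdges (univ.image f) σ := by
  rw [spannedEdges_eq_card]
  refine card_le_card_of_injOn (fun e =>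
    if (f e.1).1 < (f e.2).1 then (f e.1, f e.2) else (f e.2, f e.1)) ?_ ?_
  · intro e he
    simp only [coe_filter, mem_univ, true_and, Set.mem_ofPred_eq, liftGraph,
      SimpleGraph.fromRel_adj] at he
    simp only [coe_filter, mem_product, Set.mem_ofPred_eq]
    obtain ⟨-, -, h | h⟩ := he
    · simp [h.1, h.2]
    · simp [h.1, h.1.not_gt, h.2]
  · intro e he e' he' hee
    simp only [coe_filter, mem_univ, true_and, Set.mem_ofPred_eq] at he he'
    have h1 := he.1
    have h2 := he'.1
    simp only at hee
    split_ifs at hee <;> simp only [Prod.mk.injEq, hf.eq_iff] at hee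
    · exact Prod.ext hee.1 hee.2
    · rw [hee.1, hee.2] at h1; exact absurd h1 h2.not_gt
    · rw [hee.1, hee.2] at h1; exact absurd h1 h2.not_gt
    · exact Prod.ext hee.2 hee.1

theorem two_mul_card_filter_lt (m : ℕ) :
    2 * #{e : Fin m × Fin m | e.1 < e.2} + m = m * m := by
  have h : #{e : Fin m × Fin m | e.1 < e.2} = ∑ j ∈ range m, j := by
    rw [card_filter, Fintype.sum_prod_type, sum_comm,
      ← Fin.sum_univ_eq_sum_range (fun j => j)]
    refine sum_congr rfl fun j _ => ?_
    rw [← card_filter, filter_gt_eq_Iio, Fin.card_Iio]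
  rw [h, mul_comm 2, sum_range_id_mul_two]
  cases m with
  | zero => rfl
  | succ k => simp; ring

theorem HasTopCliqueFun.sq_le {n ℓ m : ℕ} {σ : Fin n → Fin n → Equiv.Perm (Fin ℓ)}
    {f : Fin m → Fin n × Fin ℓ} (h : HasTopCliqueFun (liftGraph n ℓ σ) f) :
    m * m ≤ 2 * spannedEdges (univ.image f) σ + 2 * (n * ℓ) + m := by
  classical
  have h1 := h.card_not_adj_le
  have h2 := card_adj_le_spannedEdges σ f h.1
  have h3 := card_filter_add_card_filter_not (s := ({e : Fin m × Fin m | e.1 < e.2} : Finset _))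
    (fun e => (liftGraph n ℓ σ).Adj (f e.1) (f e.2))
  rw [filter_filter, filter_filter] at h3
  have h4 := two_mul_card_filter_lt m
  simp only [Fintype.card_prod, Fintype.card_fin] at h1
  omega

/-- Union bound over the possible families of branch vertices. -/
theorem liftProb_le_of_topClique {n ℓ m : ℕ} (hℓ : 0 < ℓ) (p : SimpleGraph (Fin n × Fin ℓ) → Prop)
    (hp : ∀ G, p G → HasTopClique G m) (c t : ℝ) (hc : 0 ≤ c)
    (ht : (m : ℝ) ^ 2 / (2 * ℓ) + t ≤ (m : ℝ) ^ 2 / 2 - n * ℓ - m / 2) :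
    liftProb n ℓ p ≤ ((n * ℓ : ℕ) : ℝ) ^ m * Real.exp (c ^ 2 * (m : ℝ) ^ 2 / 2 - c * t) := by
  classical
  have hT : (0 : ℝ) < Fintype.card (Fin n → Fin n → Equiv.Perm (Fin ℓ)) := by
    exact_mod_cast Fintype.card_pos
  rw [liftProb, div_le_iff₀ hT]
  set bad : (Fin m → Fin n × Fin ℓ) → Finset (Fin n → Fin n → Equiv.Perm (Fin ℓ)) := fun f =>
    if Function.Injective f then
      univ.filter fun σ => (#(univ.image f) : ℝ) ^ 2 / (2 * ℓ) + t ≤ spannedEdges (univ.image f) σ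
    else ∅ with hbad
  have hcard : ∀ f, (#(bad f) : ℝ) ≤ Fintype.card (Fin n → Fin n → Equiv.Perm (Fin ℓ)) *
        Real.exp (c ^ 2 * (m : ℝ) ^ 2 / 2 - c * t) := by
    intro f
    by_cases hf : Function.Injective f
    · have := card_spannedEdges_ge_le hℓ (univ.image f) c t hc
      rw [card_image_of_injective _ hf, card_univ, Fintype.card_fin] at this
      simpa [hbad, hf, card_image_of_injective _ hf] using this
    · simp only [hbad, hf, if_false, card_empty, Nat.cast_zero]
      positivity
  calc _ ≤ ((#(univ.biUnion bad) : ℕ) : ℝ) := by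
        gcongr
        intro σ hσ
        obtain ⟨f, hf⟩ := hp _ (mem_filter.mp hσ).2
        refine mem_biUnion.mpr ⟨f, mem_univ _, ?_⟩
        simp only [hbad, hf.1, if_true, mem_filter, mem_univ, true_and,
          card_image_of_injective _ hf.1, card_univ, Fintype.card_fin]
        have : (m : ℝ) * m ≤ 2 * spannedEdges (univ.image f) σ + 2 * (n * ℓ) + m := by
          exact_mod_cast hf.sq_le
        linarith
    _ ≤ ∑ f, (#(bad f) : ℝ) := by exact_mod_cast card_biUnion_le
    _ ≤ ∑ _f : Fin m → Fin n × Fin ℓ, _ := sum_le_sum fun f _ => hcard f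
    _ = _ := by
        simp
        ring

theorem exists_sq_pow_mul_exp_le (κ δ : ℝ) (hκ : 0 < κ) (hδ : 0 < δ) :
    ∃ M : ℕ, ∀ m : ℕ, M ≤ m → ((m : ℝ) ^ 2) ^ m * Real.exp (-(κ * (m : ℝ) ^ 2)) ≤ δ := by
  have h1 : Filter.Tendsto (fun m : ℕ => (m : ℝ) ^ 2 * Real.exp (-κ * m)) Filter.atTop (nhds 0) := by
    simpa [Function.comp_def] using
      (tendsto_rpow_mul_exp_neg_mul_atTop_nhds_zero 2 κ hκ).comp tendsto_natCast_atTop_atTop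
  obtain ⟨M, hM⟩ := Filter.eventually_atTop.mp
    (h1.eventually_le_const (lt_min hδ one_pos))
  refine ⟨max M 1, fun m hm => ?_⟩
  have h2 := hM m (le_of_max_le_left hm)
  have hm1 : 1 ≤ m := le_of_max_le_right hm
  have h3 : ((m : ℝ) ^ 2) ^ m * Real.exp (-(κ * (m : ℝ) ^ 2)) =
      ((m : ℝ) ^ 2 * Real.exp (-κ * m)) ^ m := by
    rw [mul_pow, ← Real.exp_nat_mul]
    ring_nf
  rw [h3]
  calc _ ≤ (m : ℝ) ^ 2 * Real.exp (-κ * m) :=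
        pow_le_of_le_one (by positivity) (h2.trans (min_le_right _ _)) (by omega)
    _ ≤ δ := h2.trans (min_le_left _ _)

/-- For every `ε, δ > 0` there exists `N` such that for all `n ≥ N` and every integer
`ℓ ≥ 2`, the probability that a uniformly random `ℓ`-lift of `K_n` contains a topological
clique of order at least `(1+ε)√(2nℓ/(1-1/ℓ))` is at most `δ`. -/
theorem stmt6 (ε δ : ℝ) (hε : 0 < ε) (hδ : 0 < δ) :
    ∃ N : ℕ, ∀ n : ℕ, N ≤ n → ∀ ℓ : ℕ, 2 ≤ ℓ →
      liftProb n ℓ (fun G => ∃ m : ℕ,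
        (1 + ε) * Real.sqrt (2 * n * ℓ / (1 - 1 / (ℓ : ℝ))) ≤ (m : ℝ) ∧
        HasTopClique G m) ≤ δ := by
  obtain ⟨b, hb0, hb⟩ : ∃ b : ℝ, 0 < b ∧ b * (1 + ε) ^ 2 = (1 + ε) ^ 2 - 1 :=
    ⟨((1 + ε) ^ 2 - 1) / (1 + ε) ^ 2, div_pos (by nlinarith) (by positivity), by field_simp⟩
  obtain ⟨M, hM⟩ := exists_sq_pow_mul_exp_le (b ^ 2 / 128) δ (by positivity) hδ
  obtain ⟨K, hK⟩ := exists_nat_ge (4 / b)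
  refine ⟨(max M K) ^ 2, fun n hn ℓ hℓ => ?_⟩
  set m := ⌈(1 + ε) * Real.sqrt (2 * n * ℓ / (1 - 1 / (ℓ : ℝ)))⌉₊ with hm
  have hℓ2 : (2 : ℝ) ≤ ℓ := by exact_mod_cast hℓ
  have hinv : 1 / (ℓ : ℝ) ≤ 1 / 2 := one_div_le_one_div_of_le two_pos hℓ2
  have hinv0 : 0 < 1 / (ℓ : ℝ) := by positivity
  set q := 1 - 1 / (ℓ : ℝ) with hq
  have hq0 : 0 < q := by linarith
  have hnn : (0 : ℝ) ≤ n := Nat.cast_nonneg n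
  have hm1 : (1 + ε) ^ 2 * (2 * n * ℓ) ≤ (m : ℝ) ^ 2 * q := by
    have h1 : (1 + ε) * Real.sqrt (2 * n * ℓ / q) ≤ m := Nat.le_ceil _
    have h2 : ((1 + ε) * Real.sqrt (2 * n * ℓ / q)) ^ 2 ≤ (m : ℝ) ^ 2 := by gcongr
    rw [mul_pow, Real.sq_sqrt (by positivity), ← mul_div_assoc, div_le_iff₀ hq0] at h2
    exact h2
  have hm2 : ((n * ℓ : ℕ) : ℝ) ≤ (m : ℝ) ^ 2 := by
    push_cast
    have : 0 ≤ (n : ℝ) * ℓ := by positivity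
    have h1 : (m : ℝ) ^ 2 * q ≤ (m : ℝ) ^ 2 :=
      mul_le_of_le_one_right (sq_nonneg _) (by linarith)
    have h2 : 1 * (2 * n * ℓ : ℝ) ≤ (1 + ε) ^ 2 * (2 * n * ℓ) :=
      mul_le_mul_of_nonneg_right (by nlinarith) (by positivity)
    linarith
  have hm3 : max M K ≤ m := by
    have h1 : n * ℓ ≤ m ^ 2 := by exact_mod_cast hm2
    have h2 : n ≤ n * ℓ := Nat.le_mul_of_pos_right n (by omega)
    exact (Nat.pow_le_pow_iff_left two_ne_zero).mp (hn.trans (h2.trans h1))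
  have hbm : 4 ≤ b * m := by
    have : (K : ℝ) ≤ m := by exact_mod_cast le_of_max_le_right hm3
    have := hK.trans this
    rw [div_le_iff₀ hb0] at this
    linarith
  have hgap : b * ((m : ℝ) ^ 2 * q) ≤ (m : ℝ) ^ 2 * q - 2 * n * ℓ := by
    have hpos : 0 < (1 + ε) ^ 2 := by positivity
    refine le_of_mul_le_mul_left ?_ hpos
    calc (1 + ε) ^ 2 * (b * ((m : ℝ) ^ 2 * q)) = (b * (1 + ε) ^ 2) * ((m : ℝ) ^ 2 * q) := by ring
      _ = (1 + ε) ^ 2 * ((m : ℝ) ^ 2 * q) - (m : ℝ) ^ 2 * q := by rw [hb]; ring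
      _ ≤ _ := by linarith
  have hbound := liftProb_le_of_topClique (n := n) (ℓ := ℓ) (m := m) (by omega)
    (fun G => ∃ m : ℕ, (1 + ε) * Real.sqrt (2 * n * ℓ / q) ≤ (m : ℝ) ∧ HasTopClique G m)
    (fun G ⟨k, hk, hG⟩ => hG.mono (Nat.ceil_le.mpr hk)) (b / 8) (b * (m : ℝ) ^ 2 / 8)
    (by positivity) (by
      have h1 : (m : ℝ) ^ 2 / (2 * ℓ) = (m : ℝ) ^ 2 / 2 - (m : ℝ) ^ 2 * q / 2 := by
        rw [hq]; field_simp; ring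
      have h2 : b * (m : ℝ) ^ 2 / 2 ≤ b * ((m : ℝ) ^ 2 * q) := by
        have : 0 ≤ b * (m : ℝ) ^ 2 := by positivity
        nlinarith
      have h3 : 4 * (m : ℝ) ≤ b * (m : ℝ) ^ 2 := by
        have := mul_le_mul_of_nonneg_right hbm (Nat.cast_nonneg (α := ℝ) m)
        nlinarith
      rw [h1]
      linarith)
  refine hbound.trans (le_trans ?_ (hM m (le_of_max_le_left hm3)))
  have hexp : (b / 8) ^ 2 * (m : ℝ) ^ 2 / 2 - b / 8 * (b * (m : ℝ) ^ 2 / 8) =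
      -(b ^ 2 / 128 * (m : ℝ) ^ 2) := by ring
  rw [hexp]
  gcongr
end

section
/- For every δ > 0 there exists N such that for all n ≥ N and every integer ℓ ≥ 1, a uniformly random ℓ-lift of K_n is 5ℓ·log n-joined with probability at least 1 − δ. Here log denotes the natural logarithm. -/
/-- A graph is `m`-joined if any two disjoint vertex sets of size at least `m` are
connected by an edge. -/
def IsJoined {V : Type*} (G : SimpleGraph V) (m : ℝ) : Prop :=
  ∀ A B : Set V, Disjoint A B → m ≤ (A.ncard : ℝ) → m ≤ (B.ncard : ℝ) →
    ∃ a ∈ A, ∃ b ∈ B, G.Adj a b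

open Finset in
/-- Swapping two points outside `S` shows that, among the permutations mapping `S` off `T`, every
further point is mapped into `T` with proportion at least `#T / #α`. -/
lemma card_mul_card_perm_avoid_le {α : Type*} [Fintype α] [DecidableEq α] (S T : Finset α) {s : α}
    (hs : s ∉ S) :
    #T * #{σ : Equiv.Perm α | ∀ x ∈ S, σ x ∉ T} ≤
      Fintype.card α * #{σ : Equiv.Perm α | (∀ x ∈ S, σ x ∉ T) ∧ σ s ∈ T} := by
  have key (x : α) : #{σ : Equiv.Perm α | (∀ y ∈ S, σ y ∉ T) ∧ σ x ∈ T} ≤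
      #{σ : Equiv.Perm α | (∀ y ∈ S, σ y ∉ T) ∧ σ s ∈ T} := by
    by_cases hx : x ∈ S
    · rw [card_eq_zero.2]
      · exact Nat.zero_le _
      · refine filter_eq_empty_iff.2 fun σ _ h => h.1 x hx h.2
    · refine card_le_card_of_injOn (fun σ => σ * Equiv.swap x s) (fun σ hσ => ?_)
        (fun σ _ τ _ h => mul_right_cancel h)
      simp only [coe_filter, mem_univ, true_and, Set.mem_ofPred_eq] at hσ ⊢
      refine ⟨fun y hy => ?_, by simpa using hσ.2⟩
      rw [Equiv.Perm.mul_apply, Equiv.swap_apply_of_ne_of_ne]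
      · exact hσ.1 y hy
      · rintro rfl; exact hx hy
      · rintro rfl; exact hs hy
  have count : ∑ x : α, #{σ : Equiv.Perm α | (∀ y ∈ S, σ y ∉ T) ∧ σ x ∈ T} =
      #T * #{σ : Equiv.Perm α | ∀ x ∈ S, σ x ∉ T} := by
    have h := sum_card_bipartiteAbove_eq_sum_card_bipartiteBelow
      (s := (univ : Finset α)) (t := {σ : Equiv.Perm α | ∀ x ∈ S, σ x ∉ T})
      (fun x σ => σ x ∈ T)
    simp only [bipartiteAbove, bipartiteBelow, filter_filter] at h
    rw [h, mul_comm, ← smul_eq_mul, ← sum_const]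
    refine sum_congr rfl fun σ _ => ?_
    exact card_equiv σ (by simp)
  rw [← count, ← smul_eq_mul, ← card_univ, ← sum_const]
  exact sum_le_sum fun x _ => key x

open Finset in
lemma card_perm_avoid_le_pow {α : Type*} [Fintype α] [DecidableEq α] [Nonempty α]
    (S T : Finset α) :
    (#{σ : Equiv.Perm α | ∀ x ∈ S, σ x ∉ T} : ℝ) ≤
      (Fintype.card (Equiv.Perm α) : ℝ) * (1 - (#T : ℝ) / Fintype.card α) ^ #S := by
  have hα : (0 : ℝ) < Fintype.card α := by exact_mod_cast Fintype.card_pos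
  have hT : (0 : ℝ) ≤ 1 - (#T : ℝ) / Fintype.card α := by
    rw [sub_nonneg, div_le_one hα]
    exact_mod_cast card_le_univ T
  induction S using Finset.induction_on with
  | empty => simp
  | insert s S hs ih =>
    have hle := card_mul_card_perm_avoid_le S T hs
    have hsplit := card_filter_add_card_filter_not (s := {σ : Equiv.Perm α | ∀ x ∈ S, σ x ∉ T})
      (fun σ => σ s ∈ T)
    have hins : #{σ : Equiv.Perm α | ∀ x ∈ insert s S, σ x ∉ T} =
        #{σ : Equiv.Perm α | (∀ x ∈ S, σ x ∉ T) ∧ σ s ∉ T} := by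
      congr 1
      ext σ
      simp [and_comm]
    simp only [filter_filter] at hsplit
    rw [← hins] at hsplit
    rw [card_insert_of_notMem hs, pow_succ, ← mul_assoc]
    refine le_trans ?_ (mul_le_mul_of_nonneg_right ih hT)
    have hle' : (#T : ℝ) / Fintype.card α * #{σ : Equiv.Perm α | ∀ x ∈ S, σ x ∉ T} ≤
        #{σ : Equiv.Perm α | (∀ x ∈ S, σ x ∉ T) ∧ σ s ∈ T} := by
      rw [div_mul_eq_mul_div, div_le_iff₀ hα, mul_comm _ (Fintype.card α : ℝ)]
      exact_mod_cast hle
    have hsplit' : (#{σ : Equiv.Perm α | (∀ x ∈ S, σ x ∉ T) ∧ σ s ∈ T} : ℝ) +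
        #{σ : Equiv.Perm α | ∀ x ∈ insert s S, σ x ∉ T} =
        #{σ : Equiv.Perm α | ∀ x ∈ S, σ x ∉ T} := by exact_mod_cast hsplit
    linarith

open Finset in
/-- A uniformly random permutation maps `S` off `T` with probability at most
`exp (-#S #T / #α)`. -/
lemma card_perm_avoid_le_exp {α : Type*} [Fintype α] [DecidableEq α] [Nonempty α]
    (S T : Finset α) :
    (#{σ : Equiv.Perm α | ∀ x ∈ S, σ x ∉ T} : ℝ) ≤
      (Fintype.card (Equiv.Perm α) : ℝ) *
        Real.exp (-((#S : ℝ) * #T / Fintype.card α)) := by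
  have hα : (0 : ℝ) < Fintype.card α := by exact_mod_cast Fintype.card_pos
  refine (card_perm_avoid_le_pow S T).trans (mul_le_mul_of_nonneg_left ?_ (Nat.cast_nonneg _))
  have hT : (0 : ℝ) ≤ 1 - (#T : ℝ) / Fintype.card α := by
    rw [sub_nonneg, div_le_one hα]
    exact_mod_cast card_le_univ T
  calc (1 - (#T : ℝ) / Fintype.card α) ^ #S
      ≤ Real.exp (-((#T : ℝ) / Fintype.card α)) ^ #S :=
        pow_le_pow_left₀ hT (Real.one_sub_le_exp_neg _) _
    _ = _ := by
        rw [← Real.exp_nat_mul]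
        congr 1
        ring

/-- The points of `A` in the fiber of `i`. -/
def fiberPart {n ℓ : ℕ} (A : Finset (Fin n × Fin ℓ)) (i : Fin n) : Finset (Fin ℓ) :=
  Finset.univ.filter fun x => (i, x) ∈ A

open Finset in
lemma sum_card_fiberPart {n ℓ : ℕ} (A : Finset (Fin n × Fin ℓ)) :
    ∑ i, #(fiberPart A i) = #A := by
  rw [card_eq_sum_card_fiberwise (f := Prod.fst) (t := univ) (by simp)]
  refine sum_congr rfl fun i _ => ?_
  refine card_bij (fun x _ => (i, x)) ?_ ?_ ?_
  · simp [fiberPart]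
  · simp
  · rintro ⟨j, x⟩ h
    simp only [mem_filter] at h
    obtain ⟨h, rfl⟩ := h
    exact ⟨x, by simpa [fiberPart] using h, rfl⟩

lemma sum_ite_lt_add_swap {n : ℕ} (f : Fin n → Fin n → ℝ) :
    ∑ i, ∑ j, (if i < j then f i j + f j i else 0) = ∑ i, ∑ j, f i j - ∑ i, f i i := by
  have h₁ : ∑ i, ∑ j, (if i < j then f i j + f j i else 0) =
      ∑ i, ∑ j, (if i < j then f i j else 0) + ∑ i, ∑ j, (if j < i then f i j else 0) := by
    rw [Finset.sum_comm (f := fun i j => if j < i then f i j else 0)]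
    simp only [← Finset.sum_add_distrib]
    refine Finset.sum_congr rfl fun i _ => Finset.sum_congr rfl fun j _ => ?_
    split_ifs <;> simp
  have h₂ : ∑ i, f i i = ∑ i, ∑ j, (if i = j then f i j else 0) := by simp
  rw [h₁, h₂, eq_sub_iff_add_eq]
  simp only [← Finset.sum_add_distrib]
  refine Finset.sum_congr rfl fun i _ => Finset.sum_congr rfl fun j _ => ?_
  rcases lt_trichotomy i j with h | h | h
  · simp [h, h.not_gt, h.ne]
  · simp [h]
  · simp [h, h.not_gt, h.ne']

open Finset in
open Classical in
/-- The number of lifts having no edge between two given `k`-sets. -/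
lemma card_no_edge_le {n ℓ k : ℕ} (hℓ : 1 ≤ ℓ) (A B : Finset (Fin n × Fin ℓ))
    (hA : #A = k) (hB : #B = k) :
    (#{σ : Fin n → Fin n → Equiv.Perm (Fin ℓ) |
        ∀ a ∈ A, ∀ b ∈ B, ¬ (liftGraph n ℓ σ).Adj a b} : ℝ) ≤
      (Fintype.card (Fin n → Fin n → Equiv.Perm (Fin ℓ)) : ℝ) *
        Real.exp (-((k : ℝ) * (k - ℓ) / (2 * ℓ))) := by
  have : Nonempty (Fin ℓ) := ⟨⟨0, hℓ⟩⟩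
  have hℓ' : (0 : ℝ) < ℓ := by exact_mod_cast hℓ
  let S (i j : Fin n) : Finset (Equiv.Perm (Fin ℓ)) :=
    {τ | i < j → (∀ x ∈ fiberPart A i, τ x ∉ fiberPart B j) ∧
      ∀ x ∈ fiberPart B i, τ x ∉ fiberPart A j}
  let f (i j : Fin n) : ℝ := (#(fiberPart A i) : ℝ) * #(fiberPart B j)
  have hS (i j : Fin n) : (#(S i j) : ℝ) ≤ (Fintype.card (Equiv.Perm (Fin ℓ)) : ℝ) *
      Real.exp (-((if i < j then f i j + f j i else 0) / (2 * ℓ))) := by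
    split_ifs with hij
    · have h₁ : (#(S i j) : ℝ) ≤
          (Fintype.card (Equiv.Perm (Fin ℓ)) : ℝ) * Real.exp (-(f i j / ℓ)) := by
        have h := card_perm_avoid_le_exp (fiberPart A i) (fiberPart B j)
        rw [Fintype.card_fin] at h
        refine le_trans ?_ h
        refine Nat.cast_le.2 (card_le_card fun τ hτ => ?_)
        simp only [S, mem_filter, mem_univ, true_and] at hτ ⊢
        exact (hτ hij).1
      have h₂ : (#(S i j) : ℝ) ≤
          (Fintype.card (Equiv.Perm (Fin ℓ)) : ℝ) * Real.exp (-(f j i / ℓ)) := by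
        have h := card_perm_avoid_le_exp (fiberPart B i) (fiberPart A j)
        rw [Fintype.card_fin, mul_comm (#(fiberPart B i) : ℝ)] at h
        refine le_trans ?_ h
        refine Nat.cast_le.2 (card_le_card fun τ hτ => ?_)
        simp only [S, mem_filter, mem_univ, true_and] at hτ ⊢
        exact (hτ hij).2
      have h₃ : (f i j + f j i) / (2 * ℓ) = (f i j / ℓ + f j i / ℓ) / 2 := by
        field_simp
      rw [h₃]
      rcases le_total (f i j / ℓ) (f j i / ℓ) with h | h
      · refine h₂.trans ?_
        refine mul_le_mul_of_nonneg_left (Real.exp_le_exp.2 ?_) (Nat.cast_nonneg _)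
        linarith
      · refine h₁.trans ?_
        refine mul_le_mul_of_nonneg_left (Real.exp_le_exp.2 ?_) (Nat.cast_nonneg _)
        linarith
    · simpa using card_le_univ (S i j)
  have hsub : ({σ : Fin n → Fin n → Equiv.Perm (Fin ℓ) |
        ∀ a ∈ A, ∀ b ∈ B, ¬ (liftGraph n ℓ σ).Adj a b} : Finset _) ⊆
      Fintype.piFinset fun i => Fintype.piFinset (S i) := by
    intro σ hσ
    simp only [mem_filter, mem_univ, true_and] at hσ
    simp only [Fintype.mem_piFinset, S, mem_filter, mem_univ, true_and]
    refine fun i j hij => ⟨fun x hx hy => ?_, fun x hx hy => ?_⟩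
    · simp only [fiberPart, mem_filter, mem_univ, true_and] at hx hy
      refine hσ _ hx _ hy ?_
      simp [liftGraph, hij, hij.ne]
    · simp only [fiberPart, mem_filter, mem_univ, true_and] at hx hy
      refine hσ _ hy _ hx ?_
      simp [liftGraph, hij, hij.ne']
  have hsum : (k : ℝ) * (k - ℓ) ≤ ∑ i, ∑ j, (if i < j then f i j + f j i else 0) := by
    have hA' : ∑ i, (#(fiberPart A i) : ℝ) = k := by
      exact_mod_cast (sum_card_fiberPart A).trans hA
    have hB' : ∑ i, (#(fiberPart B i) : ℝ) = k := by
      exact_mod_cast (sum_card_fiberPart B).trans hB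
    have hdiag : ∑ i, f i i ≤ k * ℓ := by
      rw [← hA', sum_mul]
      refine sum_le_sum fun i _ => mul_le_mul_of_nonneg_left ?_ (Nat.cast_nonneg _)
      simpa using card_le_univ (fiberPart B i)
    rw [sum_ite_lt_add_swap, ← sum_mul_sum, hA', hB']
    linarith
  calc _ ≤ (#(Fintype.piFinset fun i => Fintype.piFinset (S i)) : ℝ) :=
        Nat.cast_le.2 (card_le_card hsub)
    _ = ∏ i, ∏ j, (#(S i j) : ℝ) := by simp [Fintype.card_piFinset]
    _ ≤ ∏ i, ∏ j, ((Fintype.card (Equiv.Perm (Fin ℓ)) : ℝ) *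
          Real.exp (-((if i < j then f i j + f j i else 0) / (2 * ℓ)))) :=
        prod_le_prod (fun i _ => prod_nonneg fun j _ => Nat.cast_nonneg _) fun i _ =>
          prod_le_prod (fun j _ => Nat.cast_nonneg _) fun j _ => hS i j
    _ = (Fintype.card (Fin n → Fin n → Equiv.Perm (Fin ℓ)) : ℝ) *
          Real.exp (-((∑ i, ∑ j, (if i < j then f i j + f j i else 0)) / (2 * ℓ))) := by
        simp only [prod_mul_distrib, ← Real.exp_sum, sum_neg_distrib, ← sum_div]
        simp
    _ ≤ _ := by gcongr

lemma choose_le_exp_mul_log {n ℓ k : ℕ} (hn : 1 ≤ n) (hℓ : 1 ≤ ℓ) (hk : Real.exp 1 * ℓ ≤ k) :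
    ((n * ℓ).choose k : ℝ) ≤ Real.exp (k * Real.log n) := by
  have hn' : (0 : ℝ) < n := by exact_mod_cast hn
  have hℓ' : (0 : ℝ) < ℓ := by exact_mod_cast hℓ
  have hk' : (0 : ℝ) < k := (by positivity : (0 : ℝ) < Real.exp 1 * ℓ).trans_le hk
  have hexp := Real.pow_div_factorial_le_exp (k : ℝ) hk'.le k
  rw [Real.exp_nat_mul, Real.exp_log hn']
  have hfact : (0 : ℝ) < k.factorial := by exact_mod_cast k.factorial_pos
  calc ((n * ℓ).choose k : ℝ) ≤ ((n * ℓ : ℕ) : ℝ) ^ k / k.factorial := Nat.choose_le_pow_div _ _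
    _ = (n : ℝ) ^ k * ((ℓ : ℝ) ^ k / k.factorial) := by push_cast; rw [mul_pow, mul_div_assoc]
    _ ≤ (n : ℝ) ^ k * 1 := by
        refine mul_le_mul_of_nonneg_left ?_ (by positivity)
        rw [div_le_one hfact]
        have h₁ : (Real.exp 1 * ℓ) ^ k ≤ Real.exp 1 ^ k * k.factorial := by
          refine (pow_le_pow_left₀ (by positivity) hk k).trans ?_
          rwa [← Real.exp_nat_mul, mul_one, ← div_le_iff₀ hfact]
        rw [mul_pow] at h₁
        exact le_of_mul_le_mul_left h₁ (by positivity)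
    _ = _ := mul_one _

open Finset in
lemma exists_finset_of_not_isJoined {V : Type*} [Fintype V] {G : SimpleGraph V} {m : ℝ}
    (h : ¬ IsJoined G m) :
    ∃ A B : Finset V, #A = ⌈m⌉₊ ∧ #B = ⌈m⌉₊ ∧ ∀ a ∈ A, ∀ b ∈ B, ¬ G.Adj a b := by
  classical
  simp only [IsJoined] at h
  push Not at h
  obtain ⟨A, B, -, hA, hB, hAB⟩ := h
  rw [Set.ncard_eq_toFinset_card', ← Nat.ceil_le] at hA hB
  obtain ⟨A', hA', hcA⟩ := exists_subset_card_eq hA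
  obtain ⟨B', hB', hcB⟩ := exists_subset_card_eq hB
  exact ⟨A', B', hcA, hcB, fun a ha b hb =>
    hAB a (Set.mem_toFinset.1 (hA' ha)) b (Set.mem_toFinset.1 (hB' hb))⟩

open Finset in
open Classical in
/-- Union bound over all pairs of `⌈m⌉₊`-sets. -/
lemma card_not_isJoined_le {n ℓ : ℕ} (hℓ : 1 ≤ ℓ) (m : ℝ) :
    (#{σ : Fin n → Fin n → Equiv.Perm (Fin ℓ) | ¬ IsJoined (liftGraph n ℓ σ) m} : ℝ) ≤
      ((n * ℓ).choose ⌈m⌉₊ : ℝ) ^ 2 *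
        ((Fintype.card (Fin n → Fin n → Equiv.Perm (Fin ℓ)) : ℝ) *
          Real.exp (-((⌈m⌉₊ : ℝ) * (⌈m⌉₊ - ℓ) / (2 * ℓ)))) := by
  let P : Finset (Finset (Fin n × Fin ℓ)) := powersetCard ⌈m⌉₊ univ
  have hP : #P = (n * ℓ).choose ⌈m⌉₊ := by simp [P]
  have hsub : ({σ : Fin n → Fin n → Equiv.Perm (Fin ℓ) |
        ¬ IsJoined (liftGraph n ℓ σ) m} : Finset _) ⊆
      (P ×ˢ P).biUnion fun AB => {σ | ∀ a ∈ AB.1, ∀ b ∈ AB.2, ¬ (liftGraph n ℓ σ).Adj a b} := by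
    intro σ hσ
    obtain ⟨A, B, hA, hB, hAB⟩ := exists_finset_of_not_isJoined (mem_filter.1 hσ).2
    simp only [mem_biUnion, mem_filter, mem_univ, true_and, mem_product]
    exact ⟨(A, B), ⟨by simp [P, mem_powersetCard, hA], by simp [P, mem_powersetCard, hB]⟩, hAB⟩
  refine (Nat.cast_le.2 ((card_le_card hsub).trans card_biUnion_le)).trans ?_
  rw [Nat.cast_sum]
  refine (sum_le_card_nsmul _ _ ((Fintype.card (Fin n → Fin n → Equiv.Perm (Fin ℓ)) : ℝ) *
    Real.exp (-((⌈m⌉₊ : ℝ) * (⌈m⌉₊ - ℓ) / (2 * ℓ)))) fun AB hAB => ?_).trans ?_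
  · simp only [P, mem_product, mem_powersetCard] at hAB
    exact card_no_edge_le hℓ _ _ hAB.1.2 hAB.2.2
  · rw [nsmul_eq_mul, card_product, hP, Nat.cast_mul, sq]

open Classical in
lemma liftProb_eq_one_sub (n ℓ : ℕ) (p : SimpleGraph (Fin n × Fin ℓ) → Prop) :
    liftProb n ℓ p = 1 - (Finset.card {σ : Fin n → Fin n → Equiv.Perm (Fin ℓ) |
      ¬ p (liftGraph n ℓ σ)} : ℝ) / Fintype.card (Fin n → Fin n → Equiv.Perm (Fin ℓ)) := by
  have hpos : (0 : ℝ) < Fintype.card (Fin n → Fin n → Equiv.Perm (Fin ℓ)) := by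
    exact_mod_cast Fintype.card_pos
  have h := Finset.card_filter_add_card_filter_not
    (s := (Finset.univ : Finset (Fin n → Fin n → Equiv.Perm (Fin ℓ))))
    (fun σ => p (liftGraph n ℓ σ))
  rw [Finset.card_univ] at h
  rw [liftProb, eq_sub_iff_add_eq, ← add_div, div_eq_one_iff_eq hpos.ne', ← h]
  push_cast
  congr!

/-- For every `δ > 0` there exists `N` such that for all `n ≥ N` and every integer
`ℓ ≥ 1`, a uniformly random `ℓ`-lift of `K_n` is `5ℓ log n`-joined with probability at
least `1 - δ`. -/
theorem stmt9 (δ : ℝ) (hδ : 0 < δ) :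
    ∃ N : ℕ, ∀ n : ℕ, N ≤ n → ∀ ℓ : ℕ, 1 ≤ ℓ →
      1 - δ ≤ liftProb n ℓ (fun G => IsJoined G (5 * ℓ * Real.log n)) := by
  classical
  obtain ⟨N, hN⟩ := exists_nat_ge (max (1 / δ) (Real.exp 2))
  refine ⟨N, fun n hn ℓ hℓ => ?_⟩
  have hNn : max (1 / δ) (Real.exp 2) ≤ n := hN.trans (by exact_mod_cast hn)
  have hδn : 1 / δ ≤ n := (le_max_left _ _).trans hNn
  have hexpn : Real.exp 2 ≤ n := (le_max_right _ _).trans hNn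
  have hn0 : (0 : ℝ) < n := (Real.exp_pos 2).trans_le hexpn
  have hL : 2 ≤ Real.log n := (Real.le_log_iff_exp_le hn0).2 hexpn
  have hℓ' : (1 : ℝ) ≤ ℓ := by exact_mod_cast hℓ
  set L := Real.log n with hLdef
  have hbad := card_not_isJoined_le (n := n) hℓ (5 * ℓ * L)
  have hk : 5 * ℓ * L ≤ (⌈5 * ℓ * L⌉₊ : ℝ) := Nat.le_ceil _
  set k := ⌈5 * ℓ * L⌉₊
  have hkL : 5 * L ≤ k := by nlinarith
  have hchoose := choose_le_exp_mul_log (n := n) (k := k) (by exact_mod_cast hn0) hℓ (by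
    nlinarith [Real.exp_one_lt_three])
  have hpos : (0 : ℝ) < Fintype.card (Fin n → Fin n → Equiv.Perm (Fin ℓ)) := by
    exact_mod_cast Fintype.card_pos
  rw [liftProb_eq_one_sub]
  refine sub_le_sub_left ((div_le_iff₀ hpos).2 (hbad.trans ?_)) 1
  rw [mul_left_comm, mul_comm δ]
  refine mul_le_mul_of_nonneg_left ?_ hpos.le
  have hexponent : (k : ℝ) * (5 * L - 1) / 2 ≤ (k : ℝ) * (k - ℓ) / (2 * ℓ) := by
    rw [div_le_div_iff₀ (by norm_num) (by linarith)]
    have : (k : ℝ) * (5 * ℓ * L) ≤ k * k := mul_le_mul_of_nonneg_left hk (Nat.cast_nonneg _)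
    nlinarith
  calc ((n * ℓ).choose k : ℝ) ^ 2 * Real.exp (-((k : ℝ) * (k - ℓ) / (2 * ℓ)))
      ≤ Real.exp (k * L) ^ 2 * Real.exp (-((k : ℝ) * (5 * L - 1) / 2)) := by gcongr
    _ = Real.exp (-(k * (L - 1) / 2)) := by
        rw [← Real.exp_nat_mul, ← Real.exp_add]
        congr 1
        push_cast
        ring
    _ ≤ Real.exp (-L) := Real.exp_le_exp.2 (by nlinarith)
    _ ≤ δ := by
        rw [Real.exp_neg, hLdef, Real.exp_log hn0]
        exact inv_le_of_inv_le₀ hδ (by simpa using hδn)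
end

section
/- Let γ > 0. For every δ > 0 there exists N such that for all n ≥ N, all integers ℓ with n ≤ ℓ ≤ (γ³/48)·n², and every collection V₁,…,Vₙ of pairwise disjoint transversals of the ℓ-lift of K_{n−1}, the following holds with probability at least 1 − δ for a uniformly random ℓ-lift G of K_{n−1}: G contains a matching M such that for all but at most γn² pairs 1 ≤ i < j ≤ n, M contains an edge with one endpoint in Vᵢ and the other in V_j. -/
/-- A transversal of a lift: a vertex set containing exactly one vertex from each fiber. -/
def IsTransversal {n ℓ : ℕ} (T : Set (Fin n × Fin ℓ)) : Prop :=
  ∀ i : Fin n, ∃! v, v ∈ T ∧ v.1 = i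

open Finset in
/-- Expansion along row `0` of the number of permutations avoiding `F`. -/
theorem card_perm_avoiding_succ (n : ℕ) (F : Finset (Fin (n + 1) × Fin (n + 1))) :
    #{σ : Equiv.Perm (Fin (n + 1)) | ∀ x, (x, σ x) ∉ F} =
      ∑ p with (0, p) ∉ F, #{e : Equiv.Perm (Fin n) |
        ∀ x, (x, e x) ∉ ({q | (q.1.succ, Equiv.swap 0 p q.2.succ) ∈ F} : Finset (Fin n × Fin n))} := by
  rw [← card_sigma]
  refine card_bij' (fun σ _ => ⟨(Equiv.Perm.decomposeFin σ).1, (Equiv.Perm.decomposeFin σ).2⟩)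
    (fun x _ => Equiv.Perm.decomposeFin.symm (x.1, x.2)) ?_ ?_ ?_ ?_
  · intro σ hσ
    obtain ⟨⟨p, e⟩, rfl⟩ := Equiv.Perm.decomposeFin.symm.surjective σ
    simp only [mem_filter, mem_univ, true_and, Fin.forall_fin_succ,
      Equiv.Perm.decomposeFin_symm_apply_zero, Equiv.Perm.decomposeFin_symm_apply_succ] at hσ
    simpa using hσ
  · rintro ⟨p, e⟩ h
    simp only [mem_filter, mem_univ, true_and, Fin.forall_fin_succ,
      Equiv.Perm.decomposeFin_symm_apply_zero, Equiv.Perm.decomposeFin_symm_apply_succ]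
    simpa using h
  · intro σ hσ
    simp
  · rintro ⟨p, e⟩ h
    simp

open Finset in
/-- Deleting row `0` and column `p` from `F` removes at most the elements lying there. -/
theorem card_le_card_minor_add (n : ℕ) (F : Finset (Fin (n + 1) × Fin (n + 1))) (p : Fin (n + 1)) :
    #F ≤ #({q | (q.1.succ, Equiv.swap 0 p q.2.succ) ∈ F} : Finset (Fin n × Fin n)) +
      #{y | (0, y) ∈ F} + #{x | (x, p) ∈ F} := by
  have hsub : F ⊆ (({q | (q.1.succ, Equiv.swap 0 p q.2.succ) ∈ F} : Finset (Fin n × Fin n)).image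
        (fun q => (q.1.succ, Equiv.swap 0 p q.2.succ)) ∪
      ({y | (0, y) ∈ F} : Finset (Fin (n + 1))).image (fun y => (0, y))) ∪
      ({x | (x, p) ∈ F} : Finset (Fin (n + 1))).image (fun x => (x, p)) := by
    rintro ⟨x, y⟩ h
    simp only [mem_union, mem_image, mem_filter, mem_univ, true_and]
    by_cases hy : y = p
    · subst hy
      exact Or.inr ⟨x, h, rfl⟩
    left
    rcases Fin.eq_zero_or_eq_succ x with rfl | ⟨x, rfl⟩
    · exact Or.inr ⟨y, h, rfl⟩
    left
    have hne : Equiv.swap 0 p y ≠ 0 := by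
      intro h0
      apply hy
      have := congrArg (Equiv.swap 0 p) h0
      simpa using this
    obtain ⟨z, hz⟩ := Fin.exists_succ_eq.mpr hne
    have hz' : Equiv.swap 0 p z.succ = y := by rw [hz]; simp
    exact ⟨(x, z), by simpa [hz'] using h, by simp [hz']⟩
  calc #F ≤ _ := card_le_card hsub
    _ ≤ _ := card_union_le _ _
    _ ≤ _ := by
      gcongr
      · refine (card_union_le _ _).trans ?_
        gcongr <;> exact card_image_le
      · exact card_image_le

open Finset in
theorem sum_card_col {α β : Type*} [Fintype α] [Fintype β] [DecidableEq α] [DecidableEq β]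
    (F : Finset (α × β)) : ∑ p, #{x | (x, p) ∈ F} = #F := by
  rw [card_eq_sum_card_fiberwise (f := Prod.snd) (t := univ) (by simp [Set.MapsTo])]
  refine sum_congr rfl fun p _ => ?_
  refine card_bij (fun x _ => (x, p)) ?_ ?_ ?_
  · simp
  · simp
  · rintro ⟨x, y⟩ h
    simp only [mem_filter] at h
    exact ⟨x, by simpa [← h.2] using h.1, by simp [h.2]⟩

open Finset in
theorem sum_card_row {α β : Type*} [Fintype α] [Fintype β] [DecidableEq α] [DecidableEq β]
    (F : Finset (α × β)) : ∑ x, #{p | (x, p) ∈ F} = #F := by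
  rw [card_eq_sum_card_fiberwise (f := Prod.fst) (t := univ) (by simp [Set.MapsTo])]
  refine sum_congr rfl fun p _ => ?_
  refine card_bij (fun x _ => (p, x)) ?_ ?_ ?_
  · simp
  · simp
  · rintro ⟨x, y⟩ h
    simp only [mem_filter] at h
    exact ⟨y, by simpa [← h.2] using h.1, by simp [h.2]⟩

theorem exp_le_one_add_two_mul {t : ℝ} (h0 : 0 ≤ t) (h1 : t ≤ 1) : Real.exp t ≤ 1 + 2 * t := by
  have h := Real.abs_exp_sub_one_sub_id_le (x := t) (by rwa [abs_of_nonneg h0])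
  have := (abs_le.mp h).2
  nlinarith

open Finset in
/-- The numerical inequality behind the induction step of `card_perm_avoiding_le`. -/
theorem sum_exp_minor_le {n : ℕ} (hn : 1 ≤ n) (F : Finset (Fin (n + 1) × Fin (n + 1)))
    (hmax : #F ≤ (n + 1) * #{y | (0, y) ∈ F}) :
    ∑ p with (0, p) ∉ F, Real.exp (-((#F : ℝ) - #{y | (0, y) ∈ F} - #{x | (x, p) ∈ F}) / (4 * n)) ≤
      (n + 1) * Real.exp (-(#F : ℝ) / (4 * (n + 1))) := by
  set f : ℕ := #{y | (0, y) ∈ F} with hf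
  have hn' : (1 : ℝ) ≤ n := by exact_mod_cast hn
  have hf_le : (f : ℝ) ≤ n + 1 := by
    have : f ≤ n + 1 := by simpa using card_le_univ ({y | (0, y) ∈ F} : Finset (Fin (n + 1)))
    exact_mod_cast this
  have hmax' : (#F : ℝ) / (n + 1) ≤ f := by
    rw [div_le_iff₀ (by positivity), mul_comm]
    exact_mod_cast hmax
  let t : Fin (n + 1) → ℝ := fun p => (f + #{x | (x, p) ∈ F} - (#F : ℝ) / (n + 1)) / (4 * n)
  have ht0 : ∀ p, 0 ≤ t p := fun p => by
    have : (0 : ℝ) ≤ #{x | (x, p) ∈ F} := by positivity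
    exact div_nonneg (by linarith) (by positivity)
  have ht1 : ∀ p, t p ≤ 1 := fun p => by
    have h1 : (#{x | (x, p) ∈ F} : ℝ) ≤ n + 1 := by
      have : #{x | (x, p) ∈ F} ≤ n + 1 := by
        simpa using card_le_univ ({x | (x, p) ∈ F} : Finset (Fin (n + 1)))
      exact_mod_cast this
    have h2 : (0 : ℝ) ≤ (#F : ℝ) / (n + 1) := by positivity
    rw [div_le_one (by positivity)]
    linarith
  have hexp : ∀ p, Real.exp (-((#F : ℝ) - f - #{x | (x, p) ∈ F}) / (4 * n)) =
      Real.exp (-(#F : ℝ) / (4 * (n + 1))) * Real.exp (t p) := fun p => by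
    rw [← Real.exp_add]
    congr 1
    simp only [t]
    field_simp
    ring
  have hcard : (#{p | (0, p) ∉ F} : ℝ) = n + 1 - f := by
    have := card_filter_add_card_filter_not (s := (univ : Finset (Fin (n + 1))))
      (fun p => (0, p) ∈ F)
    rw [card_univ, Fintype.card_fin, ← hf] at this
    have h' : (f : ℝ) + #{p | (0, p) ∉ F} = n + 1 := by exact_mod_cast this
    linarith
  have hsum : ∑ p, t p = (n + 1) * f / (4 * n) := by
    have hcol : ∑ p, (#{x | (x, p) ∈ F} : ℝ) = #F := by exact_mod_cast sum_card_col F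
    simp only [t]
    rw [← sum_div, sum_sub_distrib, sum_add_distrib, hcol]
    simp only [sum_const, card_univ, Fintype.card_fin, nsmul_eq_mul]
    push_cast
    field_simp
    ring
  calc ∑ p with (0, p) ∉ F, Real.exp (-((#F : ℝ) - f - #{x | (x, p) ∈ F}) / (4 * n))
      = Real.exp (-(#F : ℝ) / (4 * (n + 1))) * ∑ p with (0, p) ∉ F, Real.exp (t p) := by
        rw [mul_sum]
        exact sum_congr rfl fun p _ => hexp p
    _ ≤ Real.exp (-(#F : ℝ) / (4 * (n + 1))) * (n + 1) := by
        gcongr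
        calc ∑ p with (0, p) ∉ F, Real.exp (t p) ≤ ∑ p with (0, p) ∉ F, (1 + 2 * t p) :=
              sum_le_sum fun p _ => exp_le_one_add_two_mul (ht0 p) (ht1 p)
          _ = (n + 1 - f) + 2 * ∑ p with (0, p) ∉ F, t p := by
              rw [sum_add_distrib, ← mul_sum, sum_const, nsmul_eq_mul, mul_one, hcard]
          _ ≤ (n + 1 - f) + 2 * ∑ p, t p := by
              gcongr
              · intro p _ _
                exact ht0 p
              · exact filter_subset _ _
          _ ≤ n + 1 := by
              rw [hsum]
              have : 2 * ((n + 1) * f / (4 * n)) ≤ (f : ℝ) := by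
                rw [← mul_div_assoc, div_le_iff₀ (by positivity)]
                have : (0 : ℝ) ≤ f := by positivity
                nlinarith
              linarith
    _ = _ := mul_comm _ _

open Finset in
/-- A uniformly random permutation of `Fin ℓ` avoids a set `F` of cells with probability at most
`exp (-#F / (4ℓ))`. -/
theorem card_perm_avoiding_le (ℓ : ℕ) (F : Finset (Fin ℓ × Fin ℓ)) :
    (#{σ : Equiv.Perm (Fin ℓ) | ∀ x, (x, σ x) ∉ F} : ℝ) ≤
      ℓ.factorial * Real.exp (-(#F : ℝ) / (4 * ℓ)) := by
  induction ℓ with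
  | zero => simp [Subsingleton.elim F ∅]
  | succ n ih =>
    rcases Nat.eq_zero_or_pos n with rfl | hn
    · rcases F.eq_empty_or_nonempty with rfl | ⟨⟨a, b⟩, hab⟩
      · simp
      · have : #{σ : Equiv.Perm (Fin 1) | ∀ x, (x, σ x) ∉ F} = 0 := by
          rw [card_eq_zero, filter_eq_empty_iff]
          intro σ _ h
          exact h a (by rwa [Subsingleton.elim (σ a) b])
        rw [zero_add] at *
        rw [this, Nat.cast_zero]
        positivity
    wlog hmax : #F ≤ (n + 1) * #{y | (0, y) ∈ F} generalizing F
    · obtain ⟨a, -, ha⟩ := exists_max_image univ (fun a => #{y | (a, y) ∈ F}) univ_nonempty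
      have hFle : #F ≤ (n + 1) * #{y | (a, y) ∈ F} := by
        rw [← sum_card_row]
        simpa using sum_le_card_nsmul univ _ _ fun x hx => ha x hx
      let e : Equiv.Perm (Fin (n + 1)) := Equiv.swap 0 a
      let F' := F.map (e.prodCongr (Equiv.refl _)).toEmbedding
      have hmem : ∀ x y, (x, y) ∈ F' ↔ (e x, y) ∈ F := by
        intro x y
        simp only [F', mem_map_equiv]
        simp [e]
      have hcard : #F' = #F := card_map _
      have key := this F' (by rw [hcard]; simpa [hmem, e] using hFle)
      rw [hcard] at key
      refine le_of_eq_of_le ?_ key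
      congr 1
      refine card_bij' (fun σ _ => e.trans σ) (fun σ _ => e.trans σ) ?_ ?_ ?_ ?_
      · intro σ hσ
        simp only [mem_filter, mem_univ, true_and, hmem] at hσ ⊢
        intro x
        exact hσ (e x)
      · intro σ hσ
        simp only [mem_filter, mem_univ, true_and, hmem] at hσ ⊢
        intro x
        simpa [e] using hσ (e x)
      · intro σ _
        ext x
        simp [e]
      · intro σ _
        ext x
        simp [e]
    have hn0 : (0 : ℝ) < n := by exact_mod_cast hn
    rw [card_perm_avoiding_succ]
    push_cast
    calc _ ≤ ∑ p with (0, p) ∉ F, (n.factorial : ℝ) *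
          Real.exp (-((#F : ℝ) - #{y | (0, y) ∈ F} - #{x | (x, p) ∈ F}) / (4 * n)) := by
          refine sum_le_sum fun p _ => (ih _).trans ?_
          gcongr
          have := Nat.cast_le (α := ℝ).mpr (card_le_card_minor_add n F p)
          push_cast at this
          linarith
      _ ≤ n.factorial * ((n + 1) * Real.exp (-(#F : ℝ) / (4 * (n + 1)))) := by
          rw [← mul_sum]
          gcongr
          exact sum_exp_minor_le hn F hmax
      _ = _ := by
          rw [Nat.factorial_succ]
          push_cast
          ring

open Finset in
/-- A random family of permutations avoids a family of sets of cells with probability at most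
exponentially small in the total number of cells. -/
theorem card_family_avoiding_le (m ℓ : ℕ) (F : Fin m → Fin m → Finset (Fin ℓ × Fin ℓ)) :
    (#{σ : Fin m → Fin m → Equiv.Perm (Fin ℓ) | ∀ i j x, (x, σ i j x) ∉ F i j} : ℝ) ≤
      Fintype.card (Fin m → Fin m → Equiv.Perm (Fin ℓ)) *
        Real.exp (-(∑ i, ∑ j, (#(F i j) : ℝ)) / (4 * ℓ)) := by
  have hpi : ({σ : Fin m → Fin m → Equiv.Perm (Fin ℓ) | ∀ i j x, (x, σ i j x) ∉ F i j} : Finset _) =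
      Fintype.piFinset fun i => Fintype.piFinset fun j =>
        ({τ : Equiv.Perm (Fin ℓ) | ∀ x, (x, τ x) ∉ F i j} : Finset _) := by
    ext σ
    simp [Fintype.mem_piFinset]
  rw [hpi]
  simp only [Fintype.card_piFinset, Nat.cast_prod]
  calc _ ≤ ∏ i : Fin m, ∏ j : Fin m,
        ((ℓ.factorial : ℝ) * Real.exp (-(#(F i j) : ℝ) / (4 * ℓ))) := by
        gcongr with i _ j _
        exact card_perm_avoiding_le ℓ (F i j)
    _ = _ := by
        simp only [prod_mul_distrib, ← Real.exp_sum]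
        congr 1
        · simp [Fintype.card_perm]
        · congr 1
          simp only [← sum_div, sum_neg_distrib]

theorem tangent_le_mul {a b c : ℝ} (ha : 0 < a) (hb : 0 < b) (hc : 0 ≤ c) :
    3 * c ^ 2 - c ^ 3 * (1 / a) - c ^ 3 * (1 / b) ≤ a * b := by
  obtain ⟨x, hx, rfl⟩ : ∃ x : ℝ, 0 < x ∧ a = x ^ 2 :=
    ⟨√a, Real.sqrt_pos.mpr ha, (Real.sq_sqrt ha.le).symm⟩
  obtain ⟨y, hy, rfl⟩ : ∃ y : ℝ, 0 < y ∧ b = y ^ 2 :=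
    ⟨√b, Real.sqrt_pos.mpr hb, (Real.sq_sqrt hb.le).symm⟩
  have h1 : 0 ≤ (x * y) * (x * y - c) ^ 2 * (x * y + 2 * c) := by positivity
  have h2 : 0 ≤ c ^ 3 * (x - y) ^ 2 := by positivity
  have h3 : 3 * c ^ 2 - c ^ 3 * (1 / x ^ 2) - c ^ 3 * (1 / y ^ 2) =
      (3 * c ^ 2 * (x ^ 2 * y ^ 2) - c ^ 3 * (x ^ 2 + y ^ 2)) / (x ^ 2 * y ^ 2) := by
    field_simp
    ring
  rw [h3, div_le_iff₀ (by positivity)]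
  nlinarith

open Finset in
theorem sum_inv_degree_le {n : ℕ} (H : Finset (Fin n × Fin n)) :
    ∑ p ∈ H, (1 / (#{t | (p.1, t) ∈ H} : ℝ)) ≤ n := by
  calc ∑ p ∈ H, (1 / (#{t | (p.1, t) ∈ H} : ℝ))
      = ∑ p : Fin n × Fin n, if p ∈ H then (1 / (#{t | (p.1, t) ∈ H} : ℝ)) else 0 := by
        rw [← sum_filter]
        simp
    _ = ∑ s : Fin n, #{t | (s, t) ∈ H} * (1 / (#{t | (s, t) ∈ H} : ℝ)) := by
        rw [Fintype.sum_prod_type]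
        refine sum_congr rfl fun s _ => ?_
        dsimp only
        rw [← sum_filter, sum_eq_card_nsmul (b := 1 / (#{t | (s, t) ∈ H} : ℝ)) fun _ _ => rfl,
          nsmul_eq_mul]
    _ ≤ ∑ s : Fin n, (1 : ℝ) := by
        refine sum_le_sum fun s _ => ?_
        rw [mul_one_div]
        exact div_self_le_one _
    _ = n := by simp

open Finset in
/-- If a graph on `n` vertices has average degree at least `c`, the products of the degrees of
the endpoints, summed over all oriented edges, add up to at least `c³n`. -/
theorem le_sum_degree_mul_degree {n : ℕ} (H : Finset (Fin n × Fin n))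
    (hsymm : ∀ s t, (s, t) ∈ H → (t, s) ∈ H) {c : ℝ} (hc : 0 ≤ c) (hH : c * n ≤ #H) :
    c ^ 3 * n ≤ ∑ p ∈ H, (#{t | (p.1, t) ∈ H} : ℝ) * #{t | (p.2, t) ∈ H} := by
  have hpos : ∀ s t, (s, t) ∈ H → (0 : ℝ) < #{t | (s, t) ∈ H} := fun s t h => by
    exact_mod_cast card_pos.mpr ⟨t, by simpa using h⟩
  have h1 := sum_inv_degree_le H
  have h2 : ∑ p ∈ H, (1 / (#{t | (p.2, t) ∈ H} : ℝ)) = ∑ p ∈ H, (1 / (#{t | (p.1, t) ∈ H} : ℝ)) :=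
    sum_bij' (fun p _ => p.swap) (fun p _ => p.swap) (fun p hp => hsymm _ _ hp)
      (fun p hp => hsymm _ _ hp) (by simp) (by simp) (by simp)
  calc c ^ 3 * n ≤ 3 * c ^ 2 * #H - c ^ 3 * n - c ^ 3 * n := by
        nlinarith [mul_le_mul_of_nonneg_left hH (sq_nonneg c)]
    _ ≤ 3 * c ^ 2 * #H - c ^ 3 * (∑ p ∈ H, (1 / (#{t | (p.1, t) ∈ H} : ℝ))) -
          c ^ 3 * (∑ p ∈ H, (1 / (#{t | (p.2, t) ∈ H} : ℝ))) := by
        rw [h2]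
        gcongr
    _ = ∑ p ∈ H, (3 * c ^ 2 - c ^ 3 * (1 / (#{t | (p.1, t) ∈ H} : ℝ)) -
          c ^ 3 * (1 / (#{t | (p.2, t) ∈ H} : ℝ))) := by
        rw [sum_sub_distrib, sum_sub_distrib, mul_sum, mul_sum, sum_const, nsmul_eq_mul]
        ring
    _ ≤ _ := sum_le_sum fun p hp =>
        tangent_le_mul (hpos _ _ hp) (hpos _ _ (hsymm _ _ hp)) hc

/-- The pairs of transversals in `H` whose vertices in the fibers `i` and `j` both lie in `W`. -/
def openPairs {n m : ℕ} (W : Finset (Fin n × Fin m)) (H : Finset (Fin n × Fin n)) (i j : Fin m) :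
    Finset (Fin n × Fin n) :=
  {p ∈ H | (p.1, i) ∈ W ∧ (p.2, j) ∈ W}

open Finset in
theorem sum_card_openPairs {n m : ℕ} (W : Finset (Fin n × Fin m)) (H : Finset (Fin n × Fin n)) :
    ∑ i, ∑ j, #(openPairs W H i j) = ∑ p ∈ H, #{i | (p.1, i) ∈ W} * #{j | (p.2, j) ∈ W} := by
  simp only [openPairs, card_filter]
  refine (sum_congr rfl fun i _ => sum_comm).trans (sum_comm.trans (sum_congr rfl fun p _ => ?_))
  rw [sum_mul_sum]
  refine sum_congr rfl fun i _ => sum_congr rfl fun j _ => ?_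
  by_cases h : (p.1, i) ∈ W <;> simp [h]

open Finset in
theorem card_openPairs_swap {n m : ℕ} (W : Finset (Fin n × Fin m)) {H : Finset (Fin n × Fin n)}
    (hsymm : ∀ s t, (s, t) ∈ H → (t, s) ∈ H) (i j : Fin m) :
    #(openPairs W H i j) = #(openPairs W H j i) := by
  refine card_bij' (fun p _ => p.swap) (fun p _ => p.swap) ?_ ?_ ?_ ?_
  · intro p hp
    simp only [openPairs, mem_filter] at hp ⊢
    exact ⟨hsymm _ _ hp.1, hp.2.2, hp.2.1⟩
  · intro p hp
    simp only [openPairs, mem_filter] at hp ⊢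
    exact ⟨hsymm _ _ hp.1, hp.2.2, hp.2.1⟩
  · simp
  · simp

open Finset in
theorem sum_card_openPairs_le {n m : ℕ} (W : Finset (Fin n × Fin m)) {H : Finset (Fin n × Fin n)}
    (hsymm : ∀ s t, (s, t) ∈ H → (t, s) ∈ H) :
    ∑ i, ∑ j, #(openPairs W H i j) ≤
      2 * (∑ i, ∑ j, if i < j then #(openPairs W H i j) else 0) + m * n ^ 2 := by
  have hsplit : ∀ i j, #(openPairs W H i j) = (if i < j then #(openPairs W H i j) else 0) +
      (if j < i then #(openPairs W H j i) else 0) + (if i = j then #(openPairs W H i j) else 0) := by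
    intro i j
    rcases lt_trichotomy i j with h | h | h
    · simp [h, h.ne, h.not_gt]
    · simp [h]
    · simp [h, h.ne', h.not_gt, card_openPairs_swap W hsymm i j]
  have hdiag : ∑ i, ∑ j, (if i = j then #(openPairs W H i j) else 0) ≤ m * n ^ 2 := by
    simp only [sum_ite_eq, mem_univ, if_true]
    refine (sum_le_card_nsmul univ _ (n ^ 2) fun i _ => ?_).trans (by simp)
    refine (card_le_univ _).trans ?_
    simp [sq]
  calc ∑ i, ∑ j, #(openPairs W H i j) = (∑ i, ∑ j, if i < j then #(openPairs W H i j) else 0) +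
      (∑ i, ∑ j, if j < i then #(openPairs W H j i) else 0) +
      ∑ i, ∑ j, (if i = j then #(openPairs W H i j) else 0) := by
        simp only [← sum_add_distrib]
        exact sum_congr rfl fun i _ => sum_congr rfl fun j _ => hsplit i j
    _ ≤ _ := by
        rw [sum_comm (f := fun i j => if j < i then #(openPairs W H j i) else 0)]
        lia

/-- The cells `(a, b)` of the permutation `σ i j` whose presence would create an edge between open
vertices of an open pair of transversals. -/
def openCells {n m ℓ : ℕ} (v : Fin n → Fin m → Fin ℓ) (W : Finset (Fin n × Fin m))
    (H : Finset (Fin n × Fin n)) (i j : Fin m) : Finset (Fin ℓ × Fin ℓ) :=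
  if i < j then (openPairs W H i j).image fun p => (v p.1 i, v p.2 j) else ∅

open Finset in
theorem card_openCells {n m ℓ : ℕ} {v : Fin n → Fin m → Fin ℓ}
    (hv : ∀ i, Function.Injective fun s => v s i) (W : Finset (Fin n × Fin m))
    (H : Finset (Fin n × Fin n)) (i j : Fin m) :
    #(openCells v W H i j) = if i < j then #(openPairs W H i j) else 0 := by
  unfold openCells
  split_ifs
  · refine card_image_of_injective _ fun p q h => ?_
    simp only [Prod.mk.injEq] at h
    exact Prod.ext (hv i h.1) (hv j h.2)
  · rfl

open Finset in
/-- If many pairs of transversals are open, and each transversal has as many open vertices as it is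
in open pairs, then there are many open cells. -/
theorem le_sum_card_openCells {n m ℓ : ℕ} {v : Fin n → Fin m → Fin ℓ}
    (hv : ∀ i, Function.Injective fun s => v s i) (W : Finset (Fin n × Fin m))
    {H : Finset (Fin n × Fin n)} (hsymm : ∀ s t, (s, t) ∈ H → (t, s) ∈ H)
    (hdeg : ∀ s, #{i | (s, i) ∈ W} = #{t | (s, t) ∈ H}) {c : ℝ} (hc : 0 ≤ c) (hH : c * n ≤ #H) :
    (c ^ 3 * n - m * n ^ 2) / 2 ≤ ∑ i, ∑ j, (#(openCells v W H i j) : ℝ) := by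
  have h1 := sum_card_openPairs_le W hsymm
  rw [sum_card_openPairs] at h1
  simp only [hdeg, ← card_openCells hv] at h1
  have h2 := le_sum_degree_mul_degree H hsymm hc hH
  have h3 : ∑ p ∈ H, (#{t | (p.1, t) ∈ H} : ℝ) * #{t | (p.2, t) ∈ H} ≤
      2 * (∑ i, ∑ j, (#(openCells v W H i j) : ℝ)) + m * n ^ 2 := by exact_mod_cast h1
  linarith

/-- A set of oriented edges, closed under reversal, of the graph `A` on pairs (transversal, fiber)
which is a matching and which joins any two transversals at most once. -/
structure IsRainbowMatching {n m : ℕ} (A : Fin n × Fin m → Fin n × Fin m → Prop)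
    (P : Finset ((Fin n × Fin m) × (Fin n × Fin m))) : Prop where
  rel : ∀ {x y}, (x, y) ∈ P → A x y
  symm : ∀ {x y}, (x, y) ∈ P → (y, x) ∈ P
  unique : ∀ {x y z}, (x, y) ∈ P → (x, z) ∈ P → y = z
  rainbow : ∀ {x y z w}, (x, y) ∈ P → (z, w) ∈ P → x.1 = z.1 → y.1 = w.1 → x = z

/-- The vertices left uncovered by `P`. -/
def freeVertices {n m : ℕ} (P : Finset ((Fin n × Fin m) × (Fin n × Fin m))) :
    Finset (Fin n × Fin m) :=
  {x | ∀ y, (x, y) ∉ P}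

/-- The pairs of distinct transversals not joined by `P`. -/
def freePairs {n m : ℕ} (P : Finset ((Fin n × Fin m) × (Fin n × Fin m))) :
    Finset (Fin n × Fin n) :=
  {p | p.1 ≠ p.2 ∧ ∀ i j, ((p.1, i), (p.2, j)) ∉ P}

namespace IsRainbowMatching

variable {n m : ℕ} {A : Fin n × Fin m → Fin n × Fin m → Prop}
  {P : Finset ((Fin n × Fin m) × (Fin n × Fin m))}

open Finset

theorem empty : IsRainbowMatching A ∅ := by
  constructor <;> simp

theorem exists_maximal (A : Fin n × Fin m → Fin n × Fin m → Prop) :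
    ∃ P, Maximal (IsRainbowMatching A) P :=
  (Set.toFinite {P | IsRainbowMatching A P}).exists_maximal ⟨∅, empty⟩

theorem freePairs_symm (hP : IsRainbowMatching A P) (s t : Fin n) (h : (s, t) ∈ freePairs P) :
    (t, s) ∈ freePairs P := by
  simp only [freePairs, mem_filter, mem_univ, true_and] at h ⊢
  exact ⟨h.1.symm, fun i j hij => h.2 j i (hP.symm hij)⟩

theorem insert_insert (hP : IsRainbowMatching A P) (hA : ∀ x y, A x y → A y x) {x y : Fin n × Fin m}
    (hx : x ∈ freeVertices P) (hy : y ∈ freeVertices P) (hxy : (x.1, y.1) ∈ freePairs P)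
    (h : A x y) : IsRainbowMatching A (insert (x, y) (insert (y, x) P)) := by
  have hyx := hP.freePairs_symm _ _ hxy
  simp only [freeVertices, freePairs, mem_filter, mem_univ, true_and] at hx hy hxy hyx
  obtain ⟨hne, hxy⟩ := hxy
  replace hyx := hyx.2
  have hne' : x ≠ y := fun h => hne (congrArg Prod.fst h)
  have h1 : ∀ {a b}, (a, b) ∈ P → a.1 = x.1 → b.1 = y.1 → False := fun {a b} hab h1 h2 =>
    hxy a.2 b.2 (by rw [← h1, ← h2]; exact hab)
  have h2 : ∀ {a b}, (a, b) ∈ P → a.1 = y.1 → b.1 = x.1 → False := fun {a b} hab h1 h2 =>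
    hyx a.2 b.2 (by rw [← h1, ← h2]; exact hab)
  constructor
  · intro a b hab
    simp only [mem_insert, Prod.mk.injEq] at hab
    rcases hab with ⟨rfl, rfl⟩ | ⟨rfl, rfl⟩ | hab
    exacts [h, hA _ _ h, hP.rel hab]
  · intro a b hab
    simp only [mem_insert, Prod.mk.injEq] at hab ⊢
    rcases hab with ⟨rfl, rfl⟩ | ⟨rfl, rfl⟩ | hab
    exacts [by simp, by simp, Or.inr (Or.inr (hP.symm hab))]
  · intro a b c hb hc
    simp only [mem_insert, Prod.mk.injEq] at hb hc
    rcases hb with ⟨rfl, rfl⟩ | ⟨rfl, rfl⟩ | hb <;> rcases hc with ⟨h3, h4⟩ | ⟨h3, h4⟩ | hc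
    · exact h4.symm
    · exact absurd h3 hne'
    · exact absurd hc (hx _)
    · exact absurd h3.symm hne'
    · exact h4.symm
    · exact absurd hc (hy _)
    · exact absurd (h3 ▸ hb) (hx _)
    · exact absurd (h3 ▸ hb) (hy _)
    · exact hP.unique hb hc
  · intro a b a' b' hb hc e1 e2
    simp only [mem_insert, Prod.mk.injEq] at hb hc
    rcases hb with ⟨rfl, rfl⟩ | ⟨rfl, rfl⟩ | hb <;> rcases hc with ⟨h3, h4⟩ | ⟨h3, h4⟩ | hc
    · exact h3.symm
    · exact absurd (h3 ▸ e1) hne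
    · exact (h1 hc e1.symm e2.symm).elim
    · exact absurd (h3 ▸ e1).symm hne
    · exact h3.symm
    · exact (h2 hc e1.symm e2.symm).elim
    · exact (h1 hb (h3 ▸ e1) (h4 ▸ e2)).elim
    · exact (h2 hb (h3 ▸ e1) (h4 ▸ e2)).elim
    · exact hP.rainbow hb hc e1 e2

theorem not_rel_of_maximal (hP : Maximal (IsRainbowMatching A) P) (hA : ∀ x y, A x y → A y x)
    {x y : Fin n × Fin m} (hx : x ∈ freeVertices P) (hy : y ∈ freeVertices P)
    (hxy : (x.1, y.1) ∈ freePairs P) : ¬ A x y := by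
  intro h
  have hle := hP.2 (hP.1.insert_insert hA hx hy hxy h)
    (fun p hp => mem_insert_of_mem (mem_insert_of_mem hp))
  have : (x, y) ∈ P := hle (mem_insert_self _ _)
  simp only [freeVertices, mem_filter, mem_univ, true_and] at hx
  exact hx y this

/-- A transversal has as many uncovered vertices as there are transversals it is not joined to. -/
theorem card_freeVertices_eq (hP : IsRainbowMatching A P) (hne : ∀ x y, A x y → x.1 ≠ y.1)
    (hn : n = m + 1) (s : Fin n) :
    #{i | (s, i) ∈ freeVertices P} = #{t | (s, t) ∈ freePairs P} := by
  classical
  let Q := P.filter fun q => q.1.1 = s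
  have hQ : ∀ {q}, q ∈ Q ↔ q ∈ P ∧ q.1.1 = s := by simp [Q]
  have h1 : #(Q.image fun q => q.1.2) = #Q := by
    refine card_image_of_injOn ?_
    rintro ⟨x, y⟩ hq ⟨x', y'⟩ hq' h
    obtain ⟨hq, e⟩ := hQ.mp hq
    obtain ⟨hq', e'⟩ := hQ.mp hq'
    obtain rfl : x = x' := Prod.ext (e.trans e'.symm) h
    rw [hP.unique hq hq']
  have h2 : #(Q.image fun q => q.2.1) = #Q := by
    refine card_image_of_injOn ?_
    rintro ⟨x, y⟩ hq ⟨x', y'⟩ hq' h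
    obtain ⟨hq, e⟩ := hQ.mp hq
    obtain ⟨hq', e'⟩ := hQ.mp hq'
    obtain rfl : x = x' := hP.rainbow hq hq' (e.trans e'.symm) h
    rw [hP.unique hq hq']
  have h3 : ({i | (s, i) ∈ freeVertices P} : Finset (Fin m)) = (Q.image fun q => q.1.2)ᶜ := by
    ext i
    simp only [freeVertices, mem_filter, mem_univ, true_and, mem_compl, mem_image, hQ]
    constructor
    · rintro h ⟨⟨⟨a, b⟩, y⟩, ⟨hq, rfl⟩, rfl⟩
      exact h _ hq
    · intro h y hy
      exact h ⟨_, ⟨hy, rfl⟩, rfl⟩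
  have h4 : ({t | (s, t) ∈ freePairs P} : Finset (Fin n)) =
      (insert s (Q.image fun q => q.2.1))ᶜ := by
    ext t
    simp only [freePairs, mem_filter, mem_univ, true_and, mem_compl, mem_insert, mem_image, hQ,
      not_or]
    refine and_congr ne_comm ⟨?_, ?_⟩
    · rintro h ⟨⟨⟨a, b⟩, ⟨c, d⟩⟩, ⟨hq, rfl⟩, rfl⟩
      exact h _ _ hq
    · intro h i j hij
      exact h ⟨_, ⟨hij, rfl⟩, rfl⟩
  have h5 : s ∉ Q.image fun q => q.2.1 := by
    simp only [mem_image, hQ, not_exists, not_and]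
    rintro ⟨x, y⟩ ⟨hq, e⟩ e'
    exact hne _ _ (hP.rel hq) (e.trans e'.symm)
  rw [h3, h4, card_compl, card_compl, card_insert_of_notMem h5, h1, h2, Fintype.card_fin,
    Fintype.card_fin]
  lia

theorem two_mul_card_filter_lt_freePairs_le (hP : IsRainbowMatching A P) :
    2 * #{p ∈ freePairs P | p.1 < p.2} ≤ #(freePairs P) := by
  have h : #{p ∈ freePairs P | p.1 < p.2} = #{p ∈ freePairs P | p.2 < p.1} := by
    refine card_bij' (fun p _ => p.swap) (fun p _ => p.swap) ?_ ?_ (by simp) (by simp)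
    all_goals
      intro p hp
      simp only [mem_filter, Prod.fst_swap, Prod.snd_swap] at hp ⊢
      exact ⟨hP.freePairs_symm _ _ hp.1, hp.2⟩
  have hdisj : Disjoint ({p ∈ freePairs P | p.1 < p.2} : Finset _)
      ({p ∈ freePairs P | p.2 < p.1} : Finset _) :=
    disjoint_filter.mpr fun p _ h => h.not_gt
  rw [two_mul]
  nth_rewrite 2 [h]
  rw [← card_union_of_disjoint hdisj]
  exact card_le_card (union_subset (filter_subset _ _) (filter_subset _ _))

end IsRainbowMatching

/-- The adjacency relation of a graph on `Fin m × Fin ℓ` pulled back to pairs (transversal, fiber),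
where `v s i` is the position of the vertex of the transversal `s` in the fiber `i`. -/
def crossAdj {n m ℓ : ℕ} (G : SimpleGraph (Fin m × Fin ℓ)) (v : Fin n → Fin m → Fin ℓ)
    (x y : Fin n × Fin m) : Prop :=
  x.1 ≠ y.1 ∧ G.Adj (x.2, v x.1 x.2) (y.2, v y.1 y.2)

theorem crossAdj_symm {n m ℓ : ℕ} {G : SimpleGraph (Fin m × Fin ℓ)} {v : Fin n → Fin m → Fin ℓ}
    (x y : Fin n × Fin m) (h : crossAdj G v x y) : crossAdj G v y x :=
  ⟨h.1.symm, h.2.symm⟩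

/-- A rainbow matching gives a matching of the graph joining all pairs that are not free. -/
theorem exists_subgraph_isMatching {n m ℓ : ℕ} {G : SimpleGraph (Fin m × Fin ℓ)}
    {v : Fin n → Fin m → Fin ℓ} (hv : ∀ i, Function.Injective fun s => v s i)
    {P : Finset ((Fin n × Fin m) × (Fin n × Fin m))} (hP : IsRainbowMatching (crossAdj G v) P) :
    ∃ M : G.Subgraph, M.IsMatching ∧ ∀ s t, s ≠ t → (s, t) ∉ freePairs P →
      ∃ i j, M.Adj (i, v s i) (j, v t j) := by
  let vert : Fin n × Fin m → Fin m × Fin ℓ := fun x => (x.2, v x.1 x.2)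
  have hinj : Function.Injective vert := by
    rintro ⟨s, i⟩ ⟨t, j⟩ h
    simp only [vert, Prod.mk.injEq] at h
    obtain ⟨rfl, h⟩ := h
    rw [hv i h]
  let M : G.Subgraph :=
    { verts := {u | ∃ x y, (x, y) ∈ P ∧ u = vert x}
      Adj := fun u w => ∃ x y, (x, y) ∈ P ∧ u = vert x ∧ w = vert y
      adj_sub := by
        rintro u w ⟨x, y, h, rfl, rfl⟩
        exact (hP.rel h).2
      edge_vert := by
        rintro u w ⟨x, y, h, rfl, rfl⟩
        exact ⟨x, y, h, rfl⟩
      symm := ⟨by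
        rintro u w ⟨x, y, h, rfl, rfl⟩
        exact ⟨y, x, hP.symm h, rfl, rfl⟩⟩ }
  refine ⟨M, ?_, ?_⟩
  · rintro u ⟨x, y, h, rfl⟩
    refine ⟨vert y, ⟨x, y, h, rfl, rfl⟩, ?_⟩
    rintro w ⟨x', y', h', hx, rfl⟩
    obtain rfl := hinj hx
    rw [hP.unique h h']
  · intro s t hst hfree
    simp only [freePairs, Finset.mem_filter, Finset.mem_univ, true_and, not_and, not_forall,
      not_not] at hfree
    obtain ⟨i, j, hij⟩ := hfree hst
    exact ⟨i, j, _, _, hij, rfl, rfl⟩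

/-- The permutations of a lift miss all cells that are open for a maximal rainbow matching. -/
theorem notMem_openCells {n m ℓ : ℕ} {σ : Fin m → Fin m → Equiv.Perm (Fin ℓ)}
    {v : Fin n → Fin m → Fin ℓ} {P : Finset ((Fin n × Fin m) × (Fin n × Fin m))}
    (hP : Maximal (IsRainbowMatching (crossAdj (liftGraph m ℓ σ) v)) P) (i j : Fin m) (x : Fin ℓ) :
    (x, σ i j x) ∉ openCells v (freeVertices P) (freePairs P) i j := by
  intro h
  unfold openCells at h
  split_ifs at h with hij
  · simp only [openPairs, Finset.mem_image, Finset.mem_filter, Prod.mk.injEq] at h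
    obtain ⟨⟨s, t⟩, ⟨hst, hs, ht⟩, rfl, hσ⟩ := h
    refine IsRainbowMatching.not_rel_of_maximal hP crossAdj_symm hs ht hst ⟨?_, ?_⟩
    · simp only [freePairs, Finset.mem_filter] at hst
      exact hst.2.1
    · rw [liftGraph, SimpleGraph.fromRel_adj]
      exact ⟨fun h => hij.ne (congrArg Prod.fst h), Or.inl ⟨hij, hσ.symm⟩⟩
  · simp at h

open Finset in
/-- The families of permutations missing all open cells of some admissible configuration with many
open pairs are exponentially rare. -/
theorem card_exists_avoiding_le {n m ℓ : ℕ} (hmn : m ≤ n) (hℓ : 0 < ℓ) {γ : ℝ} (hγ : 0 < γ)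
    (hn : 1 ≤ 4 * γ ^ 3 * n) (hle : (ℓ : ℝ) ≤ γ ^ 3 / 48 * n ^ 2) {v : Fin n → Fin m → Fin ℓ}
    (hv : ∀ i, Function.Injective fun s => v s i)
    (B : Finset (Fin m → Fin m → Equiv.Perm (Fin ℓ)))
    (hB : ∀ σ ∈ B, ∃ (W : Finset (Fin n × Fin m)) (H : Finset (Fin n × Fin n)),
      (∀ s t, (s, t) ∈ H → (t, s) ∈ H) ∧ (∀ s, #{i | (s, i) ∈ W} = #{t | (s, t) ∈ H}) ∧
      2 * γ * n * n ≤ #H ∧ ∀ i j x, (x, σ i j x) ∉ openCells v W H i j) :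
    (#B : ℝ) ≤ Real.exp (-(22 * n ^ 2)) *
      Fintype.card (Fin m → Fin m → Equiv.Perm (Fin ℓ)) := by
  classical
  let C : Finset (Finset (Fin n × Fin m) × Finset (Fin n × Fin n)) :=
    {c | (∀ s t, (s, t) ∈ c.2 → (t, s) ∈ c.2) ∧ (∀ s, #{i | (s, i) ∈ c.1} = #{t | (s, t) ∈ c.2}) ∧
      2 * γ * n * n ≤ #c.2}
  have hsub : B ⊆ C.biUnion fun c => {σ | ∀ i j x, (x, σ i j x) ∉ openCells v c.1 c.2 i j} := by
    intro σ hσ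
    obtain ⟨W, H, h1, h2, h3, h4⟩ := hB σ hσ
    simp only [C, mem_biUnion, mem_filter, mem_univ, true_and]
    exact ⟨(W, H), ⟨h1, h2, h3⟩, h4⟩
  have hC : (#C : ℝ) ≤ Real.exp (2 * n ^ 2) := by
    have h1 : #C ≤ 2 ^ (n * m) * 2 ^ (n * n) := by
      refine (card_le_univ C).trans (le_of_eq ?_)
      simp
    have h2 : 2 ^ (n * m) * 2 ^ (n * n) ≤ 2 ^ (2 * n ^ 2) := by
      rw [← pow_add]
      refine Nat.pow_le_pow_right (by norm_num) ?_
      nlinarith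
    calc (#C : ℝ) ≤ 2 ^ (2 * n ^ 2) := by exact_mod_cast h1.trans h2
      _ ≤ Real.exp 1 ^ (2 * n ^ 2) := by
        gcongr
        linarith [Real.add_one_le_exp (1 : ℝ)]
      _ = Real.exp (2 * n ^ 2) := by
        rw [← Real.exp_nat_mul]
        push_cast
        ring_nf
  have hcells : ∀ c ∈ C, (24 : ℝ) * n ^ 2 ≤
      (∑ i, ∑ j, (#(openCells v c.1 c.2 i j) : ℝ)) / (4 * ℓ) := by
    intro c hc
    obtain ⟨h1, h2, h3⟩ := (mem_filter.mp hc).2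
    have hlow := le_sum_card_openCells hv c.1 h1 h2 (c := 2 * γ * n) (by positivity) h3
    have hm : (m : ℝ) ≤ n := by exact_mod_cast hmn
    rw [le_div_iff₀ (by positivity)]
    refine le_trans ?_ hlow
    have e1 : (m : ℝ) * n ^ 2 ≤ 4 * γ ^ 3 * n * n * n ^ 2 := by
      have : (m : ℝ) ≤ 4 * γ ^ 3 * n * n := by nlinarith [Nat.cast_nonneg (α := ℝ) n]
      gcongr
    have e2 : (24 : ℝ) * n ^ 2 * (4 * ℓ) ≤ 24 * n ^ 2 * (4 * (γ ^ 3 / 48 * n ^ 2)) := by gcongr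
    linarith
  calc (#B : ℝ) ≤ ∑ c ∈ C, (#{σ : Fin m → Fin m → Equiv.Perm (Fin ℓ) |
        ∀ i j x, (x, σ i j x) ∉ openCells v c.1 c.2 i j} : ℝ) := by
        exact_mod_cast (card_le_card hsub).trans card_biUnion_le
    _ ≤ ∑ c ∈ C, Fintype.card (Fin m → Fin m → Equiv.Perm (Fin ℓ)) *
          Real.exp (-(24 * n ^ 2)) := by
        refine sum_le_sum fun c hc => (card_family_avoiding_le m ℓ _).trans ?_
        gcongr
        rw [neg_div]
        exact neg_le_neg (hcells c hc)
    _ = #C * (Fintype.card (Fin m → Fin m → Equiv.Perm (Fin ℓ)) * Real.exp (-(24 * n ^ 2))) := by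
        rw [sum_const, nsmul_eq_mul]
    _ ≤ Real.exp (2 * n ^ 2) *
          (Fintype.card (Fin m → Fin m → Equiv.Perm (Fin ℓ)) * Real.exp (-(24 * n ^ 2))) := by
        gcongr
    _ = _ := by
        rw [mul_left_comm, ← Real.exp_add, mul_comm]
        ring_nf

open Finset in
theorem le_liftProb {n ℓ : ℕ} {p : SimpleGraph (Fin n × Fin ℓ) → Prop} {δ : ℝ}
    (h : (#(@filter _ (fun σ : Fin n → Fin n → Equiv.Perm (Fin ℓ) => ¬ p (liftGraph n ℓ σ))
      (Classical.decPred _) univ) : ℝ) ≤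
        δ * Fintype.card (Fin n → Fin n → Equiv.Perm (Fin ℓ))) :
    1 - δ ≤ liftProb n ℓ p := by
  classical
  have hpos : (0 : ℝ) < Fintype.card (Fin n → Fin n → Equiv.Perm (Fin ℓ)) := by
    exact_mod_cast Fintype.card_pos
  unfold liftProb
  rw [le_div_iff₀ hpos]
  have hsum := card_filter_add_card_filter_not
    (s := (univ : Finset (Fin n → Fin n → Equiv.Perm (Fin ℓ)))) fun σ => p (liftGraph n ℓ σ)
  rw [card_univ] at hsum
  have hsum' := congrArg (Nat.cast (R := ℝ)) hsum
  push_cast at hsum'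
  have e : ∀ (q : (Fin n → Fin n → Equiv.Perm (Fin ℓ)) → Prop) (d d' : DecidablePred q),
      @filter _ q d univ = @filter _ q d' univ := fun q d d' => by congr
  rw [e _ _ (Classical.decPred _)] at h ⊢
  rw [e _ _ (Classical.decPred _), e (fun σ => ¬ p (liftGraph n ℓ σ)) _ (Classical.decPred _)]
    at hsum'
  linarith

/-- For `n ≤ ℓ ≤ (γ³/48)n²` and disjoint transversals `V₁, …, Vₙ` of the `ℓ`-lift of
`K_{n-1}`, with probability at least `1 - δ` the lift contains a matching `M` such that
for all but at most `γn²` pairs `i < j`, `M` has an edge from `Vᵢ` to `Vⱼ`. -/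
theorem stmt11 (γ : ℝ) (hγ : 0 < γ) (δ : ℝ) (hδ : 0 < δ) :
    ∃ N : ℕ, ∀ n : ℕ, N ≤ n → ∀ ℓ : ℕ, n ≤ ℓ → (ℓ : ℝ) ≤ γ ^ 3 / 48 * n ^ 2 →
      ∀ Vt : Fin n → Set (Fin (n - 1) × Fin ℓ),
        (∀ i, IsTransversal (Vt i)) →
        (∀ i j, i ≠ j → Disjoint (Vt i) (Vt j)) →
        1 - δ ≤ liftProb (n - 1) ℓ (fun G =>
          ∃ M : G.Subgraph, M.IsMatching ∧
            (({p : Fin n × Fin n | p.1 < p.2 ∧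
                ¬ ∃ u ∈ Vt p.1, ∃ v ∈ Vt p.2, M.Adj u v}).ncard : ℝ) ≤ γ * n ^ 2) := by
  obtain ⟨N, hN⟩ := exists_nat_ge (max 1 (max (1 / (4 * γ ^ 3)) (Real.log (1 / δ))))
  simp only [max_le_iff] at hN
  refine ⟨N, fun n hNn ℓ hnℓ hℓ Vt htrans hdisj => ?_⟩
  have hNn' : (N : ℝ) ≤ n := by exact_mod_cast hNn
  have hn1 : (1 : ℝ) ≤ n := hN.1.trans hNn'
  have hn1' : 1 ≤ n := by exact_mod_cast hn1
  have hγn : 1 ≤ 4 * γ ^ 3 * n := by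
    have := hN.2.1.trans hNn'
    rwa [div_le_iff₀' (by positivity)] at this
  have hδn : Real.exp (-(22 * (n : ℝ) ^ 2)) ≤ δ := by
    have h1 := hN.2.2.trans hNn'
    rw [one_div, Real.log_inv] at h1
    calc Real.exp (-(22 * (n : ℝ) ^ 2)) ≤ Real.exp (Real.log δ) := by
          gcongr
          nlinarith
      _ = δ := Real.exp_log hδ
  have hex : ∀ s i, ∃ a, (i, a) ∈ Vt s := fun s i => by
    obtain ⟨⟨_, a⟩, ⟨h, rfl⟩, -⟩ := htrans s i
    exact ⟨a, h⟩
  choose v hv using hex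
  have hinj : ∀ i, Function.Injective fun s => v s i := fun i s t (hst : v s i = v t i) => by
    by_contra hne
    exact Set.disjoint_left.mp (hdisj s t hne) (hv s i) (hst ▸ hv t i)
  refine le_liftProb ?_
  refine (card_exists_avoiding_le (Nat.sub_le n 1) (hn1'.trans hnℓ) hγ hγn hℓ hinj _
    fun σ hσ => ?_).trans (mul_le_mul_of_nonneg_right hδn (Nat.cast_nonneg _))
  replace hσ := ((@Finset.mem_filter _ _ (Classical.decPred _) _ _).mp hσ).2
  obtain ⟨P, hP⟩ := IsRainbowMatching.exists_maximal (crossAdj (liftGraph (n - 1) ℓ σ) v)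
  refine ⟨freeVertices P, freePairs P, hP.1.freePairs_symm,
    hP.1.card_freeVertices_eq (fun _ _ h => h.1) (by lia), ?_, notMem_openCells hP⟩
  obtain ⟨M, hM, hMP⟩ := exists_subgraph_isMatching hinj hP.1
  by_contra! hfew
  refine hσ ⟨M, hM, ?_⟩
  have hsub : {p : Fin n × Fin n | p.1 < p.2 ∧ ¬ ∃ u ∈ Vt p.1, ∃ w ∈ Vt p.2, M.Adj u w} ⊆
      (((freePairs P).filter fun p => p.1 < p.2 : Finset (Fin n × Fin n)) : Set _) := by
    rintro ⟨s, t⟩ ⟨hst, hno⟩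
    simp only [Finset.coe_filter, Set.mem_ofPred_eq]
    refine ⟨?_, hst⟩
    by_contra hfree
    obtain ⟨i, j, hij⟩ := hMP s t (ne_of_lt hst) hfree
    exact hno ⟨_, hv s i, _, hv t j, hij⟩
  have hcard := Set.ncard_le_ncard hsub (Finset.finite_toSet _)
  rw [Set.ncard_coe_finset] at hcard
  have htwo : (2 : ℝ) * {p : Fin n × Fin n | p.1 < p.2 ∧
      ¬ ∃ u ∈ Vt p.1, ∃ w ∈ Vt p.2, M.Adj u w}.ncard ≤ (freePairs P).card := by
    exact_mod_cast (Nat.mul_le_mul_left 2 hcard).trans hP.1.two_mul_card_filter_lt_freePairs_le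
  linarith
end
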